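/- Let K be an algebraically closed field, Q a finite quiver with vertex set Q_0 and arrow set Q_1, and α a dimension vector for Q. The ring of quiver invariants I(Q,α) = K[Rep(Q,α)]^{GL(α)} is generated by its homogeneous elements of degree at most (M+1)·N^4, where M = |Q_1| is the number of arrows and N = Σ_{i∈Q_0} α_i. -/

import Mathlib

open MvPolynomial Matrix

/-- Coordinate functions of a representation of a quiver with arrows `Q1`,
tail/head maps `ta ha : Q1 → Q0` and dimension vector `α`. -/
def repCoords {K : Type} [Field K] {Q0 Q1 : Type} {ta ha : Q1 → Q0} {α : Q0 → ℕ}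
    (v : (a : Q1) → Matrix (Fin (α (ha a))) (Fin (α (ta a))) K) :
    ((a : Q1) × (Fin (α (ha a)) × Fin (α (ta a)))) → K :=
  fun p => v p.1 p.2.1 p.2.2

/-- The ring of quiver invariants `I(Q,α) = K[Rep(Q,α)]^{GL(α)}`. -/
noncomputable def quiverInvariants (K : Type) [Field K] {Q0 Q1 : Type}
    (ta ha : Q1 → Q0) (α : Q0 → ℕ) :
    Subalgebra K (MvPolynomial ((a : Q1) × (Fin (α (ha a)) × Fin (α (ta a)))) K) :=
  ⨅ (A : (i : Q0) → GeneralLinearGroup (Fin (α i)) K)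
    (v : (a : Q1) → Matrix (Fin (α (ha a))) (Fin (α (ta a))) K),
      AlgHom.equalizer
        (aeval (repCoords fun a => (A (ha a)).val * v a * ((A (ta a))⁻¹).val))
        (aeval (repCoords v))

/-- The ring of quiver semi-invariants `SI(Q,α) = K[Rep(Q,α)]^{SL(α)}`. -/
noncomputable def quiverSemiInvariants (K : Type) [Field K] {Q0 Q1 : Type}
    (ta ha : Q1 → Q0) (α : Q0 → ℕ) :
    Subalgebra K (MvPolynomial ((a : Q1) × (Fin (α (ha a)) × Fin (α (ta a)))) K) :=
  ⨅ (A : (i : Q0) → SpecialLinearGroup (Fin (α i)) K)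
    (v : (a : Q1) → Matrix (Fin (α (ha a))) (Fin (α (ta a))) K),
      AlgHom.equalizer
        (aeval (repCoords fun a => (A (ha a)).val * v a * ((A (ta a))⁻¹).val))
        (aeval (repCoords v))

/-- The weight space `SI(Q,α)_σ` of semi-invariants of weight `σ : Q0 → ℤ`:
those `f` with `A · f = (∏ i, det (A i) ^ σ i) • f`, i.e.
`f(A⁻¹ · v) = (∏ i, det (A i) ^ σ i) * f(v)` for all `A ∈ GL(α)`. -/
noncomputable def quiverSemiInvariantsOfWeight (K : Type) [Field K] {Q0 Q1 : Type}
    [Fintype Q0] (ta ha : Q1 → Q0) (α : Q0 → ℕ) (σ : Q0 → ℤ) :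
    Submodule K (MvPolynomial ((a : Q1) × (Fin (α (ha a)) × Fin (α (ta a)))) K) where
  carrier := { f | ∀ (A : (i : Q0) → GeneralLinearGroup (Fin (α i)) K)
      (v : (a : Q1) → Matrix (Fin (α (ha a))) (Fin (α (ta a))) K),
      aeval (repCoords fun a => ((A (ha a))⁻¹).val * v a * (A (ta a)).val) f
        = (∏ i : Q0, ((A i).val.det) ^ (σ i)) * aeval (repCoords v) f }
  add_mem' := by
    intro f g hf hg A v
    rw [map_add, map_add, hf A v, hg A v, mul_add]
  zero_mem' := by
    intro A v
    simp
  smul_mem' := by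
    intro c f hf A v
    rw [_root_.map_smul, _root_.map_smul, hf A v, smul_eq_mul, smul_eq_mul]
    ring

/-- `IsQuiverPath ta ha x y l` : the list of arrows `l` is a directed path from
vertex `x` to vertex `y`. -/
def IsQuiverPath {Q0 Q1 : Type} (ta ha : Q1 → Q0) (x y : Q0) : List Q1 → Prop
  | [] => x = y
  | a :: l =>
      ta a = x ∧ List.Chain' (fun b c => ha b = ta c) (a :: l) ∧
        ha ((a :: l).getLast (List.cons_ne_nil a l)) = y

/-- The number of directed paths from `x` to `y`. -/
noncomputable def numQuiverPaths {Q0 Q1 : Type} (ta ha : Q1 → Q0) (x y : Q0) : ℕ :=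
  Nat.card { l : List Q1 // IsQuiverPath ta ha x y l }

/-- A quiver has no oriented cycles if there is no nonempty directed path from a
vertex to itself. -/
def HasNoOrientedCycles {Q0 Q1 : Type} (ta ha : Q1 → Q0) : Prop :=
  ∀ (x : Q0) (l : List Q1), l ≠ [] → ¬ IsQuiverPath ta ha x x l

namespace QInv

section P3
variable {σ : Type} [Fintype σ] {K : Type} [Field K]

/-- aeval of homogeneous poly differences -/
lemma multiset_prod_sub_mem {S ι : Type} [CommRing S] [Algebra K S] (G G' : Submodule K S)
    (a b : ι → S) (ha : ∀ i, a i ∈ G) (hb : ∀ i, b i ∈ G) (hab : ∀ i, a i - b i ∈ G')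
    (d : ℕ) (m : Multiset ι) (hm : m.card = d + 1) :
    (m.map a).prod - (m.map b).prod ∈ G' * G ^ d := by
  have key : ∀ (m : Multiset ι), (m.map a).prod ∈ G ^ m.card := by
    intro m
    induction m using Multiset.induction_on with
    | empty => simp [Submodule.one_le.mp le_rfl]
    | cons x m ih =>
      simp only [Multiset.map_cons, Multiset.prod_cons, Multiset.card_cons]
      rw [pow_succ']
      exact Submodule.mul_mem_mul (ha x) ih
  induction m using Multiset.induction_on generalizing d with
  | empty => simp at hm
  | cons x m ih =>
    simp only [Multiset.map_cons, Multiset.prod_cons, Multiset.card_cons] at hm ⊢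
    have hm' : m.card = d := by omega
    have e : a x * (m.map a).prod - b x * (m.map b).prod
      = (a x - b x) * (m.map a).prod + b x * ((m.map a).prod - (m.map b).prod) := by ring
    rw [e]
    refine add_mem (Submodule.mul_mem_mul (hab x) (hm' ▸ key m)) ?_
    rcases d with _ | d
    · have : m = 0 := by simpa using hm'
      subst this
      simp
    · have := Submodule.mul_mem_mul (hb x) (ih d hm')
      rwa [← mul_assoc, mul_comm G G', mul_assoc, ← pow_succ'] at this

lemma aeval_sub_mem {S ι : Type} [CommRing S] [Algebra K S] (G G' : Submodule K S)
    (a b : ι → S) (ha : ∀ i, a i ∈ G) (hb : ∀ i, b i ∈ G) (hab : ∀ i, a i - b i ∈ G')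
    (d : ℕ) (P : MvPolynomial ι K) (hP : P.IsHomogeneous (d + 1)) :
    aeval a P - aeval b P ∈ G' * G ^ d := by
  rw [P.as_sum, map_sum, map_sum, ← Finset.sum_sub_distrib]
  refine Submodule.sum_mem _ fun m hm => ?_
  rw [aeval_monomial, aeval_monomial, ← mul_sub, ← Algebra.smul_def]
  refine Submodule.smul_mem _ _ ?_
  have h1 : ∀ c : ι → S, (m.prod fun i k => c i ^ k) = ((Finsupp.toMultiset m).map c).prod := by
    intro c
    classical
    rw [Finsupp.toMultiset_map, Finsupp.prod_toMultiset, Finsupp.prod_mapDomain_index] <;>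
      simp [pow_add]
  rw [h1, h1]
  refine multiset_prod_sub_mem G G' a b ha hb hab d _ ?_
  rw [Finsupp.card_toMultiset]
  have := hP (mem_support_iff.mp hm)
  simpa [Finsupp.weight_apply, Finsupp.sum] using this

lemma aeval_smul_hom {S ι : Type} [CommRing S] [Algebra K S] (c : ι → S) (x : S) (d : ℕ)
    (P : MvPolynomial ι K) (hP : P.IsHomogeneous d) :
    aeval (fun i => x * c i) P = x ^ d * aeval c P := by
  rw [P.as_sum, map_sum, map_sum, Finset.mul_sum]
  refine Finset.sum_congr rfl fun m hm => ?_
  rw [aeval_monomial, aeval_monomial]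
  have := hP (mem_support_iff.mp hm)
  have hd : m.sum (fun _ k => k) = d := by
    simpa [Finsupp.weight_apply, Finsupp.sum] using this
  simp only [Finsupp.prod, mul_pow, Finset.prod_mul_distrib]
  rw [Finset.prod_pow_eq_pow_sum, ← hd, Finsupp.sum]
  ring

lemma exists_hom_rel {ι : Type} [Fintype ι] (g : ι → MvPolynomial σ K)
    (h : Fintype.card σ + 1 < Fintype.card ι) :
    ∃ (d : ℕ) (P : MvPolynomial ι K), P ≠ 0 ∧ P.IsHomogeneous d ∧ aeval g P = 0 := by
  let y : ι → Polynomial (MvPolynomial σ K) := fun i => Polynomial.X * Polynomial.C (g i)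
  have hy : ¬ AlgebraicIndependent K y := by
    intro hy
    have h1 := hy.lift_cardinalMk_le_trdeg
    rw [← (optionEquivLeft K σ).trdeg_eq, MvPolynomial.trdeg_of_isDomain] at h1
    simp at h1
    norm_cast at h1
    omega
  rw [algebraicIndependent_iff] at hy
  push Not at hy
  obtain ⟨P0, h0, hne⟩ := hy
  obtain ⟨d, hd⟩ : ∃ d, homogeneousComponent d P0 ≠ 0 := by
    by_contra hcon
    push Not at hcon
    apply hne
    rw [← sum_homogeneousComponent P0]
    exact Finset.sum_eq_zero fun i _ => hcon i
  refine ⟨d, _, hd, homogeneousComponent_isHomogeneous d P0, ?_⟩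
  have h2 : ∀ n, aeval y (homogeneousComponent n P0)
      = Polynomial.X ^ n * Polynomial.C (aeval g (homogeneousComponent n P0)) := by
    intro n
    rw [aeval_smul_hom (fun i => Polynomial.C (g i)) _ n _ (homogeneousComponent_isHomogeneous n P0)]
    congr 1
    have := (map_aeval (R := K) g (Polynomial.C : MvPolynomial σ K →+* _)
      (homogeneousComponent n P0))
    rw [this]
    rfl
  rw [← sum_homogeneousComponent P0, map_sum] at h0
  have h3 := congrArg (fun q => Polynomial.coeff q d) h0
  simp only [h2, Polynomial.finsetSum_coeff, Polynomial.coeff_X_pow_mul', Polynomial.coeff_C,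
    Polynomial.coeff_zero] at h3
  by_cases hdd : d ∈ Finset.range (P0.totalDegree + 1)
  · rw [Finset.sum_eq_single_of_mem d hdd] at h3
    · simpa using h3
    · intro b _ hb
      split_ifs with h4 h5
      · omega
      · rfl
      · rfl
  · exfalso
    apply hd
    apply homogeneousComponent_eq_zero
    simp at hdd
    omega

lemma span_pow_le {S : Type} [CommRing S] [Algebra K S] (G G' : Submodule K S) (x : S)
    (hx : x ∈ G) (hG' : G' ≤ G)
    (hG : G ≤ G' ⊔ Submodule.span K {x}) (d : ℕ) :
    G ^ (d + 1) ≤ G' * G ^ d ⊔ Submodule.span K {x ^ (d + 1)} := by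
  induction d with
  | zero => simpa using hG
  | succ d ih =>
    rw [pow_succ' G (d+1)]
    calc G * G ^ (d + 1) ≤ (G' ⊔ Submodule.span K {x}) * G ^ (d+1) := by gcongr
      _ ≤ G' * G ^ (d + 1) ⊔ Submodule.span K {x} * (G' * G ^ d ⊔ Submodule.span K {x ^ (d + 1)}) := by
          rw [Submodule.sup_mul]; gcongr
      _ ≤ _ := by
        rw [Submodule.mul_sup, Submodule.span_mul_span]
        refine sup_le le_sup_left (sup_le ?_ ?_)
        · refine le_trans ?_ le_sup_left
          rw [← mul_assoc, mul_comm _ G', mul_assoc, pow_succ' G d]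
          gcongr
          simpa using hx
        · refine le_trans ?_ le_sup_right
          simp [pow_succ' x (d+1)]

lemma reduce_one [Infinite K] (T : Finset (MvPolynomial σ K))
    (h : Fintype.card σ + 1 < T.card) :
    ∃ (T' : Finset (MvPolynomial σ K)) (d : ℕ), T'.card < T.card ∧
      (T' : Set (MvPolynomial σ K)) ⊆ Submodule.span K (T : Set (MvPolynomial σ K)) ∧
      Submodule.span K (T : Set (MvPolynomial σ K)) ^ (d + 1) ≤
        Submodule.span K (T' : Set (MvPolynomial σ K)) * Submodule.span K (T : Set _) ^ d := by
  classical
  obtain ⟨d, P, hP0, hPh, hP⟩ := exists_hom_rel (fun i : T => (i : MvPolynomial σ K))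
    (by simpa using h)
  obtain ⟨l, hl⟩ : ∃ l : T → K, eval l P ≠ 0 := by
    by_contra hcon
    push Not at hcon
    exact hP0 (MvPolynomial.funext fun x => by simpa using hcon x)
  rcases d with _ | d
  · exfalso
    have : P = C (coeff 0 P) := by
      have := (totalDegree_eq_zero_iff_eq_C (p := P)).mp (by simpa using hPh.totalDegree_le)
      exact this
    rw [this] at hP hP0
    simp at hP hP0
    exact hP0 hP
  obtain ⟨i0, hi0⟩ : ∃ i, l i ≠ 0 := by
    by_contra hcon
    push Not at hcon
    apply hl
    have : l = fun i => 0 * l i := by funext i; simp [hcon]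
    have h2 := aeval_smul_hom (K := K) l 0 (d+1) P hPh
    rw [← this] at h2
    simpa [aeval_eq_eval] using h2
  set G := Submodule.span K (T : Set (MvPolynomial σ K)) with hG
  let g' : T → MvPolynomial σ K := fun i => l i0 • (i : MvPolynomial σ K) - l i • (i0 : MvPolynomial σ K)
  have hmem : ∀ i : T, (i : MvPolynomial σ K) ∈ G := fun i => Submodule.subset_span i.2
  have hg'0 : g' i0 = 0 := by simp [g']
  let T' := (Finset.univ.erase i0).image g'
  set G' := Submodule.span K (T' : Set (MvPolynomial σ K)) with hG'
  have hg' : ∀ i, g' i ∈ G' := by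
    intro i
    by_cases hi : i = i0
    · rw [hi, hg'0]; exact zero_mem _
    · apply Submodule.subset_span
      simp only [T', Finset.coe_image, Set.mem_image]
      exact ⟨i, by simp [hi], rfl⟩
  have hT' : (T' : Set (MvPolynomial σ K)) ⊆ G := by
    intro x hx
    simp only [T', Finset.coe_image, Set.mem_image] at hx
    obtain ⟨i, _, rfl⟩ := hx
    exact sub_mem (Submodule.smul_mem _ _ (hmem _)) (Submodule.smul_mem _ _ (hmem _))
  refine ⟨T', d, ?_, hT', ?_⟩
  · calc T'.card ≤ (Finset.univ.erase i0).card := Finset.card_image_le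
      _ < T.card := by
        rw [Finset.card_erase_of_mem (Finset.mem_univ _)]
        simp only [Finset.card_univ, Fintype.card_coe]
        omega
  · have hle : G ≤ G' ⊔ Submodule.span K {(i0 : MvPolynomial σ K)} := by
      rw [hG]
      apply Submodule.span_le.mpr
      intro x hx
      have : x = (l i0)⁻¹ • (g' ⟨x, hx⟩ + l ⟨x, hx⟩ • (i0 : MvPolynomial σ K)) := by
        simp [g', hi0]
      rw [this]
      refine Submodule.smul_mem _ _ (Submodule.add_mem_sup (hg' _) ?_)
      exact Submodule.smul_mem _ _ (Submodule.mem_span_singleton_self _)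
    refine (span_pow_le G G' i0 (hmem i0) (Submodule.span_le.mpr hT') hle d).trans
      (sup_le le_rfl ?_)
    rw [Submodule.span_singleton_le_iff_mem]
    have h3 := aeval_sub_mem G G' (fun i : T => C (l i0) * (i : MvPolynomial σ K))
      (fun i : T => (i0 : MvPolynomial σ K) * C (l i))
      (fun i => by simpa [smul_eq_C_mul] using Submodule.smul_mem _ (l i0) (hmem i))
      (fun i => by simpa [smul_eq_C_mul, mul_comm] using Submodule.smul_mem _ (l i) (hmem i0))
      (fun i => by simpa [g', smul_eq_C_mul, mul_comm] using hg' i) d P hPh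
    rw [aeval_smul_hom _ _ _ _ hPh, aeval_smul_hom _ _ _ _ hPh, hP] at h3
    have h4 : aeval (fun i => (C (l i) : MvPolynomial σ K)) P = C (eval l P) := by
      have := map_aeval (R := K) l (C : K →+* MvPolynomial σ K) P
      rw [aeval_eq_eval] at this
      erw [this]; rfl
    rw [h4, mul_zero, zero_sub] at h3
    have h5 := Submodule.smul_mem _ (eval l P)⁻¹ (neg_mem h3)
    rw [neg_neg, mul_comm (_ ^ _) (C _), ← smul_eq_C_mul, smul_smul, inv_mul_cancel₀ hl, one_smul] at h5
    exact h5

lemma reduce_all [Infinite K] (n : ℕ) (T : Finset (MvPolynomial σ K)) (hn : T.card ≤ n) :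
    ∃ (Θ : Finset (MvPolynomial σ K)) (r : ℕ), Θ.card ≤ Fintype.card σ + 1 ∧
      (Θ : Set (MvPolynomial σ K)) ⊆ Submodule.span K (T : Set (MvPolynomial σ K)) ∧
      Submodule.span K (T : Set (MvPolynomial σ K)) ^ (r + 1) ≤
        Submodule.span K (Θ : Set (MvPolynomial σ K)) * Submodule.span K (T : Set _) ^ r := by
  induction n generalizing T with
  | zero => exact ⟨T, 0, by omega, Submodule.subset_span, by simp⟩
  | succ n ih =>
    by_cases h : Fintype.card σ + 1 < T.card
    · obtain ⟨T', d, h1, h2, h3⟩ := reduce_one T h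
      obtain ⟨Θ, r, h4, h5, h6⟩ := ih T' (by omega)
      set G := Submodule.span K (T : Set (MvPolynomial σ K))
      set G' := Submodule.span K (T' : Set (MvPolynomial σ K))
      have hle : G' ≤ G := Submodule.span_le.mpr h2
      refine ⟨Θ, d + r, h4, fun x hx => hle (h5 hx), ?_⟩
      have h7 : ∀ k, G ^ (d + k) ≤ G' ^ k * G ^ d := by
        intro k
        induction k with
        | zero => simp
        | succ k ih =>
          calc G ^ (d + (k+1)) = G * G ^ (d + k) := by rw [← pow_succ']; rfl
            _ ≤ G * (G' ^ k * G ^ d) := by gcongr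
            _ = G' ^ k * G ^ (d + 1) := by ring
            _ ≤ G' ^ k * (G' * G ^ d) := by gcongr
            _ = _ := by ring
      calc G ^ (d + r + 1) ≤ G' ^ (r + 1) * G ^ d := h7 (r+1)
        _ ≤ (Submodule.span K (Θ : Set (MvPolynomial σ K)) * G' ^ r) * G ^ d := by gcongr
        _ ≤ (Submodule.span K (Θ : Set (MvPolynomial σ K)) * G ^ r) * G ^ d := by
            gcongr
        _ = _ := by ring
    · exact ⟨T, 0, by omega, Submodule.subset_span, by simp⟩

lemma pigeon (C0 : Subalgebra K (MvPolynomial σ K)) (Θ : Finset (MvPolynomial σ K))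
    (hΘ : ∀ θ ∈ Θ, θ ∈ C0) (c q : ℕ) (hc : Θ.card ≤ c) (hc0 : 0 < c) (hq : 0 < q) :
    Submodule.span K (Θ : Set (MvPolynomial σ K)) ^ (c * q) * Subalgebra.toSubmodule C0 ≤
      Submodule.span K {x | ∃ θ ∈ Θ, ∃ y ∈ C0, x = θ ^ q * y} := by
  classical
  rw [Submodule.span_pow, ← Submodule.span_eq (Subalgebra.toSubmodule C0), Submodule.span_mul_span,
    Submodule.span_le]
  rintro _ ⟨x, hx, y, hy, rfl⟩
  apply Submodule.subset_span
  rw [Set.mem_pow] at hx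
  obtain ⟨f, rfl⟩ := hx
  rw [List.prod_ofFn]
  obtain ⟨θ, hθ⟩ : ∃ θ ∈ Θ, q ≤ (Finset.univ.filter fun i => (f i : MvPolynomial σ K) = θ).card := by
    by_contra hcon
    push Not at hcon
    have h1 : (Finset.univ : Finset (Fin (c*q))).card
        = ∑ θ ∈ Θ, (Finset.univ.filter fun i => (f i : MvPolynomial σ K) = θ).card :=
      Finset.card_eq_sum_card_fiberwise (fun i _ => (f i).2)
    rw [Finset.card_univ, Fintype.card_fin] at h1
    have h2 : ∑ θ ∈ Θ, (Finset.univ.filter fun i => (f i : MvPolynomial σ K) = θ).card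
        ≤ ∑ θ ∈ Θ, (q - 1) := Finset.sum_le_sum fun θ hθ => by have := hcon θ hθ; omega
    rw [Finset.sum_const, smul_eq_mul] at h2
    have h3 : Θ.card * (q - 1) ≤ c * (q - 1) := Nat.mul_le_mul_right _ hc
    have h4 : c * (q - 1) < c * q := Nat.mul_lt_mul_of_pos_left (by omega) hc0
    omega
  obtain ⟨s, hs, hsc⟩ := Finset.exists_subset_card_eq hθ.2
  refine ⟨θ, hθ.1, (∏ i ∈ sᶜ, (f i : MvPolynomial σ K)) * y, ?_, ?_⟩
  · exact mul_mem (prod_mem fun i _ => hΘ _ (f i).2) hy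
  · show (∏ i, (f i : MvPolynomial σ K)) * y = _
    rw [← Finset.prod_mul_prod_compl s, mul_assoc]
    congr 1
    have := Finset.prod_eq_pow_card (s := s) (f := fun i => (f i : MvPolynomial σ K)) (b := θ)
    rw [hsc] at this
    apply this
    intro i hi
    exact (Finset.mem_filter.mp (hs hi)).2

lemma homComp_adjoin (e : ℕ) (T : Finset (MvPolynomial σ K))
    (hT : ∀ g ∈ T, ∃ d ≤ e, g.IsHomogeneous d) (b : MvPolynomial σ K)
    (hb : b ∈ Algebra.adjoin K (T : Set (MvPolynomial σ K))) (D k : ℕ) (hk : k * e ≤ D) (he : 0 < e) :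
    homogeneousComponent D b ∈ Submodule.span K (T : Set (MvPolynomial σ K)) ^ k *
      Subalgebra.toSubmodule (Algebra.adjoin K (T : Set (MvPolynomial σ K))) := by
  rw [← Subalgebra.mem_toSubmodule, Algebra.adjoin_eq_span] at hb
  set G := Submodule.span K (T : Set (MvPolynomial σ K))
  set B := Subalgebra.toSubmodule (Algebra.adjoin K (T : Set (MvPolynomial σ K)))
  have hGB : ∀ n, G ^ n ≤ B := by
    intro n
    have h1 : G ≤ B := Submodule.span_le.mpr Algebra.subset_adjoin
    intro x hx
    induction n generalizing x with
    | zero =>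
      obtain ⟨y, rfl⟩ := Submodule.mem_one.mp (by rwa [pow_zero] at hx)
      exact Subalgebra.algebraMap_mem _ y
    | succ n ih =>
      rw [pow_succ] at hx
      refine Submodule.mul_induction_on hx (fun a ha b hb => ?_) (fun a b ha hb => add_mem ha hb)
      exact Subalgebra.mul_mem _ (ih ha) (h1 hb)
  induction hb using Submodule.span_induction with
  | zero => simp
  | add x y _ _ hx hy => rw [map_add]; exact add_mem hx hy
  | smul c x _ hx => rw [map_smul]; exact Submodule.smul_mem _ _ hx
  | mem x hx =>
    have : ∃ n d, d ≤ n * e ∧ x.IsHomogeneous d ∧ x ∈ G ^ n := by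
      induction hx using Submonoid.closure_induction with
      | one => exact ⟨0, 0, by simp, isHomogeneous_one _ _, by simp [Submodule.one_le.mp le_rfl]⟩
      | mem x hx =>
        obtain ⟨d, hd, hx'⟩ := hT x hx
        exact ⟨1, d, by simpa using hd, hx', by simpa using Submodule.subset_span hx⟩
      | mul x y _ _ hx hy =>
        obtain ⟨n, d, h1, h2, h3⟩ := hx
        obtain ⟨n', d', h1', h2', h3'⟩ := hy
        refine ⟨n + n', d + d', by nlinarith, h2.mul h2', ?_⟩
        rw [pow_add]
        exact Submodule.mul_mem_mul h3 h3'
    obtain ⟨n, d, h1, h2, h3⟩ := this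
    rw [homogeneousComponent_of_mem ((mem_homogeneousSubmodule d x).mpr h2)]
    split_ifs with hDd
    · have hkn : k ≤ n := by
        by_contra hcon
        push Not at hcon
        have : n * e < k * e := Nat.mul_lt_mul_of_pos_right hcon he
        omega
      obtain ⟨m, rfl⟩ := Nat.exists_eq_add_of_le hkn
      rw [pow_add] at h3
      exact mul_le_mul' le_rfl (hGB m) h3
    · exact zero_mem _

lemma homComp_mul_hom (D d : ℕ) (a f : MvPolynomial σ K) (hf : f.IsHomogeneous d) :
    homogeneousComponent D (f * a) =
      if d ≤ D then f * homogeneousComponent (D - d) a else 0 := by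
  conv_lhs => rw [← sum_homogeneousComponent a, Finset.mul_sum, map_sum]
  have h1 : ∀ i, homogeneousComponent D (f * homogeneousComponent i a)
      = if D = d + i then f * homogeneousComponent i a else 0 := fun i =>
    homogeneousComponent_of_mem ((mem_homogeneousSubmodule _ _).mpr
      (hf.mul (homogeneousComponent_isHomogeneous i a)))
  simp only [h1]
  split_ifs with h
  · by_cases hdd : D - d ∈ Finset.range (a.totalDegree + 1)
    · rw [Finset.sum_eq_single_of_mem _ hdd]
      · rw [if_pos (by omega)]
      · intro b _ hb
        rw [if_neg (by omega)]
    · rw [homogeneousComponent_eq_zero (D - d) a (by simp at hdd; omega), mul_zero]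
      apply Finset.sum_eq_zero
      intro i hi
      rw [if_neg]
      rintro rfl
      apply hdd
      simpa using hi
  · exact Finset.sum_eq_zero fun i _ => if_neg (by omega)

/-- powers of an integral element -/
lemma pow_mem_of_integral {S : Type} [CommRing S] [Algebra K S] (B : Subalgebra K S) (f : S)
    (hf : IsIntegral B f) :
    ∃ s0 : ℕ, ∀ q, ∃ b : ℕ → S, (∀ i, b i ∈ B) ∧ f ^ q = ∑ i ∈ Finset.range s0, b i * f ^ i := by
  obtain ⟨P, hP, hP0⟩ := hf
  refine ⟨P.natDegree, fun q => ?_⟩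
  by_cases hP1 : P = 1
  · have : (1 : S) = 0 := by simpa [hP1] using hP0
    exact ⟨0, fun i => zero_mem _, by rw [← mul_one (f ^ q), this]; simp⟩
  have h1 : (Polynomial.X ^ q) %ₘ P + P * ((Polynomial.X ^ q) /ₘ P) = Polynomial.X ^ q :=
    Polynomial.modByMonic_add_div _ _
  refine ⟨fun i => (((Polynomial.X ^ q) %ₘ P).coeff i : B), fun i => SetLike.coe_mem _, ?_⟩
  have h2 := congrArg (Polynomial.eval₂ (algebraMap B S) f) h1
  rw [Polynomial.eval₂_add, Polynomial.eval₂_mul, hP0, zero_mul, add_zero] at h2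
  rw [Polynomial.eval₂_pow, Polynomial.eval₂_X] at h2
  rw [← h2, Polynomial.eval₂_eq_sum_range' _ (Polynomial.natDegree_modByMonic_lt _ hP hP1)]
  rfl

theorem P3main [Infinite K] (p : ℕ) (hp : 1 < p) (C0 : Subalgebra K (MvPolynomial σ K))
    (hgr : ∀ f ∈ C0, ∀ d, homogeneousComponent d f ∈ C0)
    (φ : MvPolynomial σ K → MvPolynomial σ K)
    (hφa : ∀ f g, φ (f + g) = φ f + φ g) (hφm : ∀ f g, φ (f ^ p * g) = f * φ g)
    (hφ1 : φ 1 = 1) (hφC : ∀ f ∈ C0, φ f ∈ C0)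
    (e : ℕ) (he : 0 < e) (T : Finset (MvPolynomial σ K)) (hTC : ∀ g ∈ T, g ∈ C0)
    (hT : ∀ g ∈ T, ∃ d, 1 ≤ d ∧ d ≤ e ∧ g.IsHomogeneous d)
    (hint : ∀ f ∈ C0, IsIntegral (Algebra.adjoin K (T : Set (MvPolynomial σ K))) f) :
    C0 ≤ Algebra.adjoin K {f | f ∈ C0 ∧ ∃ d ≤ (Fintype.card σ + 1) * e, f.IsHomogeneous d} := by
  have hφ0 : φ 0 = 0 := by simpa using hφa 0 0
  have hφi : ∀ k f g, φ^[k] (f ^ (p ^ k) * g) = f * φ^[k] g := by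
    intro k
    induction k with
    | zero => intro f g; simp
    | succ k ih =>
      intro f g
      rw [Function.iterate_succ_apply, Function.iterate_succ_apply, pow_succ, pow_mul, hφm, ih]
  have hφi1 : ∀ k, φ^[k] 1 = 1 := fun k => Function.iterate_fixed hφ1 k
  have hφia : ∀ k f g, φ^[k] (f + g) = φ^[k] f + φ^[k] g := by
    intro k
    induction k with
    | zero => intro f g; simp
    | succ k ih => intro f g; simp only [Function.iterate_succ_apply, hφa, ih]
  have hφi0 : ∀ k, φ^[k] 0 = 0 := fun k => Function.iterate_fixed hφ0 k
  have hφiC : ∀ k, ∀ f ∈ C0, φ^[k] f ∈ C0 := by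
    intro k
    induction k with
    | zero => intro f hf; simpa
    | succ k ih => intro f hf; rw [Function.iterate_succ_apply]; exact ih _ (hφC _ hf)
  set v := Fintype.card σ with hv
  set A := Algebra.adjoin K {f | f ∈ C0 ∧ ∃ d ≤ (v + 1) * e, f.IsHomogeneous d}
  have hmain : ∀ D, ∀ f ∈ C0, f.IsHomogeneous D → f ∈ A := by
    intro D
    induction D using Nat.strong_induction_on with
    | _ D ihD =>
    intro f hfC hfD
    by_cases hDe : D ≤ (v + 1) * e
    · exact Algebra.subset_adjoin ⟨hfC, D, hDe, hfD⟩
    push Not at hDe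
    -- f in the ideal
    have hideal : f ∈ Submodule.span K {x | ∃ g ∈ T, ∃ y ∈ C0, x = g * y} := by
      obtain ⟨s0, hs0⟩ := pow_mem_of_integral _ f (hint f hfC)
      obtain ⟨Θ, r, hΘ1, hΘ2, hΘ3⟩ := reduce_all T.card T le_rfl
      set G := Submodule.span K (T : Set (MvPolynomial σ K)) with hG
      set G' := Submodule.span K (Θ : Set (MvPolynomial σ K))
      have hGC : G ≤ Subalgebra.toSubmodule C0 := Submodule.span_le.mpr hTC
      have hGnC : ∀ n, G ^ n * Subalgebra.toSubmodule C0 ≤ Subalgebra.toSubmodule C0 := by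
        intro n
        induction n with
        | zero => simp
        | succ n ih =>
          rw [pow_succ', mul_assoc]
          calc _ ≤ Subalgebra.toSubmodule C0 * Subalgebra.toSubmodule C0 :=
                mul_le_mul' hGC ih
            _ ≤ _ := by
              rw [Submodule.mul_le]; exact fun a ha b hb => mul_mem (S := Subalgebra K _) ha hb
      have hpow : ∀ t, G ^ (r + t) ≤ G' ^ t * G ^ r := by
        intro t
        induction t with
        | zero => simp
        | succ k ih =>
          calc G ^ (r + (k+1)) = G * G ^ (r + k) := by rw [← pow_succ']; rfl
            _ ≤ G * (G' ^ k * G ^ r) := by gcongr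
            _ = G' ^ k * G ^ (r + 1) := by ring
            _ ≤ G' ^ k * (G' * G ^ r) := by gcongr
            _ = _ := by ring
      set k0 := s0 + e * (r + (v + 1) * s0) + 1
      have hq : k0 < p ^ k0 := Nat.lt_pow_self hp
      set q := p ^ k0 with hqdef
      have hfq : f ^ q ∈ G ^ (r + (v + 1) * q) * Subalgebra.toSubmodule C0 := by
        obtain ⟨b, hb, hfb⟩ := hs0 q
        have h1 : f ^ q = homogeneousComponent (D * q) (f ^ q) := by
          rw [homogeneousComponent_of_mem ((mem_homogeneousSubmodule _ _).mpr (hfD.pow q)), if_pos rfl]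
        rw [h1, hfb, map_sum]
        refine Submodule.sum_mem _ fun i hi => ?_
        rw [mul_comm (b i), homComp_mul_hom _ _ _ _ (hfD.pow i)]
        have hi' := Finset.mem_range.mp hi
        have hiq : i ≤ q := by omega
        rw [if_pos (Nat.mul_le_mul_left _ hiq), mul_comm (f ^ i)]
        have h2 : (r + (v + 1) * q) * e ≤ D * q - D * i := by
          obtain ⟨w, hw⟩ := Nat.exists_eq_add_of_le hiq
          rw [← Nat.mul_sub, hw, Nat.add_sub_cancel_left]
          have h3 : ((v + 1) * e + 1) * w ≤ D * w := Nat.mul_le_mul_right _ hDe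
          have h4 : e * (r + (v + 1) * s0) ≤ w := by omega
          have h5 : (v+1) * e * i ≤ (v+1) * e * s0 := Nat.mul_le_mul_left _ hi'.le
          nlinarith
        have h3 := homComp_adjoin e T (fun g hg => by
          obtain ⟨d, h1, h2, h3⟩ := hT g hg; exact ⟨d, h2, h3⟩) (b i) (hb i) _ _ h2 he
        have h4 : Subalgebra.toSubmodule (Algebra.adjoin K (T : Set (MvPolynomial σ K)))
            ≤ Subalgebra.toSubmodule C0 := Algebra.adjoin_le hTC
        have h5 := Submodule.mul_mem_mul (mul_le_mul' le_rfl h4 h3)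
          (show f ^ i ∈ Subalgebra.toSubmodule C0 from C0.pow_mem hfC i)
        rw [mul_assoc] at h5
        have h6 : Subalgebra.toSubmodule C0 * Subalgebra.toSubmodule C0 ≤ Subalgebra.toSubmodule C0 := by
          rw [Submodule.mul_le]; exact fun a ha b hb => mul_mem (S := Subalgebra K _) ha hb
        exact (mul_le_mul' le_rfl h6 : _ ≤ G ^ (r + (v + 1) * q) * Subalgebra.toSubmodule C0) h5
      have hΘC : ∀ θ ∈ Θ, θ ∈ C0 := fun θ hθ => hGC (hΘ2 hθ)
      have hfq2 := (pigeon C0 Θ hΘC (v + 1) q hΘ1 (by omega) (by omega)) <| by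
        have h1 := mul_le_mul' (hpow ((v+1)*q)) (le_refl (Subalgebra.toSubmodule C0)) hfq
        rw [mul_assoc] at h1
        exact mul_le_mul' le_rfl (hGnC r) h1
      have hstep : ∀ x ∈ Submodule.span K {x | ∃ θ ∈ Θ, ∃ y ∈ C0, x = θ ^ q * y},
          φ^[k0] x ∈ Submodule.span K {x | ∃ g ∈ T, ∃ y ∈ C0, x = g * y} := by
        intro x hx
        obtain ⟨n, c, z, hz, rfl⟩ : ∃ (n : ℕ) (c : Fin n → K) (z : Fin n → MvPolynomial σ K),
            (∀ i, z i ∈ {x | ∃ θ ∈ Θ, ∃ y ∈ C0, x = θ ^ q * y}) ∧ x = ∑ i, c i • z i := by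
          obtain ⟨n, c, z, h⟩ := Submodule.mem_span_set'.mp hx
          exact ⟨n, c, fun i => z i, fun i => (z i).2, h.symm⟩
        have hsum : ∀ (s : Finset (Fin n)), φ^[k0] (∑ i ∈ s, c i • z i) = ∑ i ∈ s, φ^[k0] (c i • z i) := by
          classical
          intro s
          induction s using Finset.induction_on with
          | empty => simp [hφi0]
          | insert a s ha ih => rw [Finset.sum_insert ha, Finset.sum_insert ha, hφia, ih]
        rw [hsum]
        refine Submodule.sum_mem _ fun i _ => ?_
        obtain ⟨θ, hθ, y, hy, hzi⟩ := hz i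
        rw [hzi, ← mul_smul_comm, hφi]
        have hy' : φ^[k0] (c i • y) ∈ C0 := hφiC _ _ (Subalgebra.smul_mem _ hy _)
        have hle : G ≤ (Submodule.span K {x | ∃ g ∈ T, ∃ y ∈ C0, x = g * y}).comap
            (LinearMap.mulRight K (φ^[k0] (c i • y))) :=
          Submodule.span_le.mpr fun g hg => Submodule.subset_span ⟨g, hg, _, hy', rfl⟩
        exact hle (hΘ2 hθ)
      have := hstep _ hfq2
      rwa [← mul_one (f ^ q), hφi, hφi1, mul_one] at this
    have hcomp : ∀ x ∈ Submodule.span K {x | ∃ g ∈ T, ∃ y ∈ C0, x = g * y},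
        homogeneousComponent D x ∈ A := by
      intro x hx
      induction hx using Submodule.span_induction with
      | zero => simp
      | add x y _ _ hx hy => rw [map_add]; exact add_mem hx hy
      | smul c x _ hx => rw [map_smul]; exact Subalgebra.smul_mem _ hx _
      | mem x hx =>
        obtain ⟨g, hg, y, hy, rfl⟩ := hx
        obtain ⟨d, hd1, hde, hd⟩ := hT g hg
        rw [homComp_mul_hom _ _ _ _ hd]
        split_ifs with hdD
        · refine mul_mem ?_ (ihD _ (by omega) _ (hgr _ hy _) (homogeneousComponent_isHomogeneous _ _))
          exact Algebra.subset_adjoin ⟨hTC _ hg, d, by nlinarith, hd⟩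
        · exact zero_mem _
    have h9 := hcomp f hideal
    rwa [homogeneousComponent_of_mem ((mem_homogeneousSubmodule _ _).mpr hfD), if_pos rfl] at h9
  intro f hf
  rw [← sum_homogeneousComponent f]
  exact sum_mem fun i _ => hmain i _ (hgr f hf i) (homogeneousComponent_isHomogeneous i f)
end P3
end QInv


namespace QInv

section PInv
set_option linter.unusedSectionVars false
variable {Q0 Q1 : Type} [Fintype Q0] [Fintype Q1] (ta ha : Q1 → Q0) (α : Q0 → ℕ)

/-- coordinate index type -/
abbrev Rho : Type := (a : Q1) × (Fin (α (ha a)) × Fin (α (ta a)))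
/-- matrix coordinates -/
abbrev Tau {Q0 : Type} (α : Q0 → ℕ) : Type := (i : Q0) × (Fin (α i) × Fin (α i))

variable {ta ha α}

/-- coordinates over any ring -/
def rc {L : Type} (v : (a : Q1) → Matrix (Fin (α (ha a))) (Fin (α (ta a))) L) :
    Rho ta ha α → L := fun p => v p.1 p.2.1 p.2.2

variable {L : Type} [CommRing L]

open Classical in
/-- cleared inverse -/
noncomputable def adj' (A : (i : Q0) → Matrix (Fin (α i)) (Fin (α i)) L) (i : Q0) :
    Matrix (Fin (α i)) (Fin (α i)) L :=
  (∏ j ∈ Finset.univ.erase i, (A j).det) • (A i).adjugate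

/-- cleared action -/
noncomputable def act' (A : (i : Q0) → Matrix (Fin (α i)) (Fin (α i)) L)
    (v : (a : Q1) → Matrix (Fin (α (ha a))) (Fin (α (ta a))) L) (a : Q1) :
    Matrix (Fin (α (ha a))) (Fin (α (ta a))) L :=
  A (ha a) * v a * adj' A (ta a)

lemma act'_map {L' : Type} [CommRing L'] (φ : L →+* L')
    (A : (i : Q0) → Matrix (Fin (α i)) (Fin (α i)) L)
    (v : (a : Q1) → Matrix (Fin (α (ha a))) (Fin (α (ta a))) L) (a : Q1) :
    (act' A v a).map φ = act' (fun i => (A i).map φ) (fun a => (v a).map φ) a := by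
  have h : (adj' A (ta a)).map φ = adj' (fun i => (A i).map φ) (ta a) := by
    unfold adj'
    have h1 : (A (ta a)).adjugate.map φ = ((A (ta a)).map φ).adjugate := RingHom.map_adjugate φ _
    have h2 : ∀ j, ((A j).map φ).det = φ (A j).det := fun j => by rw [RingHom.map_det]; rfl
    simp only [h2, ← map_prod, ← h1]
    ext j k
    simp
  simp only [act', Matrix.map_mul, h]

variable (ta ha α) in
/-- the linear operator -/
noncomputable def Lop (R0 : Type) [CommRing R0] (D : ℕ) :
    MvPolynomial (Rho ta ha α) R0 →ₗ[R0] MvPolynomial (Rho ta ha α ⊕ Tau α) R0 :=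
  (aeval (rc (act' (ta := ta) (ha := ha) (fun i => Matrix.of fun j k => X (Sum.inr ⟨i, j, k⟩))
      (fun a => Matrix.of fun j k => X (Sum.inl ⟨a, j, k⟩))))).toLinearMap
  - LinearMap.mulLeft R0 ((∏ i, (Matrix.of fun j k => (X (Sum.inr ⟨i, j, k⟩) :
      MvPolynomial (Rho ta ha α ⊕ Tau α) R0)).det) ^ D) ∘ₗ (rename Sum.inl).toLinearMap

lemma aeval_Lop {R0 : Type} [CommRing R0] [Algebra R0 L] (D : ℕ)
    (f : MvPolynomial (Rho ta ha α) R0)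
    (A : (i : Q0) → Matrix (Fin (α i)) (Fin (α i)) L)
    (v : (a : Q1) → Matrix (Fin (α (ha a))) (Fin (α (ta a))) L) :
    aeval (Sum.elim (rc v) (fun t => A t.1 t.2.1 t.2.2)) (Lop ta ha α R0 D f)
      = aeval (rc (act' A v)) f - (∏ i, (A i).det) ^ D * aeval (rc v) f := by
  set ev := (aeval (R := R0) (Sum.elim (rc v) (fun t : Tau α => A t.1 t.2.1 t.2.2)))
  simp only [Lop, LinearMap.sub_apply, AlgHom.toLinearMap_apply, LinearMap.comp_apply,
    LinearMap.mulLeft_apply, map_sub, map_mul, map_pow, map_prod]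
  congr 1
  · rw [← AlgHom.comp_apply, comp_aeval]
    congr 2
    funext p
    have := congrFun (congrFun (act'_map (ta := ta) (ha := ha) (α := α) (L := MvPolynomial (Rho ta ha α ⊕ Tau α) R0) (ev : _ →+* L)
      (fun i => Matrix.of fun j k => X (Sum.inr ⟨i, j, k⟩))
      (fun a => Matrix.of fun j k => X (Sum.inl ⟨a, j, k⟩)) p.1) p.2.1) p.2.2
    have e1 : (fun i => (Matrix.of fun j k => (X (Sum.inr ⟨i, j, k⟩) : MvPolynomial (Rho ta ha α ⊕ Tau α) R0)).map
        (ev : _ →+* L)) = A := by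
      funext i; ext j k; simp [ev]
    have e2 : (fun a => (Matrix.of fun j k => (X (Sum.inl ⟨a, j, k⟩) : MvPolynomial (Rho ta ha α ⊕ Tau α) R0)).map
        (ev : _ →+* L)) = v := by
      funext i; ext j k; simp [ev, rc]
    rw [e1, e2] at this
    exact this
  · congr 1
    · congr 1
      refine Finset.prod_congr rfl fun i _ => ?_
      have := RingHom.map_det (ev : _ →+* L) (Matrix.of fun j k => (X (Sum.inr ⟨i, j, k⟩) :
        MvPolynomial (Rho ta ha α ⊕ Tau α) R0))
      erw [this]
      congr 1
      ext j k; simp [ev]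
    · rw [aeval_rename]; rfl

lemma act'_inv (A B : (i : Q0) → Matrix (Fin (α i)) (Fin (α i)) L)
    (hAB : ∀ i, A i * B i = 1)
    (v : (a : Q1) → Matrix (Fin (α (ha a))) (Fin (α (ta a))) L) (a : Q1) :
    act' A v a = (∏ i, (A i).det) • (A (ha a) * v a * B (ta a)) := by
  classical
  have h : adj' A (ta a) = (∏ i, (A i).det) • B (ta a) := by
    unfold adj'
    have h1 : (A (ta a)).adjugate = (A (ta a)).det • B (ta a) := by
      have := congrArg (· * B (ta a)) (Matrix.adjugate_mul (A (ta a)))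
      simp only [mul_assoc, hAB, mul_one, smul_mul_assoc, one_mul] at this
      exact this
    rw [h1, smul_smul, Finset.prod_erase_mul _ _ (Finset.mem_univ _)]
  rw [act', h, Matrix.mul_smul]

lemma aeval_act'_inv {R0 : Type} [CommRing R0] [Algebra R0 L] (D : ℕ)
    (f : MvPolynomial (Rho ta ha α) R0) (hf : f.IsHomogeneous D)
    (A B : (i : Q0) → Matrix (Fin (α i)) (Fin (α i)) L)
    (hAB : ∀ i, A i * B i = 1)
    (v : (a : Q1) → Matrix (Fin (α (ha a))) (Fin (α (ta a))) L) :
    aeval (rc (act' A v)) f =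
      (∏ i, (A i).det) ^ D * aeval (rc fun a => A (ha a) * v a * B (ta a)) f := by
  have : rc (act' A v) = fun p => (∏ i, (A i).det) * (rc fun a => A (ha a) * v a * B (ta a)) p := by
    funext p
    simp only [rc, act'_inv A B hAB, Matrix.smul_apply, smul_eq_mul]
  rw [this, f.as_sum, map_sum, map_sum, Finset.mul_sum]
  refine Finset.sum_congr rfl fun m hm => ?_
  rw [aeval_monomial, aeval_monomial]
  have := hf (mem_support_iff.mp hm)
  have hd : m.sum (fun _ k => k) = D := by
    simpa [Finsupp.weight_apply, Finsupp.sum] using this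
  simp only [Finsupp.prod, mul_pow, Finset.prod_mul_distrib]
  rw [Finset.prod_pow_eq_pow_sum, ← hd, Finsupp.sum]
  ring

lemma mem_qi {K : Type} [Field K] (f : MvPolynomial (Rho ta ha α) K) :
    f ∈ quiverInvariants K ta ha α ↔ ∀ (A B : (i : Q0) → Matrix (Fin (α i)) (Fin (α i)) K),
      (∀ i, A i * B i = 1) → ∀ (v : (a : Q1) → Matrix (Fin (α (ha a))) (Fin (α (ta a))) K),
      aeval (rc fun a => A (ha a) * v a * B (ta a)) f = aeval (rc v) f := by
  unfold quiverInvariants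
  simp only [Algebra.mem_iInf, AlgHom.mem_equalizer]
  constructor
  · intro h A B hAB v
    exact h (fun i => ⟨A i, B i, hAB i, mul_eq_one_comm.mp (hAB i)⟩) v
  · intro h A v
    exact h (fun i => (A i).val) (fun i => ((A i)⁻¹).val) (fun i => (A i).mul_inv) v

lemma mem_qi_iff_Lop {K : Type} [Field K] [Infinite K] (D : ℕ)
    (f : MvPolynomial (Rho ta ha α) K) (hf : f.IsHomogeneous D) :
    f ∈ quiverInvariants K ta ha α ↔ Lop ta ha α K D f = 0 := by
  rw [mem_qi]
  constructor
  · intro h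
    set Δ : MvPolynomial (Rho ta ha α ⊕ Tau α) K := (∏ i, (Matrix.of fun j k => (X (Sum.inr ⟨i, j, k⟩) :
      MvPolynomial (Rho ta ha α ⊕ Tau α) K)).det) with hΔ
    have hev : ∀ x : Rho ta ha α ⊕ Tau α → K, aeval x Δ =
        ∏ i, (Matrix.of fun j k => x (Sum.inr ⟨i, j, k⟩)).det := by
      intro x
      rw [hΔ, map_prod]
      refine Finset.prod_congr rfl fun i _ => ?_
      have := RingHom.map_det ((aeval (R := K) x : _ →ₐ[K] K) : _ →+* K) (Matrix.of fun j k => (X (Sum.inr ⟨i, j, k⟩) :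
        MvPolynomial (Rho ta ha α ⊕ Tau α) K))
      erw [this]
      congr 1
      ext j k; simp
    have hΔ0 : Δ ≠ 0 := by
      intro h0
      have := hev (Sum.elim 0 (fun t => (1 : Matrix (Fin (α t.1)) (Fin (α t.1)) K) t.2.1 t.2.2))
      rw [h0, map_zero] at this
      have h1 : ∀ i, (Matrix.of fun j k => (1 : Matrix (Fin (α i)) (Fin (α i)) K) j k) = 1 := fun i => rfl
      simp [h1] at this
    have hz : Δ * Lop ta ha α K D f = 0 := by
      apply MvPolynomial.funext
      intro x
      rw [← aeval_eq_eval]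
      show aeval x _ = aeval x _
      rw [map_mul, map_zero, hev]
      set A : (i : Q0) → Matrix (Fin (α i)) (Fin (α i)) K := fun i => Matrix.of fun j k => x (Sum.inr ⟨i, j, k⟩)
      by_cases hd : ∏ i, (A i).det = 0
      · rw [hd, zero_mul]
      have hdi : ∀ i, IsUnit (A i).det := fun i =>
        isUnit_iff_ne_zero.mpr (Finset.prod_ne_zero_iff.mp hd i (Finset.mem_univ i))
      have hx : x = Sum.elim (rc (ta := ta) (ha := ha) (fun a => Matrix.of fun j k => x (Sum.inl ⟨a, j, k⟩)))
          (fun t : Tau α => A t.1 t.2.1 t.2.2) := by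
        funext y; rcases y with y | y <;> rfl
      rw [hx, aeval_Lop, aeval_act'_inv D f hf A (fun i => (A i)⁻¹) (fun i => Matrix.mul_nonsing_inv _ (hdi i)),
        h A (fun i => (A i)⁻¹) (fun i => Matrix.mul_nonsing_inv _ (hdi i))]
      simp
    exact (mul_eq_zero.mp hz).resolve_left hΔ0
  · intro h A B hAB v
    have h1 := aeval_Lop (L := K) D f A v
    rw [h, map_zero, aeval_act'_inv D f hf A B hAB, ← mul_sub] at h1
    have hd : ∏ i, (A i).det ≠ 0 := Finset.prod_ne_zero_iff.mpr fun i _ h0 => by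
      have := congrArg Matrix.det (hAB i)
      rw [Matrix.det_mul, h0] at this
      simp at this
    exact sub_eq_zero.mp ((mul_eq_zero.mp h1.symm).resolve_left (pow_ne_zero _ hd))

lemma qi_graded {K : Type} [Field K] [Infinite K] 
    (f : MvPolynomial (Rho ta ha α) K) (hf : f ∈ quiverInvariants K ta ha α) (D : ℕ) :
    homogeneousComponent D f ∈ quiverInvariants K ta ha α := by
  rw [mem_qi] at hf ⊢
  intro A B hAB v
  have h1 : ∀ (w : (a : Q1) → Matrix (Fin (α (ha a))) (Fin (α (ta a))) K) (c : K),
      aeval (rc fun a => c • w a) f = Polynomial.eval c (∑ i ∈ Finset.range (f.totalDegree + 1),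
        Polynomial.C (aeval (rc w) (homogeneousComponent i f)) * Polynomial.X ^ i) := by
    intro w c
    conv_lhs => rw [← sum_homogeneousComponent f, map_sum]
    rw [Polynomial.eval_finset_sum]
    refine Finset.sum_congr rfl fun i _ => ?_
    have : rc (fun a => c • w a) = fun p => c * rc w p := by funext p; simp [rc]
    rw [this, aeval_smul_hom _ _ _ _ (homogeneousComponent_isHomogeneous i f)]
    rw [Polynomial.eval_mul, Polynomial.eval_C, Polynomial.eval_pow, Polynomial.eval_X, mul_comm]
  have h2 := Polynomial.funext fun c => ((h1 (fun a => A (ha a) * v a * B (ta a)) c).symm.trans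
    (by simpa using hf A B hAB (fun a => c • v a))).trans (h1 v c)
  by_cases hD : D ∈ Finset.range (f.totalDegree + 1)
  · have h3 := congrArg (fun q => Polynomial.coeff q D) h2
    simp only [Polynomial.finsetSum_coeff, Polynomial.coeff_C_mul, Polynomial.coeff_X_pow] at h3
    simp only [mul_ite, mul_one, mul_zero, Finset.sum_ite_eq, if_pos hD] at h3
    exact h3
  · rw [homogeneousComponent_eq_zero]
    · simp
    · simp at hD; omega

/-- invariance over extension fields (rings) -/
lemma qi_ext {K : Type} [Field K] [Infinite K] [IsDomain L] [Algebra K L]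
    (f : MvPolynomial (Rho ta ha α) K) (hf : f ∈ quiverInvariants K ta ha α)
    (A B : (i : Q0) → Matrix (Fin (α i)) (Fin (α i)) L) (hAB : ∀ i, A i * B i = 1)
    (v : (a : Q1) → Matrix (Fin (α (ha a))) (Fin (α (ta a))) L) :
    aeval (rc fun a => A (ha a) * v a * B (ta a)) f = aeval (rc v) f := by
  rw [← sum_homogeneousComponent f, map_sum, map_sum]
  refine Finset.sum_congr rfl fun D _ => ?_
  have hh := homogeneousComponent_isHomogeneous D f
  have h := (mem_qi_iff_Lop D _ hh).mp (qi_graded f hf D)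
  have h1 := aeval_Lop (L := L) D (homogeneousComponent D f) A v
  rw [h, map_zero, aeval_act'_inv D _ hh A B hAB, ← mul_sub] at h1
  have hd : ∏ i, (A i).det ≠ 0 := Finset.prod_ne_zero_iff.mpr fun i _ h0 => by
    have := congrArg Matrix.det (hAB i)
    rw [Matrix.det_mul, h0] at this
    simp at this
  exact sub_eq_zero.mp ((mul_eq_zero.mp h1.symm).resolve_left (pow_ne_zero _ hd))

lemma Lop_map {R0 R1 : Type} [CommRing R0] [CommRing R1] (φ : R0 →+* R1) (D : ℕ)
    (f : MvPolynomial (Rho ta ha α) R0) :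
    Lop ta ha α R1 D (map φ f) = map φ (Lop ta ha α R0 D f) := by
  letI := φ.toAlgebra
  letI : Algebra R0 (MvPolynomial (Rho ta ha α ⊕ Tau α) R1) := inferInstance
  have h := aeval_Lop (L := MvPolynomial (Rho ta ha α ⊕ Tau α) R1) D f 
    (fun i => Matrix.of fun j k => X (Sum.inr ⟨i, j, k⟩)) (fun a => Matrix.of fun j k => X (Sum.inl ⟨a, j, k⟩))
  have h' := aeval_Lop (L := MvPolynomial (Rho ta ha α ⊕ Tau α) R1) D (map φ f) 
    (fun i => Matrix.of fun j k => X (Sum.inr ⟨i, j, k⟩)) (fun a => Matrix.of fun j k => X (Sum.inl ⟨a, j, k⟩))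
  have e : (Sum.elim (rc (ta := ta) (ha := ha) (α := α) fun a => Matrix.of fun j k => X (Sum.inl ⟨a, j, k⟩)) fun t =>
    (Matrix.of fun j k => X (Sum.inr ⟨t.fst, j, k⟩) : Matrix _ _ (MvPolynomial (Rho ta ha α ⊕ Tau α) R1)) t.2.1 t.2.2) = X := by
    funext y; rcases y with y | y <;> rfl
  rw [e] at h h'
  have e2 : ∀ (τ : Type) (w : τ → MvPolynomial (Rho ta ha α ⊕ Tau α) R1) (g : MvPolynomial τ R0),
      aeval w (map φ g) = aeval w g := by
    intro τ w g
    rw [aeval_map_algebraMap (A := R1) w g |>.symm]; rfl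
  rw [e2, e2, aeval_X_left, AlgHom.id_apply, ← h] at h'
  rw [h', ← e2, aeval_X_left]; rfl

end PInv
end QInv


namespace QInv

section P4
set_option linter.unusedSectionVars false

lemma exists_geninv {I J : Type} [Fintype I] [Fintype J] [DecidableEq I] [DecidableEq J]
    (M : Matrix J I ℤ) :
    ∃ (m : ℤ) (Γ : Matrix I J ℤ), m ≠ 0 ∧ M * Γ * M = m • M := by
  let Mq : Matrix J I ℚ := M.map (Int.castRingHom ℚ)
  let f := Matrix.toLin' Mq
  obtain ⟨s, hs⟩ := LinearMap.exists_rightInverse_of_surjective f.rangeRestrict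
    (LinearMap.range_rangeRestrict f)
  obtain ⟨g, hg⟩ := LinearMap.exists_extend s
  have hfg : f ∘ₗ g ∘ₗ f = f := by
    ext1 x
    ext1 
    have h1 : g (f (LinearMap.single ℚ (fun _ => ℚ) x 1)) = s (f.rangeRestrict (LinearMap.single ℚ (fun _ => ℚ) x 1)) := by
      rw [← hg]; rfl
    have h2 := LinearMap.congr_fun hs (f.rangeRestrict (LinearMap.single ℚ (fun _ => ℚ) x 1))
    have h3 := congrArg Subtype.val h2
    simp only [LinearMap.comp_apply] at h3 ⊢
    rw [h1]
    exact h3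
  have hMq : Mq * LinearMap.toMatrix' g * Mq = Mq := by
    apply Matrix.toLin'.injective
    rw [Matrix.toLin'_mul, Matrix.toLin'_mul, Matrix.toLin'_toMatrix', LinearMap.comp_assoc]
    exact hfg
  obtain ⟨b, hb⟩ := IsLocalization.exist_integer_multiples_of_finite (nonZeroDivisors ℤ)
    (fun ij : I × J => LinearMap.toMatrix' g ij.1 ij.2)
  choose Γ hΓ using hb
  refine ⟨b, Matrix.of fun i j => Γ (i, j), nonZeroDivisors.coe_ne_zero b, ?_⟩
  have hinj : Function.Injective (fun X : Matrix J I ℤ => X.map (Int.castRingHom ℚ)) :=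
    Matrix.map_injective (RingHom.injective_int (Int.castRingHom ℚ))
  apply hinj
  have e1 : (Matrix.of fun i j => Γ (i, j)).map (Int.castRingHom ℚ) = (b : ℤ) • LinearMap.toMatrix' g := by
    ext i j
    simpa using hΓ (i, j)
  simp only [Matrix.map_mul, e1]
  rw [Matrix.mul_smul, Matrix.smul_mul]
  change (b : ℤ) • (Mq * LinearMap.toMatrix' g * Mq) = _
  rw [hMq]
  ext i j
  simp [Mq]

variable {Q0 Q1 : Type} [Fintype Q0] [Fintype Q1] {ta ha : Q1 → Q0} {α : Q0 → ℕ}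

lemma hom_as_sum {ρ : Type} [Fintype ρ] [DecidableEq ρ] {R0 : Type} [CommRing R0] (D : ℕ) (f : MvPolynomial ρ R0)
    (hf : f.IsHomogeneous D) :
    f = ∑ i : Finset.finsuppAntidiag (Finset.univ : Finset ρ) D, monomial i.1 (coeff i.1 f) := by
  rw [Finset.sum_coe_sort (Finset.finsuppAntidiag Finset.univ D) (fun i => monomial i (coeff i f))]
  conv_lhs => rw [f.as_sum]
  refine Finset.sum_subset ?_ ?_
  · intro m hm
    have := hf (mem_support_iff.mp hm)
    simp only [Finset.mem_finsuppAntidiag]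
    refine ⟨?_, Finset.subset_univ _⟩
    rw [← this, Finsupp.weight_apply, Finsupp.sum_fintype _ _ (by simp)]
    simp
  · intro m _ hm
    rw [notMem_support_iff.mp hm, map_zero]

lemma monomial_antidiag_hom {ρ : Type} [Fintype ρ] [DecidableEq ρ] {R0 : Type} [CommRing R0] (D : ℕ)
    (i : Finset.finsuppAntidiag (Finset.univ : Finset ρ) D) (c : R0) :
    (monomial i.1 c).IsHomogeneous D := by
  apply isHomogeneous_monomial
  have := (Finset.mem_finsuppAntidiag.mp i.2).1
  rw [Finsupp.degree_eq_sum]; exact this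

lemma mat_of_family {I τ : Type} [Fintype I] (P : I → MvPolynomial τ ℤ) :
    ∃ (J : Type) (_ : Fintype J) (_ : DecidableEq J) (Λ : Matrix J I ℤ),
      ∀ (K : Type) [Field K] (c : I → K), (Λ.map (Int.castRingHom K)) *ᵥ c = 0 ↔
        ∑ i, c i • map (Int.castRingHom K) (P i) = 0 := by
  classical
  refine ⟨((Finset.univ : Finset I).biUnion fun i => (P i).support : Finset (τ →₀ ℕ)), inferInstance, inferInstance,
    Matrix.of fun j i => coeff j.1 (P i), ?_⟩
  intro K _ c
  have h2 : ∀ j, coeff j (∑ i : I, c i • map (Int.castRingHom K) (P i))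
      = ∑ i : I, ((coeff j (P i) : ℤ) : K) * c i := by
    intro j
    rw [coeff_sum]
    refine Finset.sum_congr rfl fun i _ => ?_
    rw [coeff_smul, coeff_map, smul_eq_mul, mul_comm]; rfl
  have h3 : ∀ j : ((Finset.univ : Finset I).biUnion fun i => (P i).support : Finset (τ →₀ ℕ)),
      (((Matrix.of fun (j : ((Finset.univ : Finset I).biUnion fun i => (P i).support : Finset (τ →₀ ℕ))) i =>
        coeff j.1 (P i)).map (Int.castRingHom K)) *ᵥ c) j = ∑ i : I, ((coeff j.1 (P i) : ℤ) : K) * c i := by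
    intro j
    simp [Matrix.mulVec, dotProduct]
  constructor
  · intro h
    ext j
    rw [h2, coeff_zero]
    by_cases hj : j ∈ ((Finset.univ : Finset I).biUnion fun i => (P i).support : Finset (τ →₀ ℕ))
    · rw [← h3 ⟨j, hj⟩, h]; rfl
    · apply Finset.sum_eq_zero
      intro i _
      have : coeff j (P i) = 0 := by
        rw [← notMem_support_iff]
        intro h'
        exact hj (Finset.mem_biUnion.mpr ⟨i, Finset.mem_univ _, h'⟩)
      rw [this]; simp
  · intro h
    funext j
    rw [h3, ← h2, h]; simp

variable (ta ha α) in
lemma exists_proj (D : ℕ) : ∃ (m : ℤ) (n : ℕ) (e : Fin n → MvPolynomial (Rho ta ha α) ℤ), m ≠ 0 ∧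
    (∀ i, (e i).IsHomogeneous D) ∧ ∀ (K : Type) [Field K] [Infinite K],
      (∀ i, map (Int.castRingHom K) (e i) ∈ quiverInvariants K ta ha α) ∧
      ((m : K) ≠ 0 → ∀ f ∈ quiverInvariants K ta ha α, f.IsHomogeneous D →
        f ∈ Submodule.span K (Set.range fun i => map (Int.castRingHom K) (e i))) := by
  classical
  let I := Finset.finsuppAntidiag (Finset.univ : Finset (Rho ta ha α)) D
  obtain ⟨J, _, _, Λ, hΛ0⟩ := mat_of_family (fun i : I => Lop ta ha α ℤ D (monomial i.1 1))
  have hΛ : ∀ (K : Type) [Field K] (c : I → K),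
      (Λ.map (Int.castRingHom K)) *ᵥ c = 0 ↔ Lop ta ha α K D (∑ i, monomial i.1 (c i)) = 0 := by
    intro K _ c
    have h1 : ∀ i : I, Lop ta ha α K D (monomial i.1 (c i)) =
        c i • map (Int.castRingHom K) (Lop ta ha α ℤ D (monomial i.1 1)) := by
      intro i
      rw [← Lop_map, ← map_smul, map_monomial]
      congr 1
      simp [smul_monomial]
    rw [map_sum]
    simp only [h1]
    exact hΛ0 K c
  obtain ⟨m, Γ, hm, hΓ⟩ := exists_geninv Λ
  let E : Matrix I I ℤ := m • (1 : Matrix I I ℤ) - Γ * Λ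
  have hΛE : Λ * E = 0 := by
    simp only [E, Matrix.mul_sub, Matrix.mul_smul, Matrix.mul_one, ← Matrix.mul_assoc, hΓ, sub_self]
  let eqv := Fintype.equivFin I
  let e' : I → MvPolynomial (Rho ta ha α) ℤ := fun k => ∑ i : I, monomial i.1 (E i k)
  refine ⟨m, Fintype.card I, fun k => e' (eqv.symm k), hm, fun k => ?_, fun K _ _ => ⟨fun k => ?_, ?_⟩⟩
  · exact IsHomogeneous.sum _ _ _ fun i _ => monomial_antidiag_hom D i _
  · set k' := eqv.symm k
    have h1 : map (Int.castRingHom K) (e' k') = ∑ i : I, monomial i.1 (E i k' : K) := by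
      simp only [e', map_sum, map_monomial]; rfl
    rw [h1, mem_qi_iff_Lop D _ (IsHomogeneous.sum _ _ _ fun i _ => monomial_antidiag_hom D i _), ← hΛ]
    have h2 := congrArg (fun X => X.map (Int.castRingHom K)) hΛE
    simp only [Matrix.map_mul] at h2
    funext j
    have := congrFun (congrFun h2 j) k'
    simpa [Matrix.mul_apply, Matrix.mulVec, dotProduct] using this
  · intro hmK f hf hfD
    set c : I → K := fun i => coeff i.1 f
    have hfc : f = ∑ i : I, monomial i.1 (c i) := hom_as_sum D f hfD
    have h0 : (Λ.map (Int.castRingHom K)) *ᵥ c = 0 := by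
      rw [hΛ, ← hfc]
      exact (mem_qi_iff_Lop D f hfD).mp hf
    have h1 : (E.map (Int.castRingHom K)) *ᵥ c = (m : K) • c := by
      have : E.map (Int.castRingHom K) = (m : K) • (1 : Matrix I I K) - Γ.map (Int.castRingHom K) * Λ.map (Int.castRingHom K) := by
        rw [← Matrix.map_mul]
        ext i j
        by_cases hij : i = j
        · subst hij; simp [E, -zsmul_one, -zsmul_eq_mul]
        · simp [E, Matrix.one_apply_ne hij, -zsmul_one, -zsmul_eq_mul]
      rw [this, Matrix.sub_mulVec, ← Matrix.mulVec_mulVec, h0, Matrix.smul_mulVec, Matrix.one_mulVec]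
      simp
    have h2 : f = ∑ k : I, ((m : K)⁻¹ * c k) • map (Int.castRingHom K) (e' k) := by
      have : ∀ i, c i = ∑ k, ((m : K)⁻¹ * c k) * (E i k : K) := by
        intro i
        have := congrFun h1 i
        simp only [Matrix.mulVec, dotProduct, Pi.smul_apply, smul_eq_mul, Matrix.map_apply] at this
        rw [eq_comm, ← eq_inv_mul_iff_mul_eq₀ hmK] at this
        rw [this, Finset.mul_sum]
        refine Finset.sum_congr rfl fun k _ => ?_
        simp only [eq_intCast]; ring
      conv_lhs => rw [hfc]
      simp only [e', map_sum, map_monomial, Finset.smul_sum]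
      rw [Finset.sum_comm]
      refine Finset.sum_congr rfl fun i _ => ?_
      conv_lhs => rw [this i]
      rw [map_sum]
      refine Finset.sum_congr rfl fun k _ => ?_
      rw [smul_monomial]; rfl
    rw [h2]
    refine Submodule.sum_mem _ fun k _ => Submodule.smul_mem _ _ (Submodule.subset_span ⟨eqv k, ?_⟩)
    simp

lemma decomp_of_adjoin {ρ K : Type} [Field K] (C0 : Subalgebra K (MvPolynomial ρ K)) (D0 : ℕ)
    (h : C0 ≤ Algebra.adjoin K {f | f ∈ C0 ∧ ∃ d ≤ D0, f.IsHomogeneous d})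
    (D : ℕ) (hD : D0 < D) (f : MvPolynomial ρ K) (hf : f ∈ C0) (hfD : f.IsHomogeneous D) :
    f ∈ Submodule.span K {x | ∃ i j, 0 < i ∧ 0 < j ∧ i + j = D ∧ ∃ a ∈ C0, ∃ b ∈ C0,
      a.IsHomogeneous i ∧ b.IsHomogeneous j ∧ x = a * b} := by
  have h1 := h hf
  rw [← Subalgebra.mem_toSubmodule, Algebra.adjoin_eq_span] at h1
  have h2 : ∀ x ∈ Submonoid.closure {f | f ∈ C0 ∧ ∃ d ≤ D0, f.IsHomogeneous d},
      x ∈ C0 ∧ ∃ d, x.IsHomogeneous d ∧ (d ≤ D0 ∨ ∃ i j, 0 < i ∧ 0 < j ∧ i + j = d ∧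
        ∃ a ∈ C0, ∃ b ∈ C0, a.IsHomogeneous i ∧ b.IsHomogeneous j ∧ x = a * b) := by
    intro x hx
    induction hx using Submonoid.closure_induction with
    | one => exact ⟨one_mem _, 0, isHomogeneous_one _ _, Or.inl (Nat.zero_le _)⟩
    | mem x hx =>
      obtain ⟨hx, d, hd, hxd⟩ := hx
      exact ⟨hx, d, hxd, Or.inl hd⟩
    | mul x y _ _ hx hy =>
      obtain ⟨hx, d, hxd, hx'⟩ := hx
      obtain ⟨hy, e, hye, hy'⟩ := hy
      refine ⟨mul_mem hx hy, d + e, hxd.mul hye, ?_⟩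
      rcases Nat.eq_zero_or_pos d with hd | hd
      · subst hd
        rcases hy' with hy' | ⟨i, j, hi, hj, hij, a, ha, b, hb, hai, hbj, rfl⟩
        · exact Or.inl (by omega)
        · refine Or.inr ⟨i, j, hi, hj, by omega, x * a, mul_mem hx ha, b, hb, ?_, hbj, by ring⟩
          simpa using hxd.mul hai
      rcases Nat.eq_zero_or_pos e with he | he
      · subst he
        rcases hx' with hx' | ⟨i, j, hi, hj, hij, a, ha, b, hb, hai, hbj, rfl⟩
        · exact Or.inl (by omega)
        · refine Or.inr ⟨i, j, hi, hj, by omega, y * a, mul_mem hy ha, b, hb, ?_, hbj, by ring⟩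
          simpa using hye.mul hai
      exact Or.inr ⟨d, e, hd, he, rfl, x, hx, y, hy, hxd, hye, rfl⟩
  have h3 : ∀ x ∈ Submodule.span K (Submonoid.closure {f | f ∈ C0 ∧ ∃ d ≤ D0, f.IsHomogeneous d} :
      Set (MvPolynomial ρ K)), homogeneousComponent D x ∈ 
      Submodule.span K {x | ∃ i j, 0 < i ∧ 0 < j ∧ i + j = D ∧ ∃ a ∈ C0, ∃ b ∈ C0,
      a.IsHomogeneous i ∧ b.IsHomogeneous j ∧ x = a * b} := by
    intro x hx
    induction hx using Submodule.span_induction with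
    | zero => simp
    | add x y _ _ hx hy => rw [map_add]; exact add_mem hx hy
    | smul c x _ hx => rw [map_smul]; exact Submodule.smul_mem _ _ hx
    | mem x hx =>
      obtain ⟨hxC, d, hxd, hx'⟩ := h2 x hx
      rw [homogeneousComponent_of_mem ((mem_homogeneousSubmodule _ _).mpr hxd)]
      split_ifs with hDd
      · subst hDd
        rcases hx' with hx' | hx'
        · omega
        · exact Submodule.subset_span hx'
      · exact zero_mem _
  have h4 := h3 f h1
  rwa [homogeneousComponent_of_mem ((mem_homogeneousSubmodule _ _).mpr hfD), if_pos rfl] at h4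

lemma span_mul_mem {K S : Type} [Field K] [CommRing S] [Algebra K S] {n m : ℕ} (u : Fin n → S) (w : Fin m → S)
    (Z : Submodule K S) (h : ∀ i j, u i * w j ∈ Z) (a b : S)
    (ha : a ∈ Submodule.span K (Set.range u)) (hb : b ∈ Submodule.span K (Set.range w)) : a * b ∈ Z := by
  have : Submodule.span K (Set.range u) * Submodule.span K (Set.range w) ≤ Z := by
    rw [Submodule.span_mul_span, Submodule.span_le]
    rintro _ ⟨_, ⟨i, rfl⟩, _, ⟨j, rfl⟩, rfl⟩
    exact h i j
  exact this (Submodule.mul_mem_mul ha hb)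

theorem P4main (D0 : ℕ)
    (hp : ∀ (p : ℕ) [Fact p.Prime], quiverInvariants (AlgebraicClosure (ZMod p)) ta ha α ≤
      Algebra.adjoin _ {f | f ∈ quiverInvariants (AlgebraicClosure (ZMod p)) ta ha α ∧
        ∃ d ≤ D0, f.IsHomogeneous d})
    (K : Type) [Field K] [CharZero K] :
    quiverInvariants K ta ha α ≤
      Algebra.adjoin K {f | f ∈ quiverInvariants K ta ha α ∧ ∃ d ≤ D0, f.IsHomogeneous d} := by
  classical
  haveI : Infinite K := inferInstance
  choose m n e hm0 hhom hK using exists_proj ta ha α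
  have key : ∀ D, D0 < D → ∀ δ, map (Int.castRingHom ℚ) (e D δ) ∈ Submodule.span ℚ
      {x | ∃ i j, 0 < i ∧ 0 < j ∧ i + j = D ∧ ∃ s t, x = map (Int.castRingHom ℚ) (e i s * e j t)} := by
    intro D hD δ
    by_contra hcon
    obtain ⟨f, hf1, hf2⟩ := Submodule.exists_le_ker_of_notMem hcon
    let I := Finset.finsuppAntidiag (Finset.univ : Finset (Rho ta ha α)) D
    obtain ⟨b, hb⟩ := IsLocalization.exist_integer_multiples_of_finite (nonZeroDivisors ℤ)
      (fun i : I => f (monomial i.1 1))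
    choose η hη using hb
    -- integer functional
    let F : MvPolynomial (Rho ta ha α) ℤ → ℤ := fun z => ∑ i : I, η i * coeff i.1 z
    have hF : ∀ z : MvPolynomial (Rho ta ha α) ℤ, z.IsHomogeneous D →
        (F z : ℚ) = (b : ℤ) * f (map (Int.castRingHom ℚ) z) := by
      intro z hz
      conv_rhs => rw [hom_as_sum D z hz]
      rw [map_sum, map_sum, Finset.mul_sum]
      simp only [F]
      push_cast
      refine Finset.sum_congr rfl fun i _ => ?_
      have h1 := hη i
      rw [map_monomial]
      have h2 : monomial i.1 ((Int.castRingHom ℚ) (coeff i.1 z)) = ((coeff i.1 z : ℤ) : ℚ) • monomial i.1 (1 : ℚ) := by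
        rw [smul_monomial]; simp
      rw [h2, map_smul]
      simp only [eq_intCast, zsmul_eq_mul, smul_eq_mul] at h1 ⊢
      rw [h1]; ring
    have hc : F (e D δ) ≠ 0 := by
      intro h0
      have := hF _ (hhom D δ)
      rw [h0] at this
      simp only [Int.cast_zero, zero_eq_mul, Int.cast_eq_zero] at this
      exact this.elim (nonZeroDivisors.coe_ne_zero b) hf1
    have hprod : F (e D δ) * ∏ i ∈ Finset.range (D+1), m i ≠ 0 :=
      mul_ne_zero hc (Finset.prod_ne_zero_iff.mpr fun i _ => hm0 i)
    obtain ⟨p, hpge, hpp⟩ := Nat.exists_infinite_primes ((F (e D δ) * ∏ i ∈ Finset.range (D+1), m i).natAbs + 1)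
    haveI : Fact p.Prime := ⟨hpp⟩
    have hpn : ¬ (p : ℤ) ∣ (F (e D δ) * ∏ i ∈ Finset.range (D+1), m i) := by
      intro hdvd
      have := Int.natAbs_dvd_natAbs.mpr hdvd
      have := Nat.le_of_dvd (Int.natAbs_pos.mpr hprod) this
      simp at this hpge
      omega
    obtain ⟨Kp, _, _, _, hp⟩ : ∃ (Kp : Type) (_ : Field Kp) (_ : Infinite Kp) (_ : CharP Kp p),
        quiverInvariants Kp ta ha α ≤ Algebra.adjoin _ {f | f ∈ quiverInvariants Kp ta ha α ∧
        ∃ d ≤ D0, f.IsHomogeneous d} :=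
      ⟨AlgebraicClosure (ZMod p), inferInstance, inferInstance,
        charP_of_injective_algebraMap (algebraMap (ZMod p) (AlgebraicClosure (ZMod p))).injective p, hp p⟩
    have hcast : ∀ z : ℤ, (z : Kp) = 0 ↔ (p : ℤ) ∣ z := fun z => CharP.intCast_eq_zero_iff Kp p z
    have hmi : ∀ i ≤ D, (m i : Kp) ≠ 0 := by
      intro i hi h0
      rw [hcast] at h0
      exact hpn (Dvd.dvd.mul_left (h0.trans (Finset.dvd_prod_of_mem _ (by simp; omega))) _)
    have hdec := decomp_of_adjoin _ D0 hp D hD _ ((hK D Kp).1 δ) ((hhom D δ).map _)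
    let Fp : MvPolynomial (Rho ta ha α) Kp →ₗ[Kp] Kp := ∑ i : I, (η i : Kp) • lcoeff Kp i.1
    have hFp : ∀ z : MvPolynomial (Rho ta ha α) ℤ, Fp (map (Int.castRingHom Kp) z) = (F z : Kp) := by
      intro z
      simp only [Fp, F, LinearMap.sum_apply, LinearMap.smul_apply, lcoeff_apply, coeff_map]
      push_cast
      rfl
    have hle : Submodule.span Kp {x | ∃ i j, 0 < i ∧ 0 < j ∧ i + j = D ∧
        ∃ a ∈ quiverInvariants Kp ta ha α, ∃ b ∈ quiverInvariants Kp ta ha α,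
        a.IsHomogeneous i ∧ b.IsHomogeneous j ∧ x = a * b} ≤ LinearMap.ker Fp := by
      rw [Submodule.span_le]
      rintro _ ⟨i, j, hi, hj, hij, a, ha, b', hb', hai, hbj, rfl⟩
      refine span_mul_mem _ _ _ ?_ a b' ((hK i Kp).2 (hmi i (by omega)) a ha hai)
        ((hK j Kp).2 (hmi j (by omega)) b' hb' hbj)
      intro s t
      rw [← map_mul, LinearMap.mem_ker, hFp]
      have h1 := hF (e i s * e j t) (by rw [← hij]; exact (hhom i s).mul (hhom j t))
      have h2 : f (map (Int.castRingHom ℚ) (e i s * e j t)) = 0 :=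
        hf2 (Submodule.subset_span ⟨i, j, hi, hj, hij, s, t, rfl⟩)
      rw [h2, mul_zero, Int.cast_eq_zero] at h1
      rw [h1, Int.cast_zero]
    have h3 := hle hdec
    rw [LinearMap.mem_ker, hFp, hcast] at h3
    exact hpn (Dvd.dvd.mul_right h3 _)
  set A := Algebra.adjoin K {f | f ∈ quiverInvariants K ta ha α ∧ ∃ d ≤ D0, f.IsHomogeneous d}
  have hmain : ∀ D, ∀ f ∈ quiverInvariants K ta ha α, f.IsHomogeneous D → f ∈ A := by
    intro D
    induction D using Nat.strong_induction_on with
    | _ D ihD =>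
    intro f hf hfD
    by_cases hDe : D ≤ D0
    · exact Algebra.subset_adjoin ⟨hf, D, hDe, hfD⟩
    push Not at hDe
    have h1 := (hK D K).2 (by exact_mod_cast hm0 D) f hf hfD
    have h2 : Submodule.span K (Set.range fun i => map (Int.castRingHom K) (e D i)) ≤ Subalgebra.toSubmodule A := by
      rw [Submodule.span_le]
      rintro _ ⟨δ, rfl⟩
      have h3 : ∀ x ∈ Submodule.span ℚ
          {x | ∃ i j, 0 < i ∧ 0 < j ∧ i + j = D ∧ ∃ s t, x = map (Int.castRingHom ℚ) (e i s * e j t)},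
          map (algebraMap ℚ K) x ∈ A := by
        intro x hx
        induction hx using Submodule.span_induction with
        | zero => simp
        | add x y _ _ hx hy => rw [map_add]; exact add_mem hx hy
        | smul c x _ hx =>
          rw [smul_eq_C_mul, map_mul, map_C, ← smul_eq_C_mul]; exact Subalgebra.smul_mem _ hx _
        | mem x hx =>
          obtain ⟨i, j, hi, hj, hij, s, t, rfl⟩ := hx
          rw [MvPolynomial.map_map, map_mul]
          have : (algebraMap ℚ K).comp (Int.castRingHom ℚ) = Int.castRingHom K := RingHom.ext_int _ _
          rw [this]
          exact mul_mem (ihD i (by omega) _ ((hK i K).1 s) ((hhom i s).map _))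
            (ihD j (by omega) _ ((hK j K).1 t) ((hhom j t).map _))
      have h4 := h3 _ (key D hDe δ)
      rw [MvPolynomial.map_map] at h4
      have : (algebraMap ℚ K).comp (Int.castRingHom ℚ) = Int.castRingHom K := RingHom.ext_int _ _
      rwa [this] at h4
    exact h2 h1
  intro f hf
  rw [← sum_homogeneousComponent f]
  exact sum_mem fun i _ => hmain i _ (qi_graded f hf i) (homogeneousComponent_isHomogeneous i f)

end P4
end QInv


namespace QInv

section Shirshov
set_option linter.unusedSectionVars false

lemma lex_app {ι : Type} [LinearOrder ι] : ∀ (u v a b : List ι), u.length = v.length → u < v → u ++ a < v ++ b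
  | [], [], a, b, _, h => absurd h (lt_irrefl _)
  | x :: u, y :: v, a, b, hl, h => by
    rw [List.cons_append, List.cons_append, List.cons_lt_cons_iff]
    rw [List.cons_lt_cons_iff] at h
    rcases h with h | ⟨h1, h2⟩
    · exact Or.inl h
    · exact Or.inr ⟨h1, lex_app u v a b (by simpa using hl) h2⟩

lemma lex_left {ι : Type} [LinearOrder ι] (p : List ι) {u v : List ι} (h : u < v) : p ++ u < p ++ v := by
  induction p with
  | nil => simpa
  | cons x p ih => rw [List.cons_append, List.cons_append, List.cons_lt_cons_iff]; exact Or.inr ⟨rfl, ih⟩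

lemma lex_flatten {ι : Type} [LinearOrder ι] : ∀ {d : ℕ} (x y : Fin d → List ι) (j : Fin d)
    (_ : ∀ i < j, x i = y i) (_ : ∀ s t, x j ++ s < y j ++ t),
    (List.ofFn x).flatten < (List.ofFn y).flatten
  | 0, _, _, j, _, _ => j.elim0
  | d + 1, x, y, j, h1, h2 => by
    rw [List.ofFn_succ, List.ofFn_succ, List.flatten_cons, List.flatten_cons]
    induction j using Fin.cases with
    | zero => exact h2 _ _
    | succ j =>
      rw [h1 0 (Fin.succ_pos _)]
      apply lex_left
      exact lex_flatten _ _ j (fun i hi => h1 _ (Fin.succ_lt_succ_iff.mpr hi)) h2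

variable {ι R E : Type} [LinearOrder ι] [Fintype ι] [CommRing R] [Ring E] [Algebra R E] (X : ι → E)

/-- value of a word -/
def wv (w : List ι) : E := (w.map X).prod

lemma wv_append (u v : List ι) : wv X (u ++ v) = wv X u * wv X v := by simp [wv]

lemma wv_flatten (l : List (List ι)) : wv X l.flatten = (l.map (wv X)).prod := by
  induction l with
  | nil => simp [wv]
  | cons a l ih => rw [List.flatten_cons, wv_append, ih]; simp

variable (R) in
/-- reducible words -/
def red (w : List ι) : Prop :=
  wv X w ∈ Submodule.span R (wv X '' {w' | w'.length < w.length ∨ (w'.length = w.length ∧ w' < w)})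

lemma red_factor (p w s : List ι) (h : red R X w) : red R X (p ++ w ++ s) := by
  unfold red at h ⊢
  rw [wv_append, wv_append]
  have : ∀ y ∈ Submodule.span R (wv X '' {w' | w'.length < w.length ∨ (w'.length = w.length ∧ w' < w)}),
      wv X p * y * wv X s ∈ Submodule.span R (wv X '' {w' | w'.length < (p ++ w ++ s).length ∨
        (w'.length = (p ++ w ++ s).length ∧ w' < p ++ w ++ s)}) := by
    intro y hy
    induction hy using Submodule.span_induction with
    | zero => simp
    | add x y _ _ hx hy => rw [mul_add, add_mul]; exact add_mem hx hy
    | smul c x _ hx => rw [mul_smul_comm, smul_mul_assoc]; exact Submodule.smul_mem _ _ hx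
    | mem x hx =>
      obtain ⟨w', hw', rfl⟩ := hx
      apply Submodule.subset_span
      refine ⟨p ++ w' ++ s, ?_, by rw [wv_append, wv_append]⟩
      rcases hw' with hw' | ⟨h1, h2⟩
      · left; simp; omega
      · right
        refine ⟨by simp [h1], ?_⟩
        rw [List.append_assoc, List.append_assoc]
        exact lex_left p (lex_app _ _ _ _ h1 h2)
  exact this _ h

lemma red_PI (d ℓ : ℕ)
    (hPI : ∀ x : Fin d → E, ∑ σ : Equiv.Perm (Fin d), Equiv.Perm.sign σ • (List.ofFn (x ∘ σ)).prod = 0)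
    (u r : Fin d → List ι) (hl : ∀ i, (u i).length = ℓ) (hu : ∀ i j, i < j → u j < u i) :
    red R X (List.ofFn fun i => u i ++ r i).flatten := by
  classical
  set x : Fin d → List ι := fun i => u i ++ r i
  have h := hPI (fun i => wv X (x i))
  have h2 : ∀ σ : Equiv.Perm (Fin d), (List.ofFn ((fun i => wv X (x i)) ∘ σ)).prod =
      wv X (List.ofFn (x ∘ σ)).flatten := by
    intro σ
    rw [wv_flatten, List.map_ofFn]; rfl
  simp only [h2] at h
  rw [Fintype.sum_eq_add_sum_compl (1 : Equiv.Perm (Fin d))] at h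
  simp only [Equiv.Perm.sign_one, one_smul, Equiv.Perm.coe_one, Function.comp_id] at h
  unfold red
  rw [eq_neg_of_add_eq_zero_left h]
  apply neg_mem
  refine sum_mem fun σ hσ => ?_
  have hσ1 : σ ≠ 1 := by simpa using hσ
  have hmem : wv X (List.ofFn (x ∘ σ)).flatten ∈ Submodule.span R (wv X '' {w' | w'.length < (List.ofFn x).flatten.length ∨
      (w'.length = (List.ofFn x).flatten.length ∧ w' < (List.ofFn x).flatten)}) := by
    apply Submodule.subset_span
    refine ⟨_, Or.inr ⟨?_, ?_⟩, rfl⟩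
    · simp only [List.length_flatten, List.map_ofFn, List.sum_ofFn]
      exact Equiv.sum_comp σ (fun i => (x i).length)
    · have hne : ∃ j, σ j ≠ j := by
        by_contra hcon
        push Not at hcon
        exact hσ1 (Equiv.ext hcon)
      obtain ⟨j, hj, hjm⟩ : ∃ j, σ j ≠ j ∧ ∀ i < j, σ i = i := by
        obtain ⟨j, hj, hm⟩ := WellFounded.has_min (wellFounded_lt (α := Fin d)) {j | σ j ≠ j} hne
        exact ⟨j, hj, fun i hi => by by_contra hc; exact hm i hc hi⟩
      have hlt : j < σ j := by
        by_contra hc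
        have h3 : σ j < j := lt_of_le_of_ne (not_lt.mp hc) hj
        exact hj (σ.injective (hjm _ h3))
      refine lex_flatten _ _ j (fun i hi => ?_) (fun s t => ?_)
      · simp [hjm i hi]
      · simp only [Function.comp, x, List.append_assoc]
        exact lex_app _ _ _ _ (by rw [hl, hl]) (hu _ _ hlt)
  rcases Int.units_eq_one_or (Equiv.Perm.sign σ) with h' | h'
  · rw [h', one_smul]; exact hmem
  · rw [h', Units.neg_smul, one_smul]; exact neg_mem hmem

lemma red_pow (m : ℕ) (u : List ι) (hu : 0 < u.length)
    (h : wv X u ^ m ∈ Submodule.span R {y | ∃ k < m, y = wv X u ^ k}) :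
    red R X (List.replicate m u).flatten := by
  have h1 : ∀ k, wv X (List.replicate k u).flatten = wv X u ^ k := by
    intro k; rw [wv_flatten]; simp
  unfold red
  rw [h1]
  refine Submodule.span_mono ?_ h
  rintro _ ⟨k, hk, rfl⟩
  refine ⟨_, Or.inl ?_, h1 k⟩
  simp only [List.length_flatten, List.map_replicate, List.sum_replicate, smul_eq_mul]
  exact Nat.mul_lt_mul_of_pos_right hk hu

lemma drop_flatten (w : List ι) : ∀ (d : ℕ) (P : ℕ → ℕ), (∀ k < d, P k ≤ P (k+1)) →
    w.drop (P 0) = (List.ofFn fun k : Fin d => (w.drop (P k)).take (P (k+1) - P k)).flatten ++ w.drop (P d)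
  | 0, P, _ => by simp
  | d + 1, P, h => by
    rw [List.ofFn_succ, List.flatten_cons]
    have ih := drop_flatten w d (fun k => P (k + 1)) (fun k hk => h _ (by omega))
    simp only [zero_add] at ih
    simp only [Fin.val_zero, Fin.val_succ, zero_add, List.append_assoc]
    rw [← ih]
    have h0 := h 0 (by omega)
    rw [show w.drop (P (0+1)) = (w.drop (P 0)).drop (P (0+1) - P 0) by rw [List.drop_drop]; congr 1; omega]
    rw [List.take_append_drop]

lemma periodic (β : List ι) (i j ℓ : ℕ) (hij : i < j) 
    (h : (β.drop i).take ℓ = (β.drop j).take ℓ) : ∀ m, (m * (j - i) ≤ ℓ) →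
    (β.drop i).take (m * (j - i)) = (List.replicate m ((β.drop i).take (j - i))).flatten
  | 0, _ => by simp
  | m + 1, hm => by
    have hm' : m * (j - i) ≤ ℓ := le_trans (Nat.mul_le_mul_right _ (Nat.le_succ m)) hm
    rw [List.replicate_succ, List.flatten_cons, ← periodic β i j ℓ hij h m hm']
    rw [add_mul, one_mul, add_comm, List.take_add, List.drop_drop, show i + (j - i) = j by omega]
    congr 1
    have := congrArg (List.take (m * (j - i))) h
    rw [List.take_take, List.take_take, min_eq_left hm'] at this
    exact this.symm

theorem shirshov (d m : ℕ) (hd : 0 < d)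
    (hPI : ∀ x : Fin d → E, ∑ σ : Equiv.Perm (Fin d), Equiv.Perm.sign σ • (List.ofFn (x ∘ σ)).prod = 0)
    (hint : ∀ u : List ι, 0 < u.length → u.length < d →
      wv X u ^ m ∈ Submodule.span R {y | ∃ k < m, y = wv X u ^ k}) :
    ∃ r, 0 < r ∧ ∀ w : List ι, w.length = r → red R X w := by
  classical
  set ℓ := m * d with hℓ
  set b := d + ℓ with hb
  set Nb := (d * Fintype.card (Fin b → ι)) + 1 with hNb
  refine ⟨b * Nb, by positivity, fun w hw => ?_⟩
  have hblk : ∀ t : Fin Nb, t * b + b ≤ w.length := by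
    intro t
    rw [hw]
    calc t * b + b = b * (t + 1) := by ring
      _ ≤ b * Nb := Nat.mul_le_mul_left _ t.2
  -- windows
  by_cases hper : ∃ t : Fin Nb, ∃ i j, i < j ∧ j < d ∧
      (w.drop (t * b + i)).take ℓ = (w.drop (t * b + j)).take ℓ
  · obtain ⟨t, i, j, hij, hj, he⟩ := hper
    have hle : m * ((t * b + j) - (t * b + i)) ≤ ℓ := Nat.mul_le_mul_left m (by omega)
    have h1 := periodic w (t * b + i) (t * b + j) ℓ (by omega) he m hle
    have hlen : ((w.drop (t * b + i)).take ((t * b + j) - (t * b + i))).length = j - i := by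
      have := hblk t
      simp only [List.length_take, List.length_drop]; omega
    have h2 := red_pow X m ((w.drop (t * b + i)).take ((t * b + j) - (t * b + i)))
      (by rw [hlen]; omega) (hint _ (by rw [hlen]; omega) (by rw [hlen]; omega))
    rw [← h1] at h2
    have h3 := red_factor X (w.take (t * b + i)) _ ((w.drop (t * b + i)).drop (m * ((t * b + j) - (t * b + i)))) h2
    rwa [List.append_assoc, List.take_append_drop, List.take_append_drop] at h3
  push Not at hper
  -- pigeonhole
  let cont : Fin Nb → (Fin b → ι) := fun t s => w.get ⟨t * b + s, by have := hblk t; omega⟩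
  obtain ⟨β, -, hβ⟩ := Finset.exists_lt_card_fiber_of_mul_lt_card_of_maps_to (s := (Finset.univ : Finset (Fin Nb)))
    (t := (Finset.univ : Finset (Fin b → ι))) (f := cont) (n := d) (fun _ _ => Finset.mem_univ _)
    (by simp [hNb, mul_comm])
  obtain ⟨J, hJ, hJd⟩ := Finset.exists_subset_card_eq hβ.le
  have hcont : ∀ t ∈ J, (w.drop (t * b)).take b = List.ofFn β := by
    intro t ht
    have h1 : cont t = β := (Finset.mem_filter.mp (hJ ht)).2
    subst h1
    apply List.ext_get
    · have := hblk t
      simp; omega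
    · intro k hk1 hk2
      simp [cont]
  have hwin : ∀ t ∈ J, ∀ i < d, (w.drop (t * b + i)).take ℓ = ((List.ofFn β).drop i).take ℓ := by
    intro t ht i hi
    rw [← hcont t ht, List.drop_take, List.take_take, List.drop_drop, min_eq_left (by omega)]
  let win : Fin d → List ι := fun i => ((List.ofFn β).drop i).take ℓ
  have hJne : ∃ t, t ∈ J := by
    have : 0 < J.card := by omega
    exact Finset.card_pos.mp this
  obtain ⟨t0, ht0⟩ := hJne
  have hwinj : Function.Injective win := by
    intro i j hij
    by_contra hne
    rcases lt_or_gt_of_ne hne with h | h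
    · refine hper t0 i j h j.2 ?_
      rw [hwin t0 ht0 i i.2, hwin t0 ht0 j j.2]; exact hij
    · refine hper t0 j i h i.2 ?_
      rw [hwin t0 ht0 i i.2, hwin t0 ht0 j j.2]; exact hij.symm
  -- sort the windows
  let Wn := Finset.univ.image win
  have hWn : Wn.card = d := by rw [Finset.card_image_of_injective _ hwinj]; simp
  let u : Fin d → List ι := fun k => Wn.orderEmbOfFin hWn (Fin.rev k)
  have hu : ∀ i j, i < j → u j < u i := by
    intro i j hij
    exact (Wn.orderEmbOfFin hWn).strictMono (Fin.rev_lt_rev.mpr hij)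
  have hu2 : ∀ k, ∃ i, win i = u k := by
    intro k
    have := Finset.orderEmbOfFin_mem Wn hWn (Fin.rev k)
    obtain ⟨i, -, hi⟩ := Finset.mem_image.mp this
    exact ⟨i, hi⟩
  choose τ hτ using hu2
  let jj : Fin d → Fin Nb := J.orderEmbOfFin hJd
  have hjJ : ∀ k, jj k ∈ J := fun k => Finset.orderEmbOfFin_mem J hJd k
  have hjm : ∀ i j, i < j → jj i < jj j := fun i j h => (J.orderEmbOfFin hJd).strictMono h
  let P : ℕ → ℕ := fun k => if h : k < d then jj ⟨k, h⟩ * b + τ ⟨k, h⟩ else w.length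
  have hP1 : ∀ k (h : k < d), P k = jj ⟨k, h⟩ * b + τ ⟨k, h⟩ := fun k h => by simp [P, h]
  have hP2 : ∀ k < d, P k + ℓ ≤ P (k + 1) := by
    intro k hk
    rw [hP1 k hk]
    have := (τ ⟨k, hk⟩).2
    by_cases hk' : k + 1 < d
    · rw [hP1 _ hk']
      have h1 : (jj ⟨k, hk⟩ : ℕ) + 1 ≤ jj ⟨k+1, hk'⟩ := hjm ⟨k, hk⟩ ⟨k+1, hk'⟩ (by simp)
      have h2 := Nat.mul_le_mul_right b h1
      rw [add_mul, one_mul] at h2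
      omega
    · have : P (k+1) = w.length := by simp [P, hk']
      rw [this]
      have := hblk (jj ⟨k, hk⟩)
      omega
  have hdf := drop_flatten w d P (fun k hk => le_trans (Nat.le_add_right _ _) (hP2 k hk))
  have hx : ∀ k : Fin d, (w.drop (P k)).take (P (k+1) - P k) =
      u k ++ ((w.drop (P k)).take (P (k+1) - P k)).drop ℓ := by
    intro k
    have h1 : u k = ((w.drop (P k)).take (P (k+1) - P k)).take ℓ := by
      rw [List.take_take, min_eq_left (by have := hP2 k k.2; omega), hP1 k k.2,
        hwin _ (hjJ _) _ (τ _).2, ← hτ k]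
    conv_rhs => rw [h1]
    rw [List.take_append_drop]
  have hul : ∀ k, (u k).length = ℓ := by
    intro k
    rw [← hτ k]
    have := (τ k).2
    simp [win]; omega
  have hred := red_PI (R := R) X d ℓ hPI u (fun k => ((w.drop (P k)).take (P (k+1) - P k)).drop ℓ) hul hu
  simp only [← hx] at hred
  have h3 := red_factor X (w.take (P 0)) _ (w.drop (P d)) hred
  rwa [List.append_assoc, ← hdf, List.take_append_drop] at h3

/-- consequence: the algebra is finite -/
theorem shirshov_span (d m : ℕ) (hd : 0 < d)
    (hPI : ∀ x : Fin d → E, ∑ σ : Equiv.Perm (Fin d), Equiv.Perm.sign σ • (List.ofFn (x ∘ σ)).prod = 0)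
    (hint : ∀ u : List ι, 0 < u.length → u.length < d →
      wv X u ^ m ∈ Submodule.span R {y | ∃ k < m, y = wv X u ^ k}) :
    ∃ r, 0 < r ∧ ∀ w : List ι, w.length ≤ r → wv X w ∈ Submodule.span R (wv X '' {w' | w'.length < r}) := by
  obtain ⟨r, hr, h⟩ := shirshov (R := R) X d m hd hPI hint
  refine ⟨r, hr, fun w hw => ?_⟩
  rcases lt_or_eq_of_le hw with hw | hw
  · exact Submodule.subset_span ⟨w, hw, rfl⟩
  have hfin : {w : List ι | w.length = r}.Finite := List.finite_length_eq ι r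
  have key : ∀ w ∈ {w : List ι | w.length = r}, wv X w ∈ Submodule.span R (wv X '' {w' | w'.length < r}) := by
    intro w hw
    refine (hfin.wellFoundedOn (r := (· < ·))).induction
      (P := fun w => wv X w ∈ Submodule.span R (wv X '' {w' | w'.length < r})) hw ?_
    intro w hw ih
    have h1 := h w hw
    unfold red at h1
    refine (Submodule.span_le.mpr ?_) h1
    rintro _ ⟨w', hw', rfl⟩
    have hw2 : w.length = r := hw
    rcases hw' with hw' | ⟨hw', hlt⟩
    · exact Submodule.subset_span ⟨w', by simpa [hw2] using hw', rfl⟩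
    · exact ih w' (by simp [hw', hw2]) hlt
  exact key w hw

end Shirshov
end QInv


namespace QInv

section P2b
set_option linter.unusedSectionVars false
open scoped Kronecker

lemma std_id {n F : Type} [Fintype n] [DecidableEq n] [Field F] (d : ℕ) (hd : Fintype.card n * Fintype.card n < d)
    (x : Fin d → Matrix n n F) :
    ∑ σ : Equiv.Perm (Fin d), Equiv.Perm.sign σ • (List.ofFn (x ∘ σ)).prod = 0 := by
  have h := AlternatingMap.map_linearDependent (K := F)
    (MultilinearMap.alternatization (MultilinearMap.mkPiAlgebraFin F d (Matrix n n F))) x (by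
      intro hli
      have := hli.fintype_card_le_finrank
      rw [Module.finrank_matrix] at this
      simp at this
      omega)
  rw [MultilinearMap.alternatization_apply] at h
  exact h

lemma field_lemma {n k ι : Type} [Fintype n] [DecidableEq n] [Field k] [Fintype ι]
    (X : ι → Matrix n n k) (w : List ι) (hw : w ≠ []) (h : (1 - wv X w).det = 0) :
    ∃ T : ι → Matrix n n k, (1 - ∑ a, X a ⊗ₖ T a).det = 0 := by
  classical
  obtain ⟨z, hz0, hz⟩ := Matrix.exists_mulVec_eq_zero_iff.mpr h
  rw [Matrix.sub_mulVec, Matrix.one_mulVec, sub_eq_zero] at hz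
  let W : Submodule k (n → k) := Submodule.span k (Set.range fun s : List ι => wv X s *ᵥ z)
  have hzW : z ∈ W := Submodule.subset_span ⟨[], by simp [wv]⟩
  have hW : ∀ x ∈ W, ∃ y : ι → (n → k), (∀ a, y a ∈ W) ∧ x = ∑ a, X a *ᵥ y a := by
    intro x hx
    have hcons : ∀ (a : ι) (s : List ι), ∃ y : ι → (n → k), (∀ a, y a ∈ W) ∧ wv X (a :: s) *ᵥ z = ∑ a, X a *ᵥ y a := by
      intro a s
      refine ⟨fun b => if b = a then wv X s *ᵥ z else 0, fun b => ?_, ?_⟩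
      · by_cases hb : b = a
        · simp only [hb, if_true]; exact Submodule.subset_span ⟨s, rfl⟩
        · simp [hb]
      · rw [Finset.sum_eq_single a]
        · simp [wv, Matrix.mulVec_mulVec]
        · intro b _ hb; simp [hb]
        · simp
    induction hx using Submodule.span_induction with
    | zero => exact ⟨fun _ => 0, fun _ => zero_mem _, by simp⟩
    | add x y _ _ hx hy =>
      obtain ⟨y1, h1, h1'⟩ := hx
      obtain ⟨y2, h2, h2'⟩ := hy
      refine ⟨fun a => y1 a + y2 a, fun a => add_mem (h1 a) (h2 a), ?_⟩
      simp only [Matrix.mulVec_add, Finset.sum_add_distrib, ← h1', ← h2']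
    | smul c x _ hx =>
      obtain ⟨y1, h1, h1'⟩ := hx
      refine ⟨fun a => c • y1 a, fun a => Submodule.smul_mem _ _ (h1 a), ?_⟩
      simp only [Matrix.mulVec_smul, ← Finset.smul_sum, ← h1']
    | mem x hx =>
      obtain ⟨s, rfl⟩ := hx
      rcases s with _ | ⟨a, s⟩
      · obtain ⟨a, s, rfl⟩ := List.exists_cons_of_ne_nil hw
        have : wv X [] *ᵥ z = wv X (a :: s) *ᵥ z := by rw [← hz]; simp [wv]
        simp only [this]
        exact hcons a s
      · exact hcons a s
  obtain ⟨p, hp⟩ := W.subtype.exists_leftInverse_of_injective (by simp)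
  let Z : n → (n → k) := fun q => (p (Pi.single q 1) : n → k)
  have hZW : ∀ q, Z q ∈ W := fun q => (p (Pi.single q 1)).2
  have hspan : ∀ x ∈ W, ∃ c : n → k, x = ∑ q, c q • Z q := by
    intro x hx
    refine ⟨x, ?_⟩
    have h1 := LinearMap.congr_fun hp ⟨x, hx⟩
    simp only [LinearMap.comp_apply, Submodule.subtype_apply, LinearMap.id_apply] at h1
    have h2 : x = ∑ q, x q • (Pi.single q 1 : n → k) := by
      ext q; simp [Finset.sum_apply, Pi.single_apply]
    have h3 := congrArg Subtype.val h1
    simp only at h3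
    rw [← h3]
    conv_lhs => rw [h2, map_sum]
    simp [Z]
    rw [h3]
  choose y hy1 hy2 using fun q => hW (Z q) (hZW q)
  choose T hT using fun a q => hspan (y q a) (hy1 q a)
  refine ⟨fun a => Matrix.of (T a), ?_⟩
  rw [← Matrix.exists_mulVec_eq_zero_iff]
  refine ⟨fun pq => Z pq.2 pq.1, ?_, ?_⟩
  · intro h0
    apply hz0
    obtain ⟨c, hc⟩ := hspan z hzW
    rw [hc]
    apply Finset.sum_eq_zero
    intro q _
    have : Z q = 0 := by
      ext s; exact congrFun h0 (s, q)
    rw [this, smul_zero]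
  · rw [Matrix.sub_mulVec, Matrix.one_mulVec, sub_eq_zero]
    funext ⟨s, q⟩
    have h1 := congrFun (hy2 q) s
    rw [h1]
    rw [Finset.sum_apply]
    simp only [Matrix.mulVec, dotProduct, Matrix.sum_apply, Finset.sum_mul]
    rw [Finset.sum_comm (s := (Finset.univ : Finset (n × n)))]
    refine Finset.sum_congr rfl fun a _ => ?_
    rw [Fintype.sum_prod_type]
    refine Finset.sum_congr rfl fun s' _ => ?_
    rw [congrFun (hT a q) s', Finset.sum_apply, Finset.mul_sum]
    refine Finset.sum_congr rfl fun q' _ => ?_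
    simp [Matrix.kroneckerMap_apply]; ring

variable {F : Type} [Field F] (O : ValuationSubring F)

lemma cramer_lattice {m : ℕ} (V : Set (Fin m → F)) (hV : V.Finite) (hI : ∀ i, (Pi.single i 1 : Fin m → F) ∈ V) :
    ∃ A B : Matrix (Fin m) (Fin m) F, A * B = 1 ∧ (∀ j, (fun i => B i j) ∈ V) ∧
      ∀ x ∈ V, ∀ i, (A *ᵥ x) i ∈ O := by
  classical
  let 𝒢 : Set (Fin m → (Fin m → F)) := {c | ∀ j, c j ∈ V}
  have hfin : 𝒢.Finite := by
    have : 𝒢 = Set.pi Set.univ (fun _ => V) := by ext; simp [𝒢]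
    rw [this]
    exact Set.Finite.pi' (fun _ => hV) |>.subset (by intro c hc; simpa using hc)
  have hne : 𝒢.Nonempty := ⟨fun j => Pi.single j 1, hI⟩
  obtain ⟨c, hc, hmax⟩ := Set.exists_max_image 𝒢 (fun c => O.valuation (Matrix.of fun i j => c j i).det) hfin hne
  set G : Matrix (Fin m) (Fin m) F := Matrix.of fun i j => c j i with hG
  have hdet : G.det ≠ 0 := by
    intro h0
    have := hmax (fun j => Pi.single j 1) hI
    have h1 : (Matrix.of fun i j => (Pi.single j 1 : Fin m → F) i) = (1 : Matrix (Fin m) (Fin m) F) := by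
      ext i j; simp [Matrix.one_apply, Pi.single_apply]
    simp only [h1, h0, Matrix.det_one, map_one, map_zero] at this
    exact absurd this (by simp)
  refine ⟨G⁻¹, G, Matrix.nonsing_inv_mul _ (isUnit_iff_ne_zero.mpr hdet), fun j => hc j, ?_⟩
  intro x hx i
  have h1 : (G⁻¹ *ᵥ x) i = G.det⁻¹ * G.cramer x i := by
    rw [Matrix.inv_def, Matrix.smul_mulVec, ← Matrix.cramer_eq_adjugate_mulVec]
    simp
  rw [h1, Matrix.cramer_apply, ← ValuationSubring.valuation_le_one_iff, map_mul, map_inv₀]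
  have h2 : G.updateCol i x = Matrix.of fun i' j => (Function.update c i x) j i' := by
    ext i' j
    by_cases hj : j = i
    · subst hj; simp
    · simp [hj, G]
  have h3 := hmax (Function.update c i x) (by
    intro j
    by_cases hj : j = i
    · subst hj; simpa using hx
    · simpa [hj] using hc j)
  rw [← h2] at h3
  have h0 : O.valuation G.det ≠ 0 := by simpa using hdet
  calc (O.valuation G.det)⁻¹ * O.valuation (G.updateCol i x).det ≤ (O.valuation G.det)⁻¹ * O.valuation G.det := by
        gcongr
    _ = 1 := inv_mul_cancel₀ h0

lemma eig_span [IsAlgClosed F] {n : Type} [Fintype n] [DecidableEq n] (M : Matrix n n F)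
    (h : ∀ c : F, (Matrix.scalar n c - M).det = 0 → c ∈ O) :
    M ^ (Fintype.card n) ∈ Submodule.span O {y | ∃ k < Fintype.card n, y = M ^ k} := by
  have h1 : M.charpoly ∈ Polynomial.lifts (algebraMap O F) := by
    rw [(IsAlgClosed.splits M.charpoly).eq_prod_roots_of_monic (Matrix.charpoly_monic M)]
    apply Subsemiring.multiset_prod_mem
    intro q hq
    obtain ⟨c, hc, rfl⟩ := Multiset.mem_map.mp hq
    have hc0 : c ∈ O := h c (by
      have := (Polynomial.mem_roots'.mp hc).2
      rwa [Polynomial.IsRoot, Matrix.eval_charpoly] at this)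
    refine (Polynomial.mem_lifts _).mpr ⟨Polynomial.X - Polynomial.C ⟨c, hc0⟩, ?_⟩
    simp
  obtain ⟨q, hq, hdeg, hmon⟩ := Polynomial.lifts_and_natDegree_eq_and_monic h1 (Matrix.charpoly_monic M)
  rw [Matrix.charpoly_natDegree_eq_dim] at hdeg
  have h2 : Polynomial.aeval M q = 0 := by
    have := Matrix.aeval_self_charpoly M
    rw [← hq, Polynomial.aeval_map_algebraMap] at this
    exact this
  rw [Polynomial.aeval_eq_sum_range, hdeg, Finset.sum_range_succ] at h2
  have h3 : q.coeff (Fintype.card n) = 1 := by rw [← hdeg]; exact hmon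
  rw [h3, one_smul] at h2
  rw [eq_neg_of_add_eq_zero_right h2]
  apply neg_mem
  refine sum_mem fun k hk => Submodule.smul_mem _ _ (Submodule.subset_span ⟨k, Finset.mem_range.mp hk, rfl⟩)

end P2b
end QInv


namespace QInv

section P2c
set_option linter.unusedSectionVars false
open scoped Kronecker

variable {Q0 Q1 : Type} [Fintype Q0] [Fintype Q1] {ta ha : Q1 → Q0} {α : Q0 → ℕ}

/-- index type of the total space -/
abbrev Nn {Q0 : Type} (α : Q0 → ℕ) : Type := (i : Q0) × Fin (α i)

open Classical in
/-- block matrix of an arrow -/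
noncomputable def big {L : Type} [Zero L] (v : (a : Q1) → Matrix (Fin (α (ha a))) (Fin (α (ta a))) L) (a : Q1) :
    Matrix (Nn α) (Nn α) L := Matrix.of fun p q =>
  if h : p.1 = ha a ∧ q.1 = ta a then v a (cast (by rw [h.1]) p.2) (cast (by rw [h.2]) q.2) else 0

variable {L : Type} [CommRing L]

lemma big_apply (v : (a : Q1) → Matrix (Fin (α (ha a))) (Fin (α (ta a))) L) (a : Q1)
    (r : Fin (α (ha a))) (s : Fin (α (ta a))) : big v a ⟨ha a, r⟩ ⟨ta a, s⟩ = v a r s := by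
  simp [big]

lemma big_apply_ne1 (v : (a : Q1) → Matrix (Fin (α (ha a))) (Fin (α (ta a))) L) (a : Q1)
    (p q : Nn α) (h : p.1 ≠ ha a) : big v a p q = 0 := by
  simp [big, h]

lemma big_apply_ne2 (v : (a : Q1) → Matrix (Fin (α (ha a))) (Fin (α (ta a))) L) (a : Q1)
    (p q : Nn α) (h : q.1 ≠ ta a) : big v a p q = 0 := by
  simp [big, h]

lemma big_map {L' : Type} [CommRing L'] (φ : L →+* L') (v : (a : Q1) → Matrix (Fin (α (ha a))) (Fin (α (ta a))) L) (a : Q1) :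
    (big v a).map φ = big (fun a => (v a).map φ) a := by
  ext p q
  simp only [big, Matrix.map_apply, Matrix.of_apply]
  split_ifs <;> simp

lemma big_smul (c : L) (v : (a : Q1) → Matrix (Fin (α (ha a))) (Fin (α (ta a))) L) (a : Q1) :
    big (fun a => c • v a) a = c • big v a := by
  ext p q
  simp only [big, Matrix.smul_apply, Matrix.of_apply]
  split_ifs <;> simp

lemma big_mul_apply (v : (a : Q1) → Matrix (Fin (α (ha a))) (Fin (α (ta a))) L) (a : Q1)
    (Y : Matrix (Nn α) (Nn α) L) (r : Fin (α (ha a))) (q : Nn α) :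
    (big v a * Y) ⟨ha a, r⟩ q = (v a *ᵥ fun s => Y ⟨ta a, s⟩ q) r := by
  classical
  rw [Matrix.mul_apply, Fintype.sum_sigma, Finset.sum_eq_single (ta a)]
  · simp [Matrix.mulVec, dotProduct, big_apply]
  · intro i _ hi
    apply Finset.sum_eq_zero
    intro s _
    rw [big_apply_ne2 v a _ _ hi, zero_mul]
  · simp

lemma big_conj [DecidableEq Q0] (A B : (i : Q0) → Matrix (Fin (α i)) (Fin (α i)) L) 
    (v : (a : Q1) → Matrix (Fin (α (ha a))) (Fin (α (ta a))) L) (a : Q1) :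
    blockDiagonal' A * big v a * blockDiagonal' B = big (fun a => A (ha a) * v a * B (ta a)) a := by
  ext p q
  obtain ⟨i, r⟩ := p
  obtain ⟨j, s⟩ := q
  rw [Matrix.mul_apply, Fintype.sum_sigma]
  by_cases hj : j = ta a
  · subst hj
    rw [Finset.sum_eq_single (ta a)]
    · by_cases hi : i = ha a
      · subst hi
        rw [big_apply, Matrix.mul_apply]
        refine Finset.sum_congr rfl fun s' _ => ?_
        rw [Matrix.mul_apply, Fintype.sum_sigma, Finset.sum_eq_single (ha a), Matrix.mul_apply]
        · simp [blockDiagonal'_apply, big_apply]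
        · intro i _ hi
          apply Finset.sum_eq_zero
          intro r' _
          rw [big_apply_ne1 v a _ _ hi, mul_zero]
        · simp
      · rw [big_apply_ne1 _ a _ _ hi]
        apply Finset.sum_eq_zero
        intro s' _
        rw [Matrix.mul_apply, Finset.sum_eq_zero, zero_mul]
        rintro ⟨i', r'⟩ _
        by_cases hi' : i' = ha a
        · rw [blockDiagonal'_apply_ne _ _ _ (by rintro rfl; exact hi hi'), zero_mul]
        · rw [big_apply_ne1 _ a _ _ hi', mul_zero]
    · intro j _ hj
      apply Finset.sum_eq_zero
      intro s' _
      rw [blockDiagonal'_apply_ne _ _ _ hj, mul_zero]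
    · simp
  · rw [big_apply_ne2 _ a _ _ hj]
    apply Finset.sum_eq_zero
    intro j' _
    apply Finset.sum_eq_zero
    intro s' _
    by_cases hj' : j' = ta a
    · rw [blockDiagonal'_apply_ne _ _ _ (by rintro rfl; exact hj hj'), mul_zero]
    · rw [Matrix.mul_apply, Finset.sum_eq_zero, zero_mul]
      intro p' _
      rw [big_apply_ne2 _ a _ _ hj', mul_zero]

lemma bd_inv [DecidableEq Q0] (A B : (i : Q0) → Matrix (Fin (α i)) (Fin (α i)) L) (hAB : ∀ i, A i * B i = 1) :
    blockDiagonal' A * blockDiagonal' B = 1 := by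
  rw [← blockDiagonal'_mul]
  simp only [hAB]
  exact blockDiagonal'_one

lemma wv_map {n : Type} [Fintype n] [DecidableEq n] {L' : Type} [CommRing L'] (φ : L →+* L') (X : Q1 → Matrix n n L) (w : List Q1) :
    (wv X w).map φ = wv (fun a => (X a).map φ) w := by
  have : (wv X w).map φ = φ.mapMatrix (wv X w) := rfl
  rw [this, wv, map_list_prod, List.map_map]; rfl

lemma wv_conj {E : Type} [Ring E] (g h : E) (hg : g * h = 1) (hh : h * g = 1) (X : Q1 → E) (w : List Q1) :
    wv (fun a => g * X a * h) w = g * wv X w * h := by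
  induction w with
  | nil => simp [wv, hg]
  | cons a w ih =>
    have e : ∀ (Y : Q1 → E), wv Y (a :: w) = Y a * wv Y w := fun Y => by simp [wv]
    rw [e, ih, e]
    calc g * X a * h * (g * wv X w * h) = g * X a * (h * g) * wv X w * h := by simp only [mul_assoc]
      _ = _ := by rw [hh, mul_one]; simp only [mul_assoc]

lemma det_conj {n : Type} [Fintype n] [DecidableEq n] (g h Y : Matrix n n L) (hg : g * h = 1) :
    (1 - g * Y * h).det = (1 - Y).det := by
  have : 1 - g * Y * h = g * (1 - Y) * h := by rw [mul_sub, sub_mul, mul_one, hg]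
  rw [this, Matrix.det_mul, Matrix.det_mul, mul_right_comm, ← Matrix.det_mul, hg, Matrix.det_one, one_mul]

/-- the determinant of the generic pencil -/
noncomputable def pdet [DecidableEq Q0] (v : (a : Q1) → Matrix (Fin (α (ha a))) (Fin (α (ta a))) L) 
    (T : Q1 → Matrix (Nn α) (Nn α) L) : L :=
  (1 - ∑ a, big v a ⊗ₖ T a).det

lemma pdet_conj [DecidableEq Q0] (A B : (i : Q0) → Matrix (Fin (α i)) (Fin (α i)) L) (hAB : ∀ i, A i * B i = 1)
    (v : (a : Q1) → Matrix (Fin (α (ha a))) (Fin (α (ta a))) L) (T : Q1 → Matrix (Nn α) (Nn α) L) :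
    pdet (fun a => A (ha a) * v a * B (ta a)) T = pdet v T := by
  unfold pdet
  rw [← det_conj (blockDiagonal' A ⊗ₖ (1 : Matrix (Nn α) (Nn α) L)) (blockDiagonal' B ⊗ₖ (1 : Matrix (Nn α) (Nn α) L))
    (∑ a, big v a ⊗ₖ T a) (by rw [← mul_kronecker_mul, bd_inv A B hAB, mul_one, one_kronecker_one])]
  rw [Finset.mul_sum, Finset.sum_mul]
  congr 2
  refine Finset.sum_congr rfl fun a _ => ?_
  rw [← mul_kronecker_mul, ← mul_kronecker_mul, big_conj, one_mul, mul_one]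

lemma pdet_map [DecidableEq Q0] {L' : Type} [CommRing L'] (φ : L →+* L')
    (v : (a : Q1) → Matrix (Fin (α (ha a))) (Fin (α (ta a))) L) (T : Q1 → Matrix (Nn α) (Nn α) L) :
    φ (pdet v T) = pdet (fun a => (v a).map φ) (fun a => (T a).map φ) := by
  unfold pdet
  rw [RingHom.map_det]
  congr 1
  rw [map_sub, map_one, map_sum]
  congr 1
  refine Finset.sum_congr rfl fun a _ => ?_
  rw [← big_map]
  ext p q
  simp

variable {F : Type} [Field F] [IsAlgClosed F] (O : ValuationSubring F)

lemma lattice [DecidableEq Q0] (v : (a : Q1) → Matrix (Fin (α (ha a))) (Fin (α (ta a))) F)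
    (h : ∀ w : List Q1, 0 < w.length → w.length ≤ Fintype.card (Nn α) * Fintype.card (Nn α) →
      ∀ c : F, (Matrix.scalar _ c - wv (big v) w).det = 0 → c ∈ O) :
    ∃ A B : (i : Q0) → Matrix (Fin (α i)) (Fin (α i)) F, (∀ i, A i * B i = 1) ∧
      ∀ a r s, (A (ha a) * v a * B (ta a)) r s ∈ O := by
  classical
  letI : LinearOrder Q1 := LinearOrder.lift' (Fintype.equivFin Q1) (Fintype.equivFin Q1).injective
  obtain ⟨r, hr, hspan⟩ := shirshov_span (R := O) (big v) (Fintype.card (Nn α) * Fintype.card (Nn α) + 1)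
    (Fintype.card (Nn α)) (Nat.succ_pos _) (std_id _ (Nat.lt_succ_self _))
    (fun u hu1 hu2 => eig_span O _ (h u hu1 (by omega)))
  have hfin : {w : List Q1 | w.length < r}.Finite := List.finite_length_lt Q1 r
  let V : (i : Q0) → Set (Fin (α i) → F) := fun i => 
    (fun wq : List Q1 × Nn α => fun s => wv (big v) wq.1 ⟨i, s⟩ wq.2) '' ({w : List Q1 | w.length < r} ×ˢ Set.univ)
  have hV : ∀ i, (V i).Finite := fun i => (hfin.prod Set.finite_univ).image _
  have hI : ∀ i s, (Pi.single s 1 : Fin (α i) → F) ∈ V i := by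
    intro i s
    refine ⟨([], ⟨i, s⟩), ⟨by simpa using hr, trivial⟩, ?_⟩
    ext s'
    simp [wv, Matrix.one_apply, Pi.single_apply]
  choose A B hAB hB hA using fun i => cramer_lattice O (V i) (hV i) (hI i)
  refine ⟨A, B, hAB, fun a p s => ?_⟩
  obtain ⟨⟨w, q⟩, ⟨hw, -⟩, hwq⟩ := hB (ta a) s
  simp only at hwq hw
  have h1 : (A (ha a) * v a * B (ta a)) p s = (A (ha a) *ᵥ fun r => wv (big v) (a :: w) ⟨ha a, r⟩ q) p := by
    rw [Matrix.mul_assoc, Matrix.mul_apply]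
    simp only [Matrix.mulVec, dotProduct]
    refine Finset.sum_congr rfl fun r' _ => ?_
    congr 1
    have : wv (big v) (a :: w) = big v a * wv (big v) w := by simp [wv]
    rw [this, big_mul_apply, hwq]
    rfl
  rw [h1]
  have h2 := hspan (a :: w) (by simpa using hw)
  have h3 : ∀ Y ∈ Submodule.span O (wv (big v) '' {w' | w'.length < r}),
      (A (ha a) *ᵥ fun r => Y ⟨ha a, r⟩ q) p ∈ O := by
    intro Y hY
    induction hY using Submodule.span_induction with
    | zero => 
      have : (fun r => (0 : Matrix (Nn α) (Nn α) F) ⟨ha a, r⟩ q) = 0 := rfl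
      rw [this, Matrix.mulVec_zero]; exact zero_mem _
    | add x y _ _ hx hy =>
      have : (fun r => (x + y) ⟨ha a, r⟩ q) = (fun r => x ⟨ha a, r⟩ q) + (fun r => y ⟨ha a, r⟩ q) := rfl
      rw [this, Matrix.mulVec_add]; exact add_mem hx hy
    | smul c x _ hx =>
      have : (fun r => (c • x) ⟨ha a, r⟩ q) = (c : F) • (fun r => x ⟨ha a, r⟩ q) := rfl
      rw [this, Matrix.mulVec_smul]; exact mul_mem c.2 hx
    | mem x hx =>
      obtain ⟨w', hw', rfl⟩ := hx
      exact hA (ha a) _ ⟨(w', q), ⟨hw', trivial⟩, rfl⟩ p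
  exact h3 _ h2

lemma wv_smul {n : Type} [Fintype n] [DecidableEq n] (c : L) (X : Q1 → Matrix n n L) (w : List Q1) :
    wv (fun a => c • X a) w = c ^ w.length • wv X w := by
  induction w with
  | nil => simp [wv]
  | cons a w ih =>
    have e : ∀ (Y : Q1 → Matrix n n L), wv Y (a :: w) = Y a * wv Y w := fun Y => by simp [wv]
    rw [e, e, ih, List.length_cons, pow_succ', smul_mul_smul_comm]

lemma no_scale [DecidableEq Q0] (v : (a : Q1) → Matrix (Fin (α (ha a))) (Fin (α (ta a))) F)
    (h : ∀ w : List Q1, 0 < w.length → w.length ≤ Fintype.card (Nn α) * Fintype.card (Nn α) →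
      ∀ c : F, (Matrix.scalar _ c - wv (big v) w).det = 0 → c ∈ O)
    (w : List Q1) (hw : w ≠ []) (h1 : (1 - wv (big v) w).det = 0) :
    ∃ T : Q1 → Matrix (Nn α) (Nn α) F, (∀ a p q, T a p q ∈ O) ∧ O.valuation (pdet v T) < 1 := by
  classical
  obtain ⟨A, B, hAB, hint⟩ := lattice O v h
  let vO : (a : Q1) → Matrix (Fin (α (ha a))) (Fin (α (ta a))) O := fun a => Matrix.of fun r s => ⟨_, hint a r s⟩
  have hvO : (fun a => (vO a).map (algebraMap O F)) = fun a => A (ha a) * v a * B (ta a) := by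
    funext a; ext r s; rfl
  have hd : (1 - wv (big vO) w).det = 0 := by
    apply (FaithfulSMul.algebraMap_injective O F)
    rw [map_zero, RingHom.map_det, map_sub, map_one]
    have : (algebraMap O F).mapMatrix (wv (big vO) w) = wv (fun a => blockDiagonal' A * big v a * blockDiagonal' B) w := by
      have := wv_map (algebraMap O F) (big vO) w
      rw [RingHom.mapMatrix_apply, this]
      congr 1
      funext a
      rw [big_map, hvO, big_conj]
    rw [this, wv_conj _ _ (bd_inv A B hAB) (bd_inv B A fun i => mul_eq_one_comm.mp (hAB i)), det_conj _ _ _ (bd_inv A B hAB), h1]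
  let res := IsLocalRing.residue O
  have hd2 : (1 - wv (fun a => (big vO a).map res) w).det = 0 := by
    have := congrArg res hd
    rw [map_zero, RingHom.map_det, map_sub, map_one, RingHom.mapMatrix_apply, wv_map] at this
    exact this
  obtain ⟨Tb, hTb⟩ := field_lemma _ w hw hd2
  choose T hT using fun a p q => IsLocalRing.residue_surjective (R := O) (Tb a p q)
  have hT' : (fun a => (Matrix.of (T a)).map res) = Tb := by
    funext a; ext p q; exact hT a p q
  have h3 : res (pdet vO (fun a => Matrix.of (T a))) = 0 := by
    rw [pdet_map, hT', pdet, ← hTb]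
    congr 2
    refine Finset.sum_congr rfl fun a _ => ?_
    rw [big_map]
  refine ⟨fun a => (Matrix.of (T a)).map (algebraMap O F), fun a p q => (T a p q).2, ?_⟩
  rw [← pdet_conj A B hAB, ← hvO, ← pdet_map]
  have h4 : pdet vO (fun a => Matrix.of (T a)) ∈ IsLocalRing.maximalIdeal O := by
    rwa [← IsLocalRing.residue_eq_zero_iff]
  exact (ValuationSubring.valuation_lt_one_iff O _).mp h4

theorem val_main [DecidableEq Q0] (v : (a : Q1) → Matrix (Fin (α (ha a))) (Fin (α (ta a))) F)
    (h : ∀ c : F, O.valuation c < 1 → ∀ T : Q1 → Matrix (Nn α) (Nn α) F, (∀ a p q, T a p q ∈ O) →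
      ¬ O.valuation (pdet (fun a => c • v a) T) < 1) :
    ∃ A B : (i : Q0) → Matrix (Fin (α i)) (Fin (α i)) F, (∀ i, A i * B i = 1) ∧
      ∀ a r s, (A (ha a) * v a * B (ta a)) r s ∈ O := by
  classical
  apply lattice
  by_contra hcon
  push Not at hcon
  obtain ⟨w1, hw1, hw1', c1, hc1, hc1'⟩ := hcon
  set L := Fintype.card (Nn α) * Fintype.card (Nn α) with hL
  set D := L.factorial with hD
  let 𝒮 : Set (List Q1 × F) := {wc | 0 < wc.1.length ∧ wc.1.length ≤ L ∧ (Matrix.scalar _ wc.2 - wv (big v) wc.1).det = 0}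
  have hfin : 𝒮.Finite := by
    have : 𝒮 ⊆ ⋃ w ∈ {w : List Q1 | w.length < L + 1}, (fun c => (w, c)) '' {c | c ∈ (wv (big v) w).charpoly.roots} := by
      rintro ⟨w, c⟩ ⟨h1, h2, h3⟩
      simp only [Set.mem_iUnion]
      refine ⟨w, Nat.lt_succ_of_le h2, c, ?_, rfl⟩
      refine Polynomial.mem_roots'.mpr ⟨(Matrix.charpoly_monic _).ne_zero, ?_⟩
      rw [Polynomial.IsRoot, Matrix.eval_charpoly]; exact h3
    refine Set.Finite.subset ?_ this
    refine Set.Finite.biUnion (List.finite_length_lt Q1 _) fun w _ => Set.Finite.image _ ?_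
    exact (wv (big v) w).charpoly.roots.toFinset.finite_toSet.subset (by intro c; simp)
  obtain ⟨⟨w0, c0⟩, ⟨hw0, hw0', hc0⟩, hmax⟩ := Set.exists_max_image 𝒮
    (fun wc => O.valuation wc.2 ^ (D / wc.1.length)) hfin ⟨(w1, c1), hw1, hw1', hc1⟩
  simp only at hw0 hw0' hc0 hmax
  have hdiv : ∀ k, 0 < k → k ≤ L → k * (D / k) = D := fun k h1 h2 =>
    Nat.mul_div_cancel' (Nat.dvd_factorial h1 h2)
  have hD0 : 0 < D := Nat.factorial_pos _
  have hdne : ∀ k, 0 < k → k ≤ L → D / k ≠ 0 := fun k h1 h2 h3 => by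
    have := hdiv k h1 h2; rw [h3] at this; omega
  have hc0' : 1 < O.valuation c0 := by
    have h2 := hmax (w1, c1) ⟨hw1, hw1', hc1⟩
    have h3 : 1 < O.valuation c1 := by
      rw [← ValuationSubring.valuation_le_one_iff] at hc1'; exact not_le.mp hc1'
    by_contra hle
    have h4 : O.valuation c0 ^ (D / w0.length) ≤ 1 := pow_le_one₀ zero_le (not_lt.mp hle)
    have h5 : 1 < O.valuation c1 ^ (D / w1.length) := one_lt_pow₀ h3 (hdne _ hw1 hw1')
    exact absurd (lt_of_lt_of_le h5 (h2.trans h4)) (lt_irrefl _)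
  have hc00 : c0 ≠ 0 := by rintro rfl; simp at hc0'
  obtain ⟨c, hc⟩ := IsAlgClosed.exists_pow_nat_eq (c0⁻¹) hw0
  have hcne : c ≠ 0 := by
    rintro rfl
    rw [zero_pow hw0.ne'] at hc
    exact hc00 (inv_eq_zero.mp hc.symm)
  have hvc : O.valuation c < 1 := by
    by_contra hle
    have : 1 ≤ O.valuation c ^ w0.length := one_le_pow₀ (not_lt.mp hle)
    rw [← map_pow, hc, map_inv₀] at this
    exact absurd (inv_lt_one_of_one_lt₀ hc0') (not_lt.mpr this)
  have hbs : big (fun a => c • v a) = fun a => c • big v a := funext fun a => big_smul c v a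
  have hdets : ∀ (w : List Q1) (e : F), (Matrix.scalar _ (c ^ w.length * e) - wv (big fun a => c • v a) w) =
      c ^ w.length • (Matrix.scalar _ e - wv (big v) w) := by
    intro w e
    rw [hbs, wv_smul, smul_sub]
    congr 1
    ext p q
    simp [Matrix.diagonal_apply]
  obtain ⟨T, hT, hlt⟩ := no_scale O (fun a => c • v a) (by
    intro w hw hw' e he
    have h1 : (Matrix.scalar _ ((c ^ w.length)⁻¹ * e) - wv (big v) w).det = 0 := by
      have h2 := hdets w ((c ^ w.length)⁻¹ * e)
      rw [mul_inv_cancel_left₀ (pow_ne_zero _ hcne)] at h2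
      rw [h2, Matrix.det_smul] at he
      exact (mul_eq_zero.mp he).resolve_left (pow_ne_zero _ (pow_ne_zero _ hcne))
    have h2 := hmax (w, (c ^ w.length)⁻¹ * e) ⟨hw, hw', h1⟩
    simp only at h2
    have h3 : O.valuation c0 ^ (D / w0.length) = (O.valuation c ^ D)⁻¹ := by
      have h4 : O.valuation c ^ D = O.valuation c ^ (w0.length * (D / w0.length)) := by rw [hdiv _ hw0 hw0']
      have h5 : O.valuation c ^ w0.length = (O.valuation c0)⁻¹ := by rw [← map_pow, hc, map_inv₀]
      rw [h4, pow_mul, h5, inv_pow, inv_inv]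
    rw [h3, map_mul, mul_pow, map_inv₀, map_pow, inv_pow, ← pow_mul, hdiv _ hw hw'] at h2
    have hpos : 0 < (O.valuation c ^ D)⁻¹ := by
      rw [inv_pos]; exact pow_pos (zero_lt_iff.mpr (by simpa using hcne)) _
    rw [← ValuationSubring.valuation_le_one_iff]
    by_contra hgt
    have h5 := one_lt_pow₀ (not_le.mp hgt) (hdne _ hw hw')
    have h6 := (mul_lt_mul_iff_right₀ hpos).mpr h5
    rw [mul_one] at h6
    exact absurd (lt_of_lt_of_le h6 h2) (lt_irrefl _)) w0 (by rintro rfl; simp at hw0) (by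
    have h2 := hdets w0 c0
    rw [hc, inv_mul_cancel₀ hc00] at h2
    have h3 : (Matrix.scalar (Nn α) (1 : F)) = 1 := map_one _
    rw [h3] at h2
    rw [h2, Matrix.det_smul, hc0, mul_zero])
  exact h c hvc T hT hlt

end P2c
end QInv


namespace QInv

section P2d
set_option linter.unusedSectionVars false
open scoped Kronecker

variable {Q0 Q1 : Type} [Fintype Q0] [Fintype Q1] {ta ha : Q1 → Q0} {α : Q0 → ℕ}
variable {K : Type} [Field K] [DecidableEq Q0]

/-- parameter index -/
abbrev Tt (Q1 : Type) {Q0 : Type} (α : Q0 → ℕ) : Type := Q1 × Nn α × Nn α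

/-- generic representation -/
noncomputable def gen (K : Type) [Field K] (ta ha : Q1 → Q0) (α : Q0 → ℕ) (a : Q1) :
    Matrix (Fin (α (ha a))) (Fin (α (ta a))) (MvPolynomial (Rho ta ha α) K) :=
  Matrix.of fun r s => X ⟨a, r, s⟩

/-- the generic determinant -/
noncomputable def GP (K : Type) [Field K] (ta ha : Q1 → Q0) (α : Q0 → ℕ) :
    MvPolynomial (Tt Q1 α) (MvPolynomial (Rho ta ha α) K) :=
  pdet (fun a => (gen K ta ha α a).map C) (fun a => Matrix.of fun p q => X (a, p, q))

lemma GP_eval {L : Type} [CommRing L] (φ : MvPolynomial (Rho ta ha α) K →+* L) (T : Tt Q1 α → L) :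
    eval₂ φ T (GP K ta ha α) = (pdet (fun a => (gen K ta ha α a).map φ)
      (fun a => Matrix.of fun p q => T (a, p, q))) := by
  have := pdet_map (eval₂Hom φ T) (fun a => (gen K ta ha α a).map C)
    (fun a => Matrix.of fun p q => (X (a, p, q) : MvPolynomial (Tt Q1 α) (MvPolynomial (Rho ta ha α) K)))
  rw [GP]
  refine this.trans ?_
  congr 1
  · funext a; ext r s; simp
  · funext a; ext r s; simp

lemma GP_map {L : Type} [CommRing L] (φ : MvPolynomial (Rho ta ha α) K →+* L) :
    map φ (GP K ta ha α) = (pdet (fun a => ((gen K ta ha α a).map φ).map (C (σ := Tt Q1 α)))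
      (fun a => Matrix.of fun p q => X (a, p, q))) := by
  have := GP_eval (ta := ta) (ha := ha) (α := α) (K := K) ((C (σ := Tt Q1 α)).comp φ) X
  refine (Eq.trans ?_ this).trans ?_
  · rw [map_eq_eval₂Hom_C_comp]; rfl
  · congr 1

lemma gen_map {L : Type} [CommRing L] [Algebra K L] (w : (a : Q1) → Matrix (Fin (α (ha a))) (Fin (α (ta a))) L)
    (a : Q1) : (gen K ta ha α a).map (aeval (rc w) : MvPolynomial (Rho ta ha α) K →ₐ[K] L) = w a := by
  ext r s; simp [gen, rc]

lemma GP_inv (m : Tt Q1 α →₀ ℕ) : coeff m (GP K ta ha α) ∈ quiverInvariants K ta ha α := by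
  rw [mem_qi]
  intro A B hAB v
  have key : ∀ w : (a : Q1) → Matrix (Fin (α (ha a))) (Fin (α (ta a))) K,
      aeval (rc w) (coeff m (GP K ta ha α)) = coeff m (pdet (fun a => (w a).map (C (σ := Tt Q1 α)))
        (fun a => Matrix.of fun p q => X (a, p, q))) := by
    intro w
    have := GP_map (ta := ta) (ha := ha) (α := α) (K := K) ((aeval (rc w)) : _ →ₐ[K] K).toRingHom
    have h2 := congrArg (coeff m) this
    rw [coeff_map] at h2
    refine h2.trans ?_
    congr 2
    funext a
    have := gen_map (K := K) w a
    exact congrArg (fun M => Matrix.map M _) this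
  rw [key, key, ← pdet_conj (fun i => (A i).map C) (fun i => (B i).map C) ?_ (fun a => (v a).map C)]
  · simp only [Matrix.map_mul]
  · intro i
    rw [← Matrix.map_mul, hAB]
    exact Matrix.map_one _ C_0 C_1

lemma GP_zero : coeff 0 (GP K ta ha α) = 1 := by
  have := GP_eval (ta := ta) (ha := ha) (α := α) (K := K) (RingHom.id _) 0
  have h2 : eval₂ (RingHom.id (MvPolynomial (Rho ta ha α) K)) 0 (GP K ta ha α) = coeff 0 (GP K ta ha α) := by
    rw [← constantCoeff_eq]
    induction (GP K ta ha α) using MvPolynomial.induction_on with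
    | C a => simp
    | add p q hp hq => rw [eval₂_add, hp, hq, map_add]
    | mul_X p i hp => rw [eval₂_mul, hp]; simp
  rw [← h2, this, pdet]
  have : ∀ a : Q1, (Matrix.of fun (p q : Nn α) => (0 : Tt Q1 α → MvPolynomial (Rho ta ha α) K) (a, p, q)) = 0 := fun a => rfl
  simp only [this, kroneckerMap_zero_right _ (fun _ => mul_zero _), Finset.sum_const_zero, sub_zero, det_one]

/-- bigraded subring -/
def homSub (τ σ K : Type) [Field K] : Subring (MvPolynomial τ (MvPolynomial σ K)) where
  carrier := {P | ∀ m, (coeff m P).IsHomogeneous m.degree}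
  mul_mem' := by
    classical
      classical
    intro P R hP hR m
    rw [coeff_mul]
    refine IsHomogeneous.sum _ _ _ fun x hx => ?_
    rw [Finset.HasAntidiagonal.mem_antidiagonal] at hx
    rw [← hx, map_add]
    exact (hP _).mul (hR _)
  one_mem' := by
    classical
      classical
    intro m
    rw [coeff_one]
    split_ifs with h
    · subst h; simpa using isHomogeneous_one σ K
    · exact isHomogeneous_zero _ _ _
  add_mem' := by
    intro P R hP hR m
    rw [coeff_add]; exact (hP m).add (hR m)
  zero_mem' := fun m => by rw [coeff_zero]; exact isHomogeneous_zero _ _ _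
  neg_mem' := by
    intro P hP m
    rw [coeff_neg]; exact (hP m).neg

lemma big_gen_hom (a : Q1) (p q : Nn α) : 
    (big (gen K ta ha α) a p q).IsHomogeneous 1 := by
  simp only [big, Matrix.of_apply]
  split_ifs
  · exact isHomogeneous_X _ _
  · exact isHomogeneous_zero _ _ _

set_option maxHeartbeats 1000000 in
lemma GP_def : GP K ta ha α = (∑ σ : Equiv.Perm (Nn α × Nn α), Equiv.Perm.sign σ • ∏ i, 
   ((1 : Matrix (Nn α × Nn α) (Nn α × Nn α) _) (σ i) i - 
    ∑ a, C (big (gen K ta ha α) a (σ i).1 i.1) * X (a, (σ i).2, i.2))) := by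
  have : (fun a => big (fun a => (gen K ta ha α a).map C) a) = 
     fun a => (big (gen K ta ha α) a).map (C (σ := Tt Q1 α)) := by
    funext a; rw [big_map]
  have h2 : GP K ta ha α = (1 - ∑ a, (big (fun a => (gen K ta ha α a).map (C (σ := Tt Q1 α))) a) ⊗ₖ
     (Matrix.of fun p q => X (a, p, q) : Matrix (Nn α) (Nn α) _)).det := rfl
  rw [h2, Matrix.det_apply]
  refine Finset.sum_congr rfl fun σ _ => ?_
  congr 1
  refine Finset.prod_congr rfl fun i _ => ?_
  rw [Matrix.sub_apply, Matrix.sum_apply]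
  congr 1
  refine Finset.sum_congr rfl fun a _ => ?_
  rw [congrFun this a]
  simp [Matrix.kroneckerMap_apply]

lemma GP_hom (m : Tt Q1 α →₀ ℕ) : (coeff m (GP K ta ha α)).IsHomogeneous m.degree := by
  revert m
  change GP K ta ha α ∈ homSub (Tt Q1 α) (Rho ta ha α) K
  rw [GP_def]
  refine Subring.sum_mem _ fun σ _ => ?_
  rw [Units.smul_def]
  refine Subring.zsmul_mem _ (Subring.prod_mem _ fun i _ => ?_) _
  refine Subring.sub_mem _ ?_ (Subring.sum_mem _ fun a _ => ?_)
  · rw [Matrix.one_apply]; split_ifs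
    · exact Subring.one_mem _
    · exact Subring.zero_mem _
  · classical
    intro m
    rw [coeff_C_mul, coeff_X']
    split_ifs with h
    · rw [← h, mul_one]
      simpa using big_gen_hom a _ _
    · rw [mul_zero]; exact isHomogeneous_zero _ _ _

lemma GP_deg (m : Tt Q1 α →₀ ℕ) (hm : m ∈ (GP K ta ha α).support) : m.degree ≤ Fintype.card (Nn α) ^ 2 := by
  refine (le_totalDegree hm).trans ?_
  rw [GP_def]
  refine (totalDegree_finset_sum _ _).trans (Finset.sup_le fun σ _ => ?_)
  rw [Units.smul_def]
  refine (totalDegree_smul_le _ _).trans ((totalDegree_finset_prod _ _).trans ?_)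
  refine (Finset.sum_le_card_nsmul _ _ 1 fun i _ => ?_).trans (by simp [sq])
  refine (totalDegree_sub _ _).trans (max_le ?_ ?_)
  · rw [Matrix.one_apply]; split_ifs <;> simp
  · refine (totalDegree_finset_sum _ _).trans (Finset.sup_le fun σ _ => ?_)
    refine (totalDegree_mul _ _).trans ?_
    simp

open Classical in
/-- the invariants generating an integral subextension -/
noncomputable def GT (K : Type) [Field K] (ta ha : Q1 → Q0) (α : Q0 → ℕ) :
    Finset (MvPolynomial (Rho ta ha α) K) :=
  ((GP K ta ha α).support.filter (· ≠ 0)).image fun m => coeff m (GP K ta ha α)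

lemma GT_mem (g) (hg : g ∈ GT K ta ha α) : g ∈ quiverInvariants K ta ha α := by
  simp only [GT, Finset.mem_image] at hg
  obtain ⟨m, -, rfl⟩ := hg
  exact GP_inv m

lemma GT_deg (g) (hg : g ∈ GT K ta ha α) : ∃ d, 1 ≤ d ∧ d ≤ Fintype.card (Nn α) ^ 2 ∧ g.IsHomogeneous d := by
  simp only [GT, Finset.mem_image, Finset.mem_filter] at hg
  obtain ⟨m, ⟨h1, h2⟩, rfl⟩ := hg
  refine ⟨m.degree, ?_, GP_deg m h1, GP_hom m⟩
  rw [Nat.one_le_iff_ne_zero]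
  intro h; exact h2 ((Finsupp.degree_eq_zero_iff m).mp h)

theorem GT_int [Infinite K] (f) (hf : f ∈ quiverInvariants K ta ha α) :
    IsIntegral (Algebra.adjoin K (GT K ta ha α : Set (MvPolynomial (Rho ta ha α) K))) f := by
  let S := MvPolynomial (Rho ta ha α) K
  let F := AlgebraicClosure (FractionRing S)
  let ι : S →+* F := (algebraMap (FractionRing S) F).comp (algebraMap S (FractionRing S))
  have hι : Function.Injective ι := 
    (algebraMap (FractionRing S) F).injective.comp (IsFractionRing.injective S (FractionRing S))
  letI : Algebra K F := (ι.comp C).toAlgebra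
  set B := Algebra.adjoin K (GT K ta ha α : Set S) with hB
  set s : Set F := ι '' B with hs
  have hcl : ∀ x ∈ Subring.closure s, x ∈ B.toSubring.map ι := by
    intro x hx
    refine (Subring.closure_le (t := B.toSubring.map ι)).mpr ?_ hx
    rintro _ ⟨b, hb, rfl⟩
    exact ⟨b, hb, rfl⟩
  by_contra hni
  have h1 : ι f ∉ (integralClosure (Subring.closure s) F).toSubring := by
    intro hmem
    have hmem : IsIntegral (Subring.closure s) (ι f) := hmem
    apply hni
    obtain ⟨P, hP, hPe⟩ := hmem
    let j : B →+* F := ι.comp B.val.toRingHom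
    have hj : Function.Injective j := hι.comp Subtype.val_injective
    let e := RingEquiv.ofBijective j.rangeRestrict ⟨fun x y h => hj (congrArg Subtype.val h), j.rangeRestrict_surjective⟩
    let ρ : Subring.closure s →+* B := e.symm.toRingHom.comp (Subring.inclusion (by
      intro x hx
      obtain ⟨b, hb, rfl⟩ := hcl x hx
      exact ⟨⟨b, hb⟩, rfl⟩))
    have hρ : ∀ x, j (ρ x) = x := fun x => by
      have := e.apply_symm_apply (Subring.inclusion (S := Subring.closure s) (T := j.range) (by
        intro x hx
        obtain ⟨b, hb, rfl⟩ := hcl x hx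
        exact ⟨⟨b, hb⟩, rfl⟩) x)
      exact congrArg Subtype.val this
    refine ⟨P.map ρ, hP.map ρ, hι ?_⟩
    rw [map_zero, Polynomial.hom_eval₂, Polynomial.eval₂_map, ← hPe]
    congr 1
    ext x
    exact hρ x
  rw [← iInf_valuationSubring_superset, Subring.mem_iInf] at h1
  push Not at h1
  obtain ⟨⟨O, hO⟩, hfO⟩ := h1
  have hO' : ∀ b ∈ B, ι b ∈ O := fun b hb => hO ⟨b, hb, rfl⟩
  have hfO : ι f ∉ O := hfO
  let v : (a : Q1) → Matrix (Fin (α (ha a))) (Fin (α (ta a))) F := fun a => (gen K ta ha α a).map ι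
  obtain ⟨A, B', hAB, hint⟩ := val_main O v (by
    intro c hc T hT hlt
    have e1 : pdet (fun a => c • v a) T = eval₂ ι (fun x => c * T x.1 x.2.1 x.2.2) (GP K ta ha α) := by
      rw [GP_eval, pdet, pdet]
      congr 2
      refine Finset.sum_congr rfl fun a _ => ?_
      rw [big_smul]
      ext p q
      simp [v]
      ring
    have e2 : pdet (fun a => c • v a) T - 1 ∈ {x : F | O.valuation x < 1} := by
      have h0 : (0 : Tt Q1 α →₀ ℕ) ∈ (GP K ta ha α).support := by
        rw [mem_support_iff, GP_zero]; exact one_ne_zero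
      rw [e1, eval₂_eq, ← Finset.add_sum_erase _ _ h0, GP_zero]
      simp only [map_one, Finsupp.coe_zero, Finsupp.support_zero, Finset.prod_empty, one_mul, add_sub_cancel_left]
      refine Valuation.map_sum_lt (g := 1) O.valuation one_ne_zero fun d hd => ?_
      rw [Finset.mem_erase] at hd
      have h3 : ι (coeff d (GP K ta ha α)) ∈ O := hO' _ (Algebra.subset_adjoin (by
        simp only [GT, Finset.coe_image, Set.mem_image, Finset.mem_coe, Finset.mem_filter]
        exact ⟨d, ⟨hd.2, hd.1⟩, rfl⟩))
      have h4 : ∏ i ∈ d.support, T i.1 i.2.1 i.2.2 ^ d i ∈ O := prod_mem fun i _ => pow_mem (hT _ _ _) _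
      simp only [mul_pow]
      rw [Finset.prod_mul_distrib, Finset.prod_pow_eq_pow_sum, mul_left_comm, map_mul, map_pow]
      have h5 := (O.valuation_le_one_iff _).mpr (mul_mem h3 h4)
      refine mul_lt_one_of_lt_of_le (pow_lt_one₀ zero_le' hc ?_) h5
      intro h
      exact hd.1 ((Finsupp.degree_eq_zero_iff d).mp h)
    have e3 : O.valuation (1 : F) < 1 := by
      have : (1 : F) = pdet (fun a => c • v a) T - (pdet (fun a => c • v a) T - 1) := by ring
      rw [this]
      exact lt_of_le_of_lt (O.valuation.map_sub _ _) (max_lt hlt e2)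
    simp at e3)
  have hq := qi_ext f hf A B' hAB v
  apply hfO
  have e4 : ∀ g : S, ι g = aeval (rc v) g := by
    intro g
    have : ι = (aeval (rc v) : S →ₐ[K] F).toRingHom := by
      apply MvPolynomial.ringHom_ext
      · intro r; simp; rfl
      · intro i; simp [rc, v, gen]
    rw [this]; rfl
  rw [e4, ← hq]
  rw [aeval_def, eval₂_eq]
  refine sum_mem fun d _ => mul_mem ?_ (prod_mem fun i _ => pow_mem ?_ _)
  · exact hO' (C _) (B.algebraMap_mem _)
  · exact hint _ _ _

end P2d
end QInv


namespace QInv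

section P1a
set_option linter.unusedSectionVars false
variable {σ K : Type} [Fintype σ] [Field K]

/-- polynomials of weight below `w` -/
def Wlt (K : Type) [Field K] (ω : σ → ℕ) (w : ℕ) : Submodule K (MvPolynomial σ K) where
  carrier := {g | ∀ m, coeff m g ≠ 0 → Finsupp.weight ω m < w}
  add_mem' := by
    intro f g hf hg m hm
    by_cases h : coeff m f = 0
    · apply hg m; rw [coeff_add, h, zero_add] at hm; exact hm
    · exact hf m h
  zero_mem' := by intro m hm; simp at hm
  smul_mem' := by
    intro c f hf m hm
    apply hf m
    intro h; apply hm; rw [coeff_smul, h, smul_zero]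

lemma Wlt_mul {ω : σ → ℕ} {w w' : ℕ} {f g : MvPolynomial σ K} (hf : f ∈ Wlt K ω (w + 1)) (hg : g ∈ Wlt K ω w') :
    f * g ∈ Wlt K ω (w + w') := by
  classical
  intro m hm
  rw [coeff_mul] at hm
  obtain ⟨x, hx, hne⟩ := Finset.exists_ne_zero_of_sum_ne_zero hm
  rw [Finset.HasAntidiagonal.mem_antidiagonal] at hx
  have h1 := hf _ (left_ne_zero_of_mul hne)
  have h2 := hg _ (right_ne_zero_of_mul hne)
  rw [← hx, map_add]; omega

lemma Wlt_mono {ω : σ → ℕ} {w w' : ℕ} (h : w ≤ w') {f : MvPolynomial σ K} (hf : f ∈ Wlt K ω w) : f ∈ Wlt K ω w' :=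
  fun m hm => (hf m hm).trans_le h

lemma Wlt_monomial {ω : σ → ℕ} {w : ℕ} (m : σ →₀ ℕ) (c : K) (h : Finsupp.weight ω m < w) : monomial m c ∈ Wlt K ω w := by
  classical
  intro m' hm'
  rw [coeff_monomial] at hm'
  split_ifs at hm' with h1
  · rw [← h1]; exact h
  · simp at hm'

/-- dominant monomial `m` with coefficient one -/
def Dom (ω : σ → ℕ) (f : MvPolynomial σ K) (m : σ →₀ ℕ) : Prop :=
  f - monomial m 1 ∈ Wlt K ω (Finsupp.weight ω m)

lemma Dom.mul {ω : σ → ℕ} {f g : MvPolynomial σ K} {m m' : σ →₀ ℕ} (hf : Dom ω f m) (hg : Dom ω g m') :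
    Dom ω (f * g) (m + m') := by
  have e : f * g - monomial (m + m') 1 = f * (g - monomial m' 1) + monomial m' 1 * (f - monomial m 1) := by
    rw [← mul_one (1 : K), ← monomial_mul, mul_one]; ring
  have hf' : f ∈ Wlt K ω (Finsupp.weight ω m + 1) := by
    have := Submodule.add_mem _ (Wlt_mono (Nat.le_succ _) hf) (Wlt_monomial (w := Finsupp.weight ω m + 1) m (1 : K) (Nat.lt_succ_self _))
    simpa using this
  unfold Dom
  rw [e, map_add]
  refine Submodule.add_mem _ (Wlt_mul hf' hg) ?_
  rw [add_comm (Finsupp.weight ω m)]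
  exact Wlt_mul (Wlt_monomial m' (1 : K) (Nat.lt_succ_self _)) hf

lemma Dom.one {ω : σ → ℕ} : Dom ω (1 : MvPolynomial σ K) 0 := by
  unfold Dom
  have : (1 : MvPolynomial σ K) - monomial 0 1 = 0 := by rw [sub_eq_zero]; rfl
  rw [this]; exact Submodule.zero_mem _

lemma Dom.pow {ω : σ → ℕ} {f : MvPolynomial σ K} {m : σ →₀ ℕ} (hf : Dom ω f m) (n : ℕ) :
    Dom ω (f ^ n) (n • m) := by
  induction n with
  | zero => rw [pow_zero, zero_smul]; exact Dom.one
  | succ n ih => rw [pow_succ, succ_nsmul]; exact ih.mul hf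

lemma Dom.prod {ω : σ → ℕ} {ι : Type} (s : Finset ι) (f : ι → MvPolynomial σ K) (m : ι → σ →₀ ℕ)
    (hf : ∀ i ∈ s, Dom ω (f i) (m i)) : Dom ω (∏ i ∈ s, f i) (∑ i ∈ s, m i) := by
  classical
  induction s using Finset.induction_on with
  | empty => simpa using Dom.one
  | insert a s ha ih =>
    rw [Finset.prod_insert ha, Finset.sum_insert ha]
    exact (hf a (Finset.mem_insert_self _ _)).mul (ih fun i hi => hf i (Finset.mem_insert_of_mem hi))

lemma Dom.coeff_eq {ω : σ → ℕ} {f : MvPolynomial σ K} {m : σ →₀ ℕ} (hf : Dom ω f m) : coeff m f = 1 := by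
  classical
  by_contra h
  have := hf m (by rw [coeff_sub, coeff_monomial, if_pos rfl]; exact sub_ne_zero.mpr h)
  exact lt_irrefl _ this

variable (p : ℕ) [Fact p.Prime]

/-- top exponent -/
noncomputable def allp (p : ℕ) (σ : Type) [Fintype σ] : σ →₀ ℕ := Finsupp.equivFunOnFinite.symm fun _ => p - 1

lemma allp_apply (i : σ) : allp p σ i = p - 1 := rfl

lemma allp_degree : (allp p σ).degree = Fintype.card σ * (p - 1) := by
  rw [Finsupp.degree_eq_sum]; simp [allp_apply]

/-- exponent shift -/
noncomputable def pm (m : σ →₀ ℕ) : σ →₀ ℕ := p • m + allp p σ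

lemma pm_inj : Function.Injective (pm p (σ := σ)) := by
  intro a b h
  have h2 : p • a = p • b := add_right_cancel h
  ext i
  have := DFunLike.congr_fun h2 i
  simp only [Finsupp.smul_apply, smul_eq_mul] at this
  exact Nat.eq_of_mul_eq_mul_left (Fact.out : p.Prime).pos this

variable [CharP K p] [PerfectRing K p]

/-- the trace operator -/
noncomputable def Tr (F : MvPolynomial σ K) : MvPolynomial σ K :=
  ∑ m ∈ F.support.preimage (pm p) (pm_inj p).injOn, monomial m ((frobeniusEquiv K p).symm (coeff (pm p m) F))

lemma coeff_Tr (F : MvPolynomial σ K) (m : σ →₀ ℕ) :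
    coeff m (Tr p F) = (frobeniusEquiv K p).symm (coeff (pm p m) F) := by
  classical
  unfold Tr
  rw [coeff_sum]
  simp only [coeff_monomial]
  rw [Finset.sum_ite_eq']
  split_ifs with h
  · rfl
  · rw [Finset.mem_preimage, mem_support_iff, not_not] at h
    rw [h, map_zero]

lemma Tr_add (F G : MvPolynomial σ K) : Tr p (F + G) = Tr p F + Tr p G := by
  ext m; simp only [coeff_add, coeff_Tr, map_add]

lemma Tr_mul (f g : MvPolynomial σ K) : Tr p (f ^ p * g) = f * Tr p g := by
  classical
  induction f using MvPolynomial.induction_on' with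
  | add a b ha hb =>
    haveI : CharP (MvPolynomial σ K) p := inferInstance
    rw [add_pow_char, add_mul, Tr_add, ha, hb, add_mul]
  | monomial a c =>
    ext m
    rw [coeff_Tr, monomial_pow, coeff_monomial_mul', coeff_monomial_mul', coeff_Tr]
    have hp := (Fact.out : p.Prime).pos
    have hiff : p • a ≤ pm p m ↔ a ≤ m := by
      constructor
      · intro h i
        have := h i
        simp only [pm, Finsupp.smul_apply, Finsupp.add_apply, allp_apply, smul_eq_mul] at this
        by_contra hlt
        push Not at hlt
        have : p * (m i + 1) ≤ p * a i := Nat.mul_le_mul_left _ hlt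
        rw [mul_add] at this; omega
      · intro h i
        simp only [pm, Finsupp.smul_apply, Finsupp.add_apply, allp_apply, smul_eq_mul]
        have := Nat.mul_le_mul_left p (h i)
        omega
    by_cases h : a ≤ m
    · rw [if_pos h, if_pos (hiff.mpr h), map_mul]
      congr 1
      · exact (frobeniusEquiv K p).symm_apply_apply c
      · congr 2
        ext i
        have := Nat.mul_le_mul_left p (h i)
        simp only [pm, Finsupp.tsub_apply, Finsupp.smul_apply, Finsupp.add_apply, allp_apply, smul_eq_mul, Nat.mul_sub]
        omega
    · rw [if_neg h, if_neg (fun h' => h (hiff.mp h')), map_zero]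

lemma pm_degree (m : σ →₀ ℕ) : (pm p m).degree = p * m.degree + (allp p σ).degree := by
  rw [pm, map_add, map_nsmul, smul_eq_mul]

lemma Tr_low (F : MvPolynomial σ K) (d : ℕ) (hF : F.IsHomogeneous d) (hd : d < (allp p σ).degree) : Tr p F = 0 := by
  ext m
  rw [coeff_Tr, hF.coeff_eq_zero, map_zero, coeff_zero]
  rw [pm_degree]; omega

lemma Tr_top (F : MvPolynomial σ K) (hF : F.IsHomogeneous (allp p σ).degree) (h1 : coeff (allp p σ) F = 1) : Tr p F = 1 := by
  classical
  ext m
  rw [coeff_Tr, coeff_one]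
  split_ifs with h
  · rw [← h, pm, smul_zero, zero_add, h1, map_one]
  · rw [hF.coeff_eq_zero, map_zero]
    rw [pm_degree]
    have : m.degree ≠ 0 := fun h' => h ((Finsupp.degree_eq_zero_iff m).mp h').symm
    have := Nat.mul_pos (Fact.out : p.Prime).pos (Nat.pos_of_ne_zero this)
    omega

lemma Tr_comm (ψ : MvPolynomial σ K →ₐ[K] MvPolynomial σ K) (hψ : ∀ i, (ψ (X i)).IsHomogeneous 1)
    (h1 : coeff (allp p σ) (ψ (monomial (allp p σ) 1)) = 1) (F : MvPolynomial σ K) :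
    Tr p (ψ F) = ψ (Tr p F) := by
  classical
  have hp := (Fact.out : p.Prime).pos
  have hh : ∀ r : σ →₀ ℕ, (ψ (monomial r 1)).IsHomogeneous r.degree := by
    intro r
    rw [monomial_eq, Finsupp.prod, C_1, one_mul, map_prod]
    simp only [map_pow]
    refine IsHomogeneous.prod _ _ _ fun i _ => ?_
    simpa using (hψ i).pow (r i)
  induction F using MvPolynomial.induction_on' with
  | add a b ha hb => rw [map_add, Tr_add, ha, hb, Tr_add, map_add]
  | monomial d c =>
    let a : σ →₀ ℕ := Finsupp.equivFunOnFinite.symm fun i => d i / p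
    let r : σ →₀ ℕ := Finsupp.equivFunOnFinite.symm fun i => d i % p
    have hd : d = p • a + r := by
      ext i
      exact (Nat.div_add_mod (d i) p).symm
    have hc : c = ((frobeniusEquiv K p).symm c) ^ p := ((frobeniusEquiv K p).apply_symm_apply c).symm
    have e : monomial d c = (monomial a ((frobeniusEquiv K p).symm c)) ^ p * monomial r (1 : K) := by
      rw [monomial_pow, monomial_mul, ← hd, ← hc, mul_one]
    rw [e, map_mul, map_pow, Tr_mul, Tr_mul, map_mul]
    congr 1
    by_cases hr : r = allp p σ
    · rw [hr, Tr_top p _ (hh _) h1, Tr_top p, map_one]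
      · exact isHomogeneous_monomial _ rfl
      · rw [coeff_monomial, if_pos rfl]
    · have hle : ∀ i, r i ≤ allp p σ i := fun i => by
        have : d i % p < p := Nat.mod_lt _ hp
        change d i % p ≤ p - 1
        omega
      have hlt : r.degree < (allp p σ).degree := by
        rw [Finsupp.degree_eq_sum, Finsupp.degree_eq_sum]
        apply Finset.sum_lt_sum (fun i _ => hle i)
        by_contra hcon
        push Not at hcon
        exact hr (Finsupp.ext fun i => le_antisymm (hle i) (hcon i (Finset.mem_univ i)))
      rw [Tr_low p _ _ (hh r) hlt, Tr_low p _ _ (isHomogeneous_monomial _ rfl) hlt, map_zero]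

end P1a
end QInv


namespace QInv

section P1b
set_option linter.unusedSectionVars false

lemma sm_bound {j n : ℕ} (hj : j ≤ n + 1) (g : Fin j → ℕ) (hg : StrictMono g) (hn : ∀ i, g i ≤ n) (i : Fin j) :
    g i ≤ n + 1 - j + i := by
  have key : ∀ d : ℕ, ∀ h : (i : ℕ) + d < j, g i + d ≤ g ⟨i + d, h⟩ := by
    intro d
    induction d with
    | zero => intro h; exact le_refl _
    | succ d ih =>
      intro h
      have h1 := ih (by omega)
      have h2 : g ⟨i + d, by omega⟩ < g ⟨i + (d + 1), h⟩ := hg (by rw [Fin.mk_lt_mk]; omega)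
      omega
  have h := key (j - 1 - i) (by omega)
  have := hn ⟨i + (j - 1 - i), by omega⟩
  omega

lemma W1 {j n : ℕ} (hj : j ≤ n + 1) (f : Fin j → ℕ) (hf : Function.Injective f) (hn : ∀ i, f i ≤ n) :
    ∑ i : Fin j, ((i : ℕ) + 1) * f i ≤ ∑ i : Fin j, ((i : ℕ) + 1) * (n + 1 - j + i) ∧
    ((∃ i : Fin j, f i ≠ n + 1 - j + i) → 
      ∑ i : Fin j, ((i : ℕ) + 1) * f i < ∑ i : Fin j, ((i : ℕ) + 1) * (n + 1 - j + i)) := by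
  set τ := Tuple.sort f
  have hm : Monotone (f ∘ τ) := Tuple.monotone_sort f
  have hs : StrictMono (f ∘ τ) := hm.strictMono_of_injective (hf.comp τ.injective)
  have hb := sm_bound hj _ hs (fun i => hn _)
  have hmv : Monovary (fun i : Fin j => (i : ℕ) + 1) (f ∘ τ) := by
    intro a b hab
    have := hs.lt_iff_lt.mp hab
    have : (a : ℕ) < b := this
    change (a : ℕ) + 1 ≤ b + 1
    omega
  have hcomp : ∀ i, (f ∘ τ) (τ⁻¹ i) = f i := fun i => by simp
  have hle2 : ∑ i : Fin j, ((i : ℕ) + 1) * (f ∘ τ) i ≤ ∑ i : Fin j, ((i : ℕ) + 1) * (n + 1 - j + i) :=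
    Finset.sum_le_sum fun i _ => Nat.mul_le_mul_left _ (hb i)
  have hle1 := hmv.sum_mul_comp_perm_le_sum_mul (σ := τ⁻¹)
  simp only [hcomp] at hle1
  refine ⟨hle1.trans hle2, fun hne => ?_⟩
  by_cases hmf : Monovary (fun i : Fin j => (i : ℕ) + 1) f
  · have hsf : StrictMono f := by
      intro a b hab
      rcases lt_trichotomy (f a) (f b) with h | h | h
      · exact h
      · exact absurd (hf h) hab.ne
      · have h1 : (b : ℕ) + 1 ≤ a + 1 := hmf h
        have : (a : ℕ) < b := hab
        omega
    have hb := sm_bound hj _ hsf hn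
    obtain ⟨i, hi⟩ := hne
    refine Finset.sum_lt_sum (fun i _ => Nat.mul_le_mul_left _ (hb i)) ⟨i, Finset.mem_univ _, ?_⟩
    exact Nat.mul_lt_mul_of_pos_left (lt_of_le_of_ne (hb i) hi) (Nat.succ_pos _)
  · have := (hmv.sum_mul_comp_perm_lt_sum_mul_iff (σ := τ⁻¹)).mpr (by
      intro h; apply hmf
      have : (f ∘ τ) ∘ (τ⁻¹ : Equiv.Perm (Fin j)) = f := funext hcomp
      rwa [this] at h)
    simp only [hcomp] at this
    exact this.trans_le hle2

variable {K : Type} [Field K] {n : ℕ}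

/-- leading principal minor -/
noncomputable def Dl {L : Type} [CommRing L] {n : ℕ} (j : Fin n) (P : Matrix (Fin n) (Fin n) L) : L :=
  (P.submatrix (Fin.castLE j.2.le) (Fin.castLE j.2.le)).det

/-- the basic form -/
noncomputable def kp {L : Type} [CommRing L] {n : ℕ} (Y : Matrix (Fin n) (Fin n) L) : L :=
  Y.det * ∏ j, Dl j (Y * Y)

/-- weight -/
def om (n : ℕ) (x : Fin n × Fin n) : ℕ := ((x.1 : ℕ) + 1) * ((x.2 : ℕ) + 1)

/-- term monomial of a minor -/
noncomputable def tm {n j : ℕ} (a b : Fin j → Fin n) : Fin n × Fin n →₀ ℕ := ∑ i, Finsupp.single (a i, b i) 1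

lemma tm_prod {j : ℕ} (a b : Fin j → Fin n) : ∏ i, mvPolynomialX (Fin n) (Fin n) K (a i) (b i) = monomial (tm a b) 1 := by
  have := monomial_sum_one (R := K) Finset.univ (fun i : Fin j => Finsupp.single (a i, b i) 1)
  exact this.symm

lemma tm_weight {j : ℕ} (a b : Fin j → Fin n) : Finsupp.weight (om n) (tm a b) = ∑ i, ((a i : ℕ) + 1) * ((b i : ℕ) + 1) := by
  unfold tm
  rw [map_sum]
  simp [Finsupp.weight_single, om]

lemma tm_swap {j : ℕ} (a b : Fin j → Fin n) : Finsupp.weight (om n) (tm a b) = Finsupp.weight (om n) (tm b a) := by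
  rw [tm_weight, tm_weight]; simp only [mul_comm]

lemma tm_lt {j : ℕ} (hj : j ≤ n) (f g : Fin j → Fin n) (hf : Function.Injective f) 
    (hg : ∀ i : Fin j, (g i : ℕ) = n - j + i) :
    Finsupp.weight (om n) (tm (Fin.castLE hj) f) ≤ Finsupp.weight (om n) (tm (Fin.castLE hj) g) ∧
    (f ≠ g → Finsupp.weight (om n) (tm (Fin.castLE hj) f) < Finsupp.weight (om n) (tm (Fin.castLE hj) g)) := by
  have h := W1 (j := j) (n := n) (by omega) (fun i => (f i : ℕ) + 1) (fun a b h => hf (by ext; simpa using h)) (fun i => (f i).2)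
  rw [tm_weight, tm_weight]
  simp only [Fin.val_castLE, hg]
  have e : ∀ i : Fin j, n - j + (i : ℕ) + 1 = n + 1 - j + i := fun i => by omega
  simp only [e]
  refine ⟨h.1, fun hne => h.2 ?_⟩
  obtain ⟨i, hi⟩ := Function.ne_iff.mp hne
  refine ⟨i, fun h' => hi (Fin.ext ?_)⟩
  rw [hg]
  have := e i
  omega

lemma perm_reindex {j : ℕ} (a b : Fin j → Fin n) (τ : Equiv.Perm (Fin j)) : tm (a ∘ τ) b = tm a (b ∘ (τ⁻¹ : Equiv.Perm (Fin j))) := by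
  unfold tm
  rw [← Equiv.sum_comp τ⁻¹]
  simp

lemma det_dom : Dom (om n) (mvPolynomialX (Fin n) (Fin n) K).det (tm id id) := by
  unfold Dom
  have h0 : ∀ τ : Equiv.Perm (Fin n), ∏ i, mvPolynomialX (Fin n) (Fin n) K (τ i) i = monomial (tm τ id) 1 := 
    fun τ => tm_prod τ id
  rw [det_apply, ← Finset.add_sum_erase _ _ (Finset.mem_univ 1)]
  simp only [h0]
  rw [Equiv.Perm.sign_one, one_smul, Equiv.Perm.coe_one, add_sub_cancel_left]
  refine Submodule.sum_mem _ fun τ hτ => ?_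
  rw [Units.smul_def]
  refine zsmul_mem (Wlt_monomial _ _ ?_) _
  rw [Finset.mem_erase] at hτ
  have h := (tm_lt (le_refl n) τ id τ.injective (fun i => by simp)).2 (fun h => hτ.1 (by ext i; simp [h]))
  rw [tm_swap]
  exact h

/-- shift embedding -/
def sh {n : ℕ} (j : Fin n) (i : Fin j) : Fin n := ⟨n - j + i, by omega⟩

lemma Dl_dom (j : Fin n) : Dom (om n) (Dl j (mvPolynomialX (Fin n) (Fin n) K * mvPolynomialX (Fin n) (Fin n) K))
    (tm (Fin.castLE j.2.le) (sh j) + tm (sh j) (Fin.castLE j.2.le)) := by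
  classical
  set c : Fin j → Fin n := Fin.castLE j.2.le with hc
  set Y := mvPolynomialX (Fin n) (Fin n) K with hY
  have e1 : Dl j (Y * Y) = ∑ f : Fin j → Fin n, (∏ i, Y (f i) (c i)) * (Matrix.of fun k i => Y (c k) (f i)).det := by
    rw [Dl, det_apply]
    simp only [submatrix_apply, mul_apply, Finset.prod_univ_sum, Fintype.piFinset_univ, det_apply, Finset.mul_sum, Finset.smul_sum]
    rw [Finset.sum_comm]
    refine Finset.sum_congr rfl fun f _ => Finset.sum_congr rfl fun τ _ => ?_
    rw [Finset.prod_mul_distrib, mul_smul_comm, mul_comm]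
    simp [hc]
  have hterm : ∀ (f : Fin j → Fin n) (τ : Equiv.Perm (Fin j)), 
      (∏ i, Y (f i) (c i)) * ∏ i, (Matrix.of fun k i => Y (c k) (f i)) (τ i) i = 
        monomial (tm f c + tm (c ∘ τ) f) 1 := by
    intro f τ
    rw [tm_prod, ← mul_one (1 : K), ← monomial_mul, ← tm_prod (c ∘ τ) f, mul_one]
    rfl
  have hw : ∀ (f : Fin j → Fin n) (τ : Equiv.Perm (Fin j)), Function.Injective f → (f ≠ sh j ∨ τ ≠ 1) →
      Finsupp.weight (om n) (tm f c + tm (c ∘ τ) f) < Finsupp.weight (om n) (tm c (sh j) + tm (sh j) c) := by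
    intro f τ hf h
    rw [map_add, map_add, tm_swap f c, tm_swap (sh j) c, perm_reindex]
    have h1 := tm_lt j.2.le f (sh j) hf (fun i => rfl)
    have h2 := tm_lt j.2.le (f ∘ (τ⁻¹ : Equiv.Perm (Fin j))) (sh j) (hf.comp (Equiv.injective _)) (fun i => rfl)
    by_cases hfe : f = sh j
    · have h3 := h2.2 (by
        intro h4
        rcases h with h | h
        · exact h hfe
        · apply h
          rw [← inv_eq_one]
          ext i
          have := hf ((congrFun h4 i).trans (congrFun hfe i).symm)
          simp [this])
      exact add_lt_add_of_le_of_lt h1.1 h3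
    · exact add_lt_add_of_lt_of_le (h1.2 hfe) h2.1
  have hinj : Function.Injective (sh j) := fun a b h => by
    have := congrArg Fin.val h
    simp only [sh] at this
    ext; omega
  unfold Dom
  rw [e1, ← Finset.add_sum_erase _ _ (Finset.mem_univ (sh j)), det_apply, Finset.mul_sum,
    ← Finset.add_sum_erase _ _ (Finset.mem_univ 1)]
  simp only [mul_smul_comm]
  have h1 := hterm (sh j) 1
  rw [Equiv.Perm.sign_one, one_smul, h1]
  have e2 : tm (sh j) c + tm (c ∘ (1 : Equiv.Perm (Fin j))) (sh j) = tm c (sh j) + tm (sh j) c := by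
    rw [add_comm]; rfl
  rw [e2, add_assoc, add_sub_cancel_left]
  refine Submodule.add_mem _ (Submodule.sum_mem _ fun τ hτ => ?_) (Submodule.sum_mem _ fun f hf => ?_)
  · rw [hterm, Units.smul_def]
    rw [Finset.mem_erase] at hτ
    exact zsmul_mem (Wlt_monomial _ _ (hw _ _ hinj (Or.inr hτ.1))) _
  · rw [Finset.mem_erase] at hf
    by_cases hi : Function.Injective f
    · rw [det_apply, Finset.mul_sum]
      refine Submodule.sum_mem _ fun τ _ => ?_
      rw [mul_smul_comm, hterm, Units.smul_def]
      exact zsmul_mem (Wlt_monomial _ _ (hw _ _ hi (Or.inl hf.1))) _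
    · simp only [Function.Injective, not_forall] at hi
      obtain ⟨a, b, hab, hne⟩ := hi
      rw [det_zero_of_column_eq hne (fun k => by simp [hab]), mul_zero]
      exact Submodule.zero_mem _

lemma tm_total : tm id id + ∑ j : Fin n, (tm (Fin.castLE j.2.le) (sh j) + tm (sh j) (Fin.castLE j.2.le)) = 
    Finsupp.equivFunOnFinite.symm (fun _ : Fin n × Fin n => 1) := by
  classical
  have key : ∀ k l : Fin n, (∑ j : Fin n, ∑ i : Fin j, if Fin.castLE j.2.le i = k ∧ sh j i = l then 1 else 0) = if k < l then 1 else 0 := by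
    intro k l
    split_ifs with h
    · have h' : (k : ℕ) < l := h
      rw [Finset.sum_eq_single ⟨n - (l - k), by omega⟩, Finset.sum_eq_single ⟨k, by simp; omega⟩]
      · rw [if_pos]
        refine ⟨by ext; simp, by ext; simp [sh]; omega⟩
      · intro b _ hb
        rw [if_neg]
        rintro ⟨h1, -⟩
        apply hb; ext; simp [← h1]
      · simp
      · intro j _ hj
        refine Finset.sum_eq_zero fun i _ => ?_
        rw [if_neg]
        rintro ⟨h1, h2⟩
        have h1 := congrArg Fin.val h1
        have h2 := congrArg Fin.val h2
        simp [sh] at h1 h2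
        apply hj; ext; simp; omega
      · simp
    · refine Finset.sum_eq_zero fun j _ => Finset.sum_eq_zero fun i _ => ?_
      rw [if_neg]
      rintro ⟨h1, h2⟩
      apply h
      rw [← h1, ← h2, Fin.lt_def]
      simp [sh]
  ext ⟨k, l⟩
  have k1 := key k l
  have k2 := key l k
  simp only [tm, Finsupp.add_apply, Finsupp.finset_sum_apply, Finsupp.single_apply, Prod.mk.injEq, Finset.sum_add_distrib]
  rw [k1]
  have : ∀ j : Fin n, ∀ i : Fin j, (sh j i = k ∧ Fin.castLE j.2.le i = l) ↔ (Fin.castLE j.2.le i = l ∧ sh j i = k) := fun _ _ => and_comm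
  simp only [this]
  rw [k2]
  have k3 : (∑ x : Fin n, if id x = k ∧ id x = l then 1 else 0) = if k = l then 1 else 0 := by
    simp only [id]
    split_ifs with h
    · subst h; simp
    · refine Finset.sum_eq_zero fun i _ => ?_
      rw [if_neg]; rintro ⟨rfl, h2⟩; exact h h2
  rw [k3]
  rcases lt_trichotomy k l with h | h | h
  · simp [h, h.ne, h.not_gt]
  · simp [h]
  · simp [h, h.ne', h.not_gt]

lemma kp_dom : Dom (om n) (kp (mvPolynomialX (Fin n) (Fin n) K)) (Finsupp.equivFunOnFinite.symm (fun _ : Fin n × Fin n => 1)) := by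
  rw [← tm_total]
  exact det_dom.mul (Dom.prod _ _ _ fun j _ => Dl_dom j)

lemma det_hom {σ : Type} {m : ℕ} (A : Matrix (Fin m) (Fin m) (MvPolynomial σ K)) (d : ℕ) (hA : ∀ i j, (A i j).IsHomogeneous d) :
    A.det.IsHomogeneous (m * d) := by
  rw [det_apply]
  refine IsHomogeneous.sum _ _ _ fun τ _ => ?_
  rw [Units.smul_def]
  have : (∏ i, A (τ i) i).IsHomogeneous (m * d) := by
    have := IsHomogeneous.prod Finset.univ (fun i => A (τ i) i) (fun _ => d) fun i _ => hA _ _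
    simpa using this
  rw [zsmul_eq_mul]
  rcases Int.units_eq_one_or (Equiv.Perm.sign τ) with h | h
  · simpa [h] using this
  · simpa [h] using this.neg

lemma kp_hom : (kp (mvPolynomialX (Fin n) (Fin n) K)).IsHomogeneous (n * n) := by
  have h1 : ∀ i j, (mvPolynomialX (Fin n) (Fin n) K i j).IsHomogeneous 1 := fun i j => isHomogeneous_X _ _
  have h2 : ∀ i j, ((mvPolynomialX (Fin n) (Fin n) K * mvPolynomialX (Fin n) (Fin n) K) i j).IsHomogeneous 2 := by
    intro i j
    rw [mul_apply]
    exact IsHomogeneous.sum _ _ _ fun k _ => (h1 i k).mul (h1 k j)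
  have h3 := (det_hom _ 1 h1).mul (IsHomogeneous.prod Finset.univ (fun j => Dl j (mvPolynomialX (Fin n) (Fin n) K * mvPolynomialX (Fin n) (Fin n) K)) _ fun j _ => det_hom _ 2 fun a b => h2 _ _)
  have e : n * 1 + ∑ j : Fin n, (j : ℕ) * 2 = n * n := by
    rw [← Finset.sum_mul, Fin.sum_univ_eq_sum_range (fun i => i) n, Finset.sum_range_id_mul_two]
    cases n <;> simp; ring
  rw [e] at h3
  exact h3

end P1b
end QInv


namespace QInv

section P1c
set_option linter.unusedSectionVars false
variable {K : Type} [Field K] {ι : Type} [Fintype ι] [DecidableEq ι]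

/-- evaluation at a matrix -/
noncomputable def ev {L : Type} [CommRing L] [Algebra K L] (Y : Matrix ι ι L) : MvPolynomial (ι × ι) K →ₐ[K] L :=
  aeval fun x => Y x.1 x.2

lemma ev_map {L L' : Type} [CommRing L] [Algebra K L] [CommRing L'] [Algebra K L'] (θ : L →ₐ[K] L') (Y : Matrix ι ι L)
    (F : MvPolynomial (ι × ι) K) : θ (ev Y F) = ev (Y.map θ) F := by
  have : θ.comp (ev Y) = ev (Y.map θ) := by
    apply MvPolynomial.algHom_ext; intro x; simp [ev]
  rw [← this]; rfl

lemma ev_X {L : Type} [CommRing L] [Algebra K L] (Y : Matrix ι ι L) : (mvPolynomialX ι ι K).map (ev Y) = Y := by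
  ext i j; simp [ev]

/-- conjugation invariance under `D` -/
def Gd (F : MvPolynomial (ι × ι) K) (D : Matrix ι ι K) : Prop := ∀ Y : Matrix ι ι K, ev (D * Y) F = ev (Y * D) F

lemma Gd.mul {F : MvPolynomial (ι × ι) K} {D E : Matrix ι ι K} (h1 : Gd F D) (h2 : Gd F E) : Gd F (D * E) := by
  intro Y
  rw [mul_assoc, h1, mul_assoc, h2, mul_assoc]

lemma Gd.one {F : MvPolynomial (ι × ι) K} : Gd F 1 := by
  intro Y; rw [one_mul, mul_one]

/-- conjugation substitution -/
noncomputable def cj (D D' : Matrix ι ι K) : MvPolynomial (ι × ι) K →ₐ[K] MvPolynomial (ι × ι) K :=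
  ev (D.map C * mvPolynomialX ι ι K * D'.map C)

lemma ev_cj (D D' Y : Matrix ι ι K) (F : MvPolynomial (ι × ι) K) : ev Y (cj D D' F) = ev (D * Y * D') F := by
  unfold cj
  rw [ev_map]
  have h : ∀ E : Matrix ι ι K, (E.map C).map (ev Y : MvPolynomial (ι × ι) K →ₐ[K] K) = E := by
    intro E; ext i j; simp [ev]
  rw [Matrix.map_mul, Matrix.map_mul, h, h, ev_X]

lemma ev_ext [Infinite K] {F G : MvPolynomial (ι × ι) K} (h : ∀ Y : Matrix ι ι K, ev Y F = ev Y G) : F = G := by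
  apply MvPolynomial.funext
  intro x
  have := h (Matrix.of fun i j => x (i, j))
  simp only [ev, Matrix.of_apply, Prod.mk.eta] at this
  exact this

lemma cj_eq [Infinite K] {F : MvPolynomial (ι × ι) K} {D D' : Matrix ι ι K} (hD : D' * D = 1) (h : Gd F D) : cj D D' F = F := by
  apply ev_ext; intro Y
  rw [ev_cj, mul_assoc, h, mul_assoc, hD, mul_one]

lemma Gd_of {F : MvPolynomial (ι × ι) K} {D D' : Matrix ι ι K} (hD : D * D' = 1) (h : ∀ Y, ev (D * Y * D') F = ev Y F) : Gd F D := by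
  intro Y
  rw [← h (Y * D), mul_assoc, mul_assoc, hD, mul_one]

lemma cj_hom (D D' : Matrix ι ι K) (x : ι × ι) : (cj D D' (X x)).IsHomogeneous 1 := by
  have : cj D D' (X x) = ∑ b, (∑ a, C (D x.1 a) * X (a, b)) * C (D' b x.2) := by
    simp [cj, ev, mul_apply]
  rw [this]
  refine IsHomogeneous.sum _ _ _ fun b _ => ?_
  rw [mul_comm]
  refine IsHomogeneous.C_mul (IsHomogeneous.sum _ _ _ fun a _ => IsHomogeneous.C_mul (isHomogeneous_X _ _) _) _

lemma mon_all {σ : Type} [Fintype σ] (p : ℕ) : (monomial (allp p σ) 1 : MvPolynomial σ K) = (∏ x, X x) ^ (p - 1) := by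
  rw [monomial_eq, Finsupp.prod_fintype _ _ (fun _ => pow_zero _), C_1, one_mul, ← Finset.prod_pow]
  rfl

variable (p : ℕ) [Fact p.Prime] [CharP K p] [PerfectRing K p] {n : ℕ}

/-- the splitting -/
noncomputable def ph (f : MvPolynomial (Fin n × Fin n) K) : MvPolynomial (Fin n × Fin n) K :=
  Tr p (kp (mvPolynomialX (Fin n) (Fin n) K) ^ (p - 1) * f)

lemma ph_add (f g : MvPolynomial (Fin n × Fin n) K) : ph p (f + g) = ph p f + ph p g := by
  unfold ph; rw [mul_add, Tr_add]

lemma ph_mul (f g : MvPolynomial (Fin n × Fin n) K) : ph p (f ^ p * g) = f * ph p g := by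
  unfold ph; rw [mul_left_comm, Tr_mul]

lemma ph_one : ph p (1 : MvPolynomial (Fin n × Fin n) K) = 1 := by
  unfold ph
  rw [mul_one]
  apply Tr_top
  · rw [allp_degree, Fintype.card_prod, Fintype.card_fin]
    exact kp_hom.pow _
  · have h := (kp_dom (K := K) (n := n)).pow (p - 1)
    have e : (p - 1) • Finsupp.equivFunOnFinite.symm (fun _ : Fin n × Fin n => 1) = allp p (Fin n × Fin n) := by
      ext x; simp [allp_apply]
    rw [e] at h
    exact h.coeff_eq

lemma kp_map {L L' : Type} [CommRing L] [CommRing L'] (θ : L →+* L') (Y : Matrix (Fin n) (Fin n) L) : θ (kp Y) = kp (Y.map θ) := by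
  unfold kp Dl
  rw [map_mul, map_prod, RingHom.map_det]
  congr 1
  refine Finset.prod_congr rfl fun j _ => ?_
  rw [RingHom.map_det, ← Matrix.map_mul]
  rfl

lemma cj_kp (D D' : Matrix (Fin n) (Fin n) K) : cj D D' (kp (mvPolynomialX (Fin n) (Fin n) K)) = 
    kp (D.map C * mvPolynomialX (Fin n) (Fin n) K * D'.map C) := by
  have := kp_map (cj D D').toRingHom (mvPolynomialX (Fin n) (Fin n) K)
  refine this.trans ?_
  congr 1
  exact ev_X _

lemma conj_sq {L : Type} [CommRing L] {D D' : Matrix (Fin n) (Fin n) L} (h : D' * D = 1) (Y : Matrix (Fin n) (Fin n) L) :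
    (D * Y * D') * (D * Y * D') = D * (Y * Y) * D' := by
  calc _ = D * Y * (D' * D) * Y * D' := by simp only [mul_assoc]
    _ = _ := by rw [h]; simp only [mul_assoc, one_mul]

lemma kp_diag {L : Type} [CommRing L] (d d' : Fin n → L) (h : ∀ i, d i * d' i = 1) (Y : Matrix (Fin n) (Fin n) L) :
    kp (diagonal d * Y * diagonal d') = kp Y := by
  have key : ∀ (m : ℕ) (c : Fin m → Fin n) (P : Matrix (Fin n) (Fin n) L),
      ((diagonal d * P * diagonal d').submatrix c c).det = (P.submatrix c c).det := by
    intro m c P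
    have : (diagonal d * P * diagonal d').submatrix c c
      = diagonal (fun i => d (c i)) * P.submatrix c c * diagonal (fun i => d' (c i)) := by
      ext x y : 2; simp [mul_diagonal, diagonal_mul]
    rw [this, det_mul, det_mul, det_diagonal, det_diagonal, mul_right_comm, ← Finset.prod_mul_distrib]
    simp [h]
  have h' : diagonal d' * diagonal d = 1 := by
    rw [diagonal_mul_diagonal, ← diagonal_one]; congr 1; funext i; rw [mul_comm, h]
  unfold kp Dl
  rw [conj_sq h']
  congr 1
  · exact key n id Y
  · exact Finset.prod_congr rfl fun j _ => key j _ (Y * Y)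

/-- diagonal case -/
lemma ph_diag [Infinite K] (d : Fin n → K) (hd : ∀ i, d i ≠ 0) (f : MvPolynomial (Fin n × Fin n) K) (hf : Gd f (diagonal d)) :
    Gd (ph p f) (diagonal d) := by
  set d' : Fin n → K := fun i => (d i)⁻¹ with hd'
  have h1 : diagonal d * diagonal d' = 1 := by
    rw [diagonal_mul_diagonal, ← diagonal_one]; congr 1; funext i; simp [hd', hd i]
  have h2 : diagonal d' * diagonal d = 1 := by
    rw [diagonal_mul_diagonal, ← diagonal_one]; congr 1; funext i; simp [hd', hd i]
  have hk : cj (diagonal d) (diagonal d') (kp (mvPolynomialX (Fin n) (Fin n) K)) = kp (mvPolynomialX (Fin n) (Fin n) K) := by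
    rw [cj_kp]
    have e1 : (diagonal d).map C = diagonal (fun i => (C (d i) : MvPolynomial (Fin n × Fin n) K)) := diagonal_map C_0
    have e2 : (diagonal d').map C = diagonal (fun i => (C (d' i) : MvPolynomial (Fin n × Fin n) K)) := diagonal_map C_0
    rw [e1, e2]
    apply kp_diag
    intro i
    rw [← C_mul, hd', mul_inv_cancel₀ (hd i), C_1]
  have hcoef : coeff (allp p (Fin n × Fin n)) (cj (diagonal d) (diagonal d') (monomial (allp p (Fin n × Fin n)) 1)) = 1 := by
    have : ∀ x : Fin n × Fin n, cj (diagonal d) (diagonal d') (X x) = C (d x.1 * d' x.2) * X x := by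
      intro x
      simp [cj, ev, diagonal_map, diagonal_mul, mul_diagonal]
      ring
    rw [mon_all, map_pow, map_prod]
    simp only [this]
    rw [Finset.prod_mul_distrib, ← map_prod, mul_pow, ← mon_all]
    have : ∏ x : Fin n × Fin n, (d x.1 * d' x.2) = 1 := by
      rw [Finset.prod_mul_distrib, Fintype.prod_prod_type, Fintype.prod_prod_type_right, ← Finset.prod_mul_distrib]
      refine Finset.prod_eq_one fun i _ => ?_
      rw [← Finset.prod_mul_distrib]
      exact Finset.prod_eq_one fun j _ => mul_inv_cancel₀ (hd i)
    rw [this, C_1, one_pow, one_mul, coeff_monomial, if_pos rfl]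
  refine Gd_of h1 fun Y => ?_
  rw [← ev_cj]
  congr 1
  unfold ph
  rw [← Tr_comm p _ (cj_hom _ _) hcoef, map_mul, map_pow, hk, cj_eq h2 hf]

end P1c
end QInv


namespace QInv

section P1d
set_option linter.unusedSectionVars false

lemma tr_apply {L ι : Type} [CommRing L] [Fintype ι] [DecidableEq ι] (i j : ι) (t : L) (P : Matrix ι ι L) (k l : ι) :
    (transvection i j t * P * transvection i j (-t)) k l =
      (P k l + if k = i then t * P j l else 0) - if l = j then t * (P k i + if k = i then t * P j i else 0) else 0 := by
  have h1 : ∀ k l, (transvection i j t * P) k l = P k l + if k = i then t * P j l else 0 := by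
    intro k l
    by_cases hk : k = i
    · subst hk; rw [transvection_mul_apply_same, if_pos rfl]
    · rw [transvection_mul_apply_of_ne (ha := hk), if_neg hk, add_zero]
  by_cases hl : l = j
  · subst hl; rw [mul_transvection_apply_same, h1, h1, if_pos rfl]; ring
  · rw [mul_transvection_apply_of_ne (hb := hl), h1, if_neg hl, sub_zero]

variable {L : Type} [CommRing L] {n : ℕ}

lemma trans_inv {ι : Type} [Fintype ι] [DecidableEq ι] {i j : ι} (h : i ≠ j) (t : L) :
    transvection i j t * transvection i j (-t) = 1 := by
  rw [transvection_mul_transvection_same _ _ h, add_neg_cancel, transvection_zero]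

lemma trans_inv' {ι : Type} [Fintype ι] [DecidableEq ι] {i j : ι} (h : i ≠ j) (t : L) :
    transvection i j (-t) * transvection i j t = 1 := by
  rw [transvection_mul_transvection_same _ _ h, neg_add_cancel, transvection_zero]

lemma Dl_trans_ne (i i' j : Fin n) (hii : i'.val = i.val + 1) (hj : j ≠ i') (t : L) (P : Matrix (Fin n) (Fin n) L) :
    Dl j (transvection i i' t * P * transvection i i' (-t)) = Dl j P := by
  unfold Dl
  have hjv : j.val ≠ i'.val := fun h => hj (Fin.ext h)
  by_cases hlt : j.val ≤ i.val
  · congr 1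
    ext k l
    rw [submatrix_apply, submatrix_apply, tr_apply, if_neg, if_neg]
    · ring
    · intro h; have := congrArg Fin.val h; simp at this; omega
    · intro h; have := congrArg Fin.val h; simp at this; omega
  · have e : (transvection i i' t * P * transvection i i' (-t)).submatrix (Fin.castLE j.2.le) (Fin.castLE j.2.le) =
      transvection (⟨i, by omega⟩ : Fin j) ⟨i', by omega⟩ t * P.submatrix (Fin.castLE j.2.le) (Fin.castLE j.2.le) *
        transvection (⟨i, by omega⟩ : Fin j) ⟨i', by omega⟩ (-t) := by
      ext k l
      rw [submatrix_apply, tr_apply, tr_apply]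
      simp only [submatrix_apply, Fin.ext_iff, Fin.val_castLE, Fin.castLE_mk]
    have hne : (⟨i, by omega⟩ : Fin j) ≠ ⟨i', by omega⟩ := by
      intro h; have := congrArg Fin.val h; simp at this; omega
    rw [e, det_mul, det_mul, det_transvection_of_ne _ _ hne, det_transvection_of_ne _ _ hne, one_mul, mul_one]

lemma Dl_trans_eq (i i' : Fin n) (hii : i'.val = i.val + 1) (P : Matrix (Fin n) (Fin n) L) :
    ∃ q : L, ∀ t, Dl i' (transvection i i' t * P * transvection i i' (-t)) = Dl i' P + t * q := by
  unfold Dl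
  refine ⟨((P.submatrix (Fin.castLE i'.2.le) (Fin.castLE i'.2.le)).updateRow ⟨i, by omega⟩
    (fun l => P i' (Fin.castLE i'.2.le l))).det, fun t => ?_⟩
  have e : (transvection i i' t * P * transvection i i' (-t)).submatrix (Fin.castLE i'.2.le) (Fin.castLE i'.2.le) = 
    (P.submatrix (Fin.castLE i'.2.le) (Fin.castLE i'.2.le)).updateRow ⟨i, by omega⟩
     ((P.submatrix (Fin.castLE i'.2.le) (Fin.castLE i'.2.le)) ⟨i, by omega⟩ + t • (fun l => P i' (Fin.castLE i'.2.le l))) := by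
    ext k l
    have hl : ¬ (Fin.castLE i'.2.le l = i') := by
      intro h; have := congrArg Fin.val h; simp at this; omega
    rw [submatrix_apply, tr_apply, if_neg hl, updateRow_apply, sub_zero]
    by_cases hk : k = ⟨i, by omega⟩
    · subst hk
      simp
    · have : ¬ (Fin.castLE i'.2.le k = i) := by
        intro h; apply hk; ext; have := congrArg Fin.val h; simpa using this
      rw [if_neg hk, if_neg this, add_zero]; rfl
  rw [e, det_updateRow_add, det_updateRow_smul, updateRow_eq_self]

lemma kp_trans (i i' : Fin n) (hii : i'.val = i.val + 1) (Y : Matrix (Fin n) (Fin n) L) :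
    ∃ q : L, ∀ t, kp (transvection i i' t * Y * transvection i i' (-t)) = kp Y + t * q := by
  obtain ⟨q, hq⟩ := Dl_trans_eq i i' hii (Y * Y)
  have hne : i ≠ i' := by intro h; rw [h] at hii; omega
  refine ⟨Y.det * (q * ∏ j ∈ Finset.univ.erase i', Dl j (Y * Y)), fun t => ?_⟩
  unfold kp
  rw [conj_sq (trans_inv' hne t), det_mul, det_mul, det_transvection_of_ne _ _ hne, det_transvection_of_ne _ _ hne,
    ← Finset.mul_prod_erase _ _ (Finset.mem_univ i'), ← Finset.mul_prod_erase _ (fun j => Dl j (Y * Y)) (Finset.mem_univ i'), hq t,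
    Finset.prod_congr rfl fun j hj => Dl_trans_ne i i' j hii (Finset.ne_of_mem_erase hj) t (Y * Y)]
  ring

lemma trans_map {L' ι : Type} [CommRing L'] [Fintype ι] [DecidableEq ι] (θ : L →+* L') (i j : ι) (t : L) :
    (transvection i j t).map θ = transvection i j (θ t) := by
  unfold transvection
  ext k l
  simp [Matrix.one_apply, Matrix.single_apply, apply_ite θ]

variable {K : Type} [Field K] 

lemma trans_coef (p : ℕ) {ι : Type} [Fintype ι] [DecidableEq ι] (i i' : ι) (h : i ≠ i') (t : K) :
    coeff (allp p (ι × ι)) (cj (transvection i i' t) (transvection i i' (-t)) (monomial (allp p (ι × ι)) 1)) = 1 := by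
  rw [mon_all, map_pow, map_prod]
  set ω : ι × ι → ℕ := fun x => (if x.1 = i then 1 else 0) + (if x.2 = i then 0 else 1)
  have hx : ∀ x ∈ Finset.univ, Dom ω (cj (transvection i i' t) (transvection i i' (-t)) (X x)) (Finsupp.single x 1) := by
    rintro ⟨k, l⟩ -
    have e : cj (transvection i i' t) (transvection i i' (-t)) (X (k, l)) - monomial (Finsupp.single (k, l) 1) 1 =
      (if k = i then t • (monomial (Finsupp.single (i', l) 1) 1 : MvPolynomial (ι × ι) K) else 0) - 
        (if l = i' then t • ((monomial (Finsupp.single (k, i) 1) 1 : MvPolynomial (ι × ι) K) + if k = i then t • monomial (Finsupp.single (i', i) 1) 1 else 0) else 0) := by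
      have : cj (transvection i i' t) (transvection i i' (-t)) (X (k, l)) = 
        (transvection i i' (C t) * mvPolynomialX ι ι K * transvection i i' (-C t) : Matrix ι ι (MvPolynomial (ι × ι) K)) k l := by
        unfold cj ev
        rw [aeval_X]
        simp only
        rw [trans_map C i i' t, trans_map C i i' (-t), C_neg]
      rw [this, tr_apply]
      simp only [mvPolynomialX_apply, smul_eq_C_mul]
      simp only [X]
      ring
    unfold Dom
    rw [e]
    have hm : ∀ y, ω y < ω (k, l) → (monomial (Finsupp.single y 1) 1 : MvPolynomial (ι × ι) K) ∈ Wlt K ω (Finsupp.weight ω (Finsupp.single (k, l) 1)) := by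
      intro y hy
      apply Wlt_monomial
      rw [Finsupp.weight_single, Finsupp.weight_single, one_smul, one_smul]; exact hy
    apply Submodule.sub_mem
    · split_ifs with hk
      · refine Submodule.smul_mem _ _ (hm _ ?_)
        subst hk
        simp [ω, h.symm]
      · exact Submodule.zero_mem _
    · split_ifs with hl hk
      · refine Submodule.smul_mem _ _ (Submodule.add_mem _ (hm _ ?_) (Submodule.smul_mem _ _ (hm _ ?_)))
        · subst hl; simp [ω, h.symm]
        · subst hk hl; simp [ω, h.symm]
      · refine Submodule.smul_mem _ _ (Submodule.add_mem _ (hm _ ?_) (Submodule.zero_mem _))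
        subst hl; simp [ω, h.symm]
      · exact Submodule.zero_mem _
  have := (Dom.prod Finset.univ _ _ hx).pow (p - 1)
  have e : (p - 1) • ∑ x : ι × ι, Finsupp.single x 1 = allp p (ι × ι) := by
    ext x; simp [Finsupp.finsetSum_apply, Finsupp.single_apply]; rfl
  rw [e] at this
  exact this.coeff_eq

variable (p : ℕ) [Fact p.Prime] [CharP K p] [PerfectRing K p]

lemma Tr_zero' {σ : Type} [Fintype σ] : Tr p (0 : MvPolynomial σ K) = 0 := by
  have := Tr_add p (0 : MvPolynomial σ K) 0
  simpa using this

lemma Tr_sum {σ κ : Type} [Fintype σ] (s : Finset κ) (F : κ → MvPolynomial σ K) : Tr p (∑ x ∈ s, F x) = ∑ x ∈ s, Tr p (F x) := by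
  classical
  induction s using Finset.induction_on with
  | empty => simp [Tr_zero']
  | insert a s ha ih => rw [Finset.sum_insert ha, Finset.sum_insert ha, Tr_add, ih]

/-- upper simple transvections -/
lemma ph_up [Infinite K] (i i' : Fin n) (hii : i'.val = i.val + 1) (f : MvPolynomial (Fin n × Fin n) K)
    (hf : ∀ t, Gd f (transvection i i' t)) (t : K) : Gd (ph p f) (transvection i i' t) := by
  have hne : i ≠ i' := by intro h; rw [h] at hii; omega
  have hp : 0 < p := (Fact.out : p.Prime).pos
  refine Gd_of (trans_inv hne t) fun Y => ?_
  obtain ⟨q, hq⟩ := kp_trans i i' hii (mvPolynomialX (Fin n) (Fin n) K)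
  set k := kp (mvPolynomialX (Fin n) (Fin n) K) with hk
  set g := ph p f with hg
  have key : ∀ s : K, cj (transvection i i' (s ^ p)) (transvection i i' (-s ^ p)) g = 
      ∑ r ∈ Finset.range p, C (s ^ r) * Tr p (q ^ r * k ^ (p - 1 - r) * ((p - 1).choose r : MvPolynomial (Fin n × Fin n) K) * f) := by
    intro s
    rw [hg, ph, ← Tr_comm p _ (cj_hom _ _) (trans_coef p i i' hne _), map_mul, map_pow, cj_kp,
      cj_eq (trans_inv' hne _) (hf _)]
    have e1 : (transvection i i' (s ^ p)).map C = transvection i i' (C (s ^ p) : MvPolynomial (Fin n × Fin n) K) := trans_map _ _ _ _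
    have e2 : (transvection i i' (-s ^ p)).map C = transvection i i' (- C (s ^ p) : MvPolynomial (Fin n × Fin n) K) := by
      rw [← C_neg]; exact trans_map _ _ _ _
    rw [e1, e2, hq, add_comm k, add_pow, Finset.sum_mul, Tr_sum, Nat.sub_add_cancel hp]
    refine Finset.sum_congr rfl fun r _ => ?_
    rw [← Tr_mul]
    congr 1
    rw [C_pow, C_pow, mul_pow]
    ring
  set G : Polynomial K := ev (transvection i i' (Polynomial.X) * Y.map Polynomial.C * transvection i i' (-Polynomial.X)) g with hG
  have hGev : ∀ s : K, G.eval s = ev (transvection i i' s * Y * transvection i i' (-s)) g := by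
    intro s
    have := ev_map (Polynomial.aeval s : Polynomial K →ₐ[K] K) (transvection i i' (Polynomial.X) * Y.map Polynomial.C * transvection i i' (-Polynomial.X)) g
    rw [← hG, Polynomial.coe_aeval_eq_eval] at this
    rw [this]
    have e0 : (Y.map Polynomial.C).map (Polynomial.eval s) = Y := by ext; simp
    have e1 : ∀ u : Polynomial K, (transvection i i' u).map (Polynomial.eval s) = transvection i i' (u.eval s) := 
      fun u => trans_map (Polynomial.evalRingHom s) _ _ _
    have e3 : ∀ A B : Matrix (Fin n) (Fin n) (Polynomial K), (A * B).map (Polynomial.eval s) = A.map (Polynomial.eval s) * B.map (Polynomial.eval s) :=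
      fun A B => Matrix.map_mul (f := Polynomial.evalRingHom s)
    rw [e3, e3, e1, e1, e0, Polynomial.eval_neg, Polynomial.eval_X]
  set H : Polynomial K := ∑ r ∈ Finset.range p, Polynomial.C (ev Y (Tr p (q ^ r * k ^ (p - 1 - r) * ((p - 1).choose r : MvPolynomial (Fin n × Fin n) K) * f))) * Polynomial.X ^ r with hH
  have hGH : Polynomial.expand K p G = H := by
    apply Polynomial.funext
    intro s
    rw [Polynomial.expand_eval, hGev, ← ev_cj, key, map_sum, hH, Polynomial.eval_finsetSum]
    refine Finset.sum_congr rfl fun r _ => ?_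
    rw [map_mul, Polynomial.eval_mul, Polynomial.eval_C, Polynomial.eval_pow, Polynomial.eval_X, mul_comm]
    congr 1
    unfold ev
    rw [aeval_C]; rfl
  have hdeg : H.natDegree < p := by
    have : H.natDegree ≤ p - 1 := by
      apply Polynomial.natDegree_sum_le_of_forall_le
      intro r hr
      rw [Finset.mem_range] at hr
      exact (Polynomial.natDegree_C_mul_X_pow_le _ _).trans (by omega)
    omega
  rw [← hGH, Polynomial.natDegree_expand] at hdeg
  have hG0 : G.natDegree = 0 := by
    by_contra h
    have := Nat.le_mul_of_pos_left p (Nat.pos_of_ne_zero h)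
    omega
  have hc := Polynomial.eq_C_of_natDegree_eq_zero hG0
  have h0 : G.eval t = G.eval 0 := by rw [hc, Polynomial.eval_C, Polynomial.eval_C]
  rw [← hGev, h0, hGev, neg_zero, transvection_zero, one_mul, mul_one]

end P1d
end QInv


namespace QInv

section P1e
set_option linter.unusedSectionVars false
variable {L : Type} [CommRing L] {ι : Type} [Fintype ι] [DecidableEq ι]

/-- inclusion of the two coordinates -/
def Jm (L : Type) [CommRing L] (i i' : ι) : Matrix ι (Fin 2) L := Matrix.of fun k c => if k = ![i, i'] c then 1 else 0

/-- embedding of 2 by 2 matrices -/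
def em (i i' : ι) (A : Matrix (Fin 2) (Fin 2) L) : Matrix ι ι L := 1 + Jm L i i' * (A - 1) * (Jm L i i')ᵀ

lemma Jm_inv {i i' : ι} (h : i ≠ i') : (Jm L i i')ᵀ * Jm L i i' = 1 := by
  ext a b
  simp only [Jm, mul_apply, transpose_apply, of_apply, mul_ite, mul_one, mul_zero, Finset.sum_ite_eq', Finset.mem_univ, if_true]
  fin_cases a <;> fin_cases b <;> simp [h, h.symm]

lemma em_mul {i i' : ι} (h : i ≠ i') (A B : Matrix (Fin 2) (Fin 2) L) : em i i' (A * B) = em i i' A * em i i' B := by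
  unfold em
  set J := Jm L i i'
  have e : A * B - 1 = (A - 1) + (B - 1) + (A - 1) * (B - 1) := by noncomm_ring
  have e2 : J * (A - 1) * Jᵀ * (J * (B - 1) * Jᵀ) = J * ((A - 1) * (B - 1)) * Jᵀ := by
    calc _ = J * (A - 1) * (Jᵀ * J) * (B - 1) * Jᵀ := by simp only [Matrix.mul_assoc]
      _ = _ := by rw [Jm_inv h]; simp only [Matrix.mul_assoc, Matrix.one_mul]
  rw [add_mul, mul_add, mul_add, e2, e]
  simp only [mul_one, one_mul, Matrix.mul_add, Matrix.add_mul]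
  abel

lemma em_apply (i i' : ι) (A : Matrix (Fin 2) (Fin 2) L) (k l : ι) : em i i' A k l = (if k = l then 1 else 0) + 
    ((if k = i then (A 0 0 - 1) else 0) + (if k = i' then A 1 0 else 0)) * (if l = i then 1 else 0) + 
    ((if k = i then A 0 1 else 0) + (if k = i' then (A 1 1 - 1) else 0)) * (if l = i' then 1 else 0) := by
  unfold em
  rw [Matrix.add_apply, Matrix.one_apply, Matrix.mul_apply, Fin.sum_univ_two, Matrix.mul_apply, Matrix.mul_apply, Fin.sum_univ_two, Fin.sum_univ_two]
  have j0 : ∀ k, Jm L i i' k 0 = if k = i then 1 else 0 := fun _ => rfl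
  have j1 : ∀ k, Jm L i i' k 1 = if k = i' then 1 else 0 := fun _ => rfl
  simp only [transpose_apply, j0, j1, Matrix.sub_apply, Matrix.one_apply_eq, Matrix.one_apply_ne (show (0 : Fin 2) ≠ 1 by decide),
    Matrix.one_apply_ne (show (1 : Fin 2) ≠ 0 by decide), sub_zero]
  have hh : ∀ (P : Prop) [Decidable P] (x : L), (if P then x else 0) = (if P then 1 else 0) * x := by
    intro P _ x; split_ifs <;> simp
  rw [hh (k = i) (A 0 0 - 1), hh (k = i') (A 1 0), hh (k = i) (A 0 1), hh (k = i') (A 1 1 - 1)]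
  ring

lemma em_up {i i' : ι} (t : L) : em i i' !![1, t; 0, 1] = transvection i i' t := by
  ext k l
  rw [em_apply, transvection, Matrix.add_apply, Matrix.one_apply, Matrix.single_apply]
  by_cases h1 : k = i <;> by_cases h2 : l = i' <;> simp [h1, h2, Ne.symm, eq_comm]

lemma em_low {i i' : ι} (t : L) : em i i' !![1, 0; t, 1] = transvection i' i t := by
  ext k l
  rw [em_apply, transvection, Matrix.add_apply, Matrix.one_apply, Matrix.single_apply]
  simp only [eq_comm (a := i') (b := k), eq_comm (a := i) (b := l)]
  by_cases h1 : k = i' <;> by_cases h2 : l = i <;> simp [h1, h2]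

lemma em_diag {i i' : ι} (h : i ≠ i') (a s : L) : em i i' !![a, 0; 0, s] = diagonal fun k => if k = i then a else if k = i' then s else 1 := by
  ext k l
  rw [em_apply, diagonal_apply]
  by_cases h1 : k = i
  · subst h1
    by_cases h2 : k = l
    · subst h2; simp [h]
    · simp [h2, h, Ne.symm h2]
  · by_cases h3 : k = i'
    · subst h3
      by_cases h2 : k = l
      · subst h2; simp [h1]
      · simp [h2, h1, Ne.symm h2]
    · simp [h1, h3]

lemma em_map {L' : Type} [CommRing L'] (θ : L →+* L') (i i' : ι) (A : Matrix (Fin 2) (Fin 2) L) :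
    (em i i' A).map θ = em i i' (A.map θ) := by
  ext k l
  rw [Matrix.map_apply, em_apply, em_apply]
  simp [apply_ite θ]

variable {K : Type} [Field K] 

lemma em_ev (i i' : ι) (A B : Matrix (Fin 2) (Fin 2) (Polynomial K)) (Y : Matrix ι ι K) (g : MvPolynomial (ι × ι) K) (s : K) :
    (ev (em i i' A * Y.map Polynomial.C * em i i' B) g : Polynomial K).eval s =
      ev (em i i' (A.map (Polynomial.eval s)) * Y * em i i' (B.map (Polynomial.eval s))) g := by
  have := ev_map (Polynomial.aeval s : Polynomial K →ₐ[K] K) (em i i' A * Y.map Polynomial.C * em i i' B) g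
  rw [Polynomial.coe_aeval_eq_eval] at this
  rw [this]
  have e0 : (Y.map Polynomial.C).map (Polynomial.eval s) = Y := by ext; simp
  have e1 : ∀ u, (em i i' u).map (Polynomial.eval s) = em i i' (u.map (Polynomial.eval s)) := 
    fun u => em_map (Polynomial.evalRingHom s) _ _ _
  have e3 : ∀ A B : Matrix ι ι (Polynomial K), (A * B).map (Polynomial.eval s) = A.map (Polynomial.eval s) * B.map (Polynomial.eval s) :=
    fun A B => Matrix.map_mul (f := Polynomial.evalRingHom s)
  rw [e3, e3, e1, e1, e0]

lemma poly_const [Infinite K] (G H : Polynomial K) (h : ∀ s : K, s ≠ 0 → G.eval s = H.eval s⁻¹) (s : K) : G.eval s = G.eval 0 := by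
  have hrev : ∀ s : K, s ≠ 0 → H.eval s⁻¹ * s ^ H.natDegree = H.reverse.eval s := by
    intro s hs
    letI := invertibleOfNonzero (inv_ne_zero hs)
    have := Polynomial.eval₂_reverse_mul_pow (RingHom.id K) s⁻¹ H
    simp only [invOf_eq_inv, inv_inv] at this
    change Polynomial.eval s H.reverse * (s⁻¹) ^ _ = Polynomial.eval s⁻¹ H at this
    rw [← this, mul_assoc, ← mul_pow, inv_mul_cancel₀ hs, one_pow, mul_one]
  have e : Polynomial.X * (G * Polynomial.X ^ H.natDegree) = Polynomial.X * H.reverse := by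
    apply Polynomial.funext
    intro s
    by_cases hs : s = 0
    · simp [hs]
    · rw [Polynomial.eval_mul, Polynomial.eval_mul, Polynomial.eval_mul, Polynomial.eval_pow, Polynomial.eval_X, h s hs, hrev s hs]
  have e' := mul_left_cancel₀ Polynomial.X_ne_zero e
  by_cases hG : G = 0
  · simp [hG]
  have hd : G.natDegree = 0 := by
    have := congrArg Polynomial.natDegree e'
    rw [Polynomial.natDegree_mul hG (pow_ne_zero _ Polynomial.X_ne_zero), Polynomial.natDegree_X_pow] at this
    have := Polynomial.reverse_natDegree_le H
    omega
  have hc := Polynomial.eq_C_of_natDegree_eq_zero hd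
  rw [hc, Polynomial.eval_C, Polynomial.eval_C]

lemma Gd_low [Infinite K] {i i' : ι} (h : i ≠ i') (g : MvPolynomial (ι × ι) K) (hd : ∀ d : ι → K, (∀ i, d i ≠ 0) → Gd g (diagonal d))
    (hu : ∀ t, Gd g (transvection i i' t)) (t : K) : Gd g (transvection i' i t) := by
  refine Gd_of (trans_inv h.symm t) fun Y => ?_
  have := poly_const (ev (em i i' !![1, 0; Polynomial.X, 1] * Y.map Polynomial.C * em i i' !![1, 0; -Polynomial.X, 1]) g)
    (ev (em i i' !![0, -1; 1, Polynomial.X] * Y.map Polynomial.C * em i i' !![Polynomial.X, 1; -1, 0]) g) ?_ t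
  · rw [em_ev, em_ev] at this
    have e : ∀ (u : Polynomial K) (s : K), (!![1, 0; u, 1] : Matrix _ _ (Polynomial K)).map (Polynomial.eval s) = !![1, 0; u.eval s, 1] := by
      intro u s; ext a b; fin_cases a <;> fin_cases b <;> simp
    simp only [e, em_low] at this
    simpa using this
  · intro s hs
    rw [em_ev, em_ev]
    have e1 : (!![1, 0; Polynomial.X, 1] : Matrix _ _ (Polynomial K)).map (Polynomial.eval s) = !![1, s⁻¹; 0, 1] * !![s⁻¹, 0; 0, s] * !![0, -1; 1, s⁻¹] := by
      ext a b; fin_cases a <;> fin_cases b <;> simp [hs]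
    have e2 : (!![0, -1; 1, Polynomial.X] : Matrix _ _ (Polynomial K)).map (Polynomial.eval s⁻¹) = !![0, -1; 1, s⁻¹] := by
      ext a b; fin_cases a <;> fin_cases b <;> simp
    have e4 : (!![1, 0; -Polynomial.X, 1] : Matrix _ _ (Polynomial K)).map (Polynomial.eval s) = !![1, 0; -s, 1] := by
      ext a b; fin_cases a <;> fin_cases b <;> simp
    have e3 : (!![Polynomial.X, 1; -1, 0] : Matrix _ _ (Polynomial K)).map (Polynomial.eval s⁻¹) = 
      (!![1, 0; -Polynomial.X, 1] : Matrix _ _ (Polynomial K)).map (Polynomial.eval s) * !![1, s⁻¹; 0, 1] * !![s⁻¹, 0; 0, s] := by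
      rw [e4]; ext a b; fin_cases a <;> fin_cases b <;> simp [hs]
    rw [e1, e2, e3, em_mul h, em_mul h, em_mul h, em_mul h, em_up, em_diag h]
    have h1 := hu s⁻¹
    have h2 := hd (fun k => if k = i then s⁻¹ else if k = i' then s else 1) (by intro k; split_ifs <;> simp [hs])
    have h3 := h1.mul h2 
    simp only [Matrix.mul_assoc]
    rw [← Matrix.mul_assoc (transvection i i' s⁻¹), h3]
    simp only [Matrix.mul_assoc]

lemma trans_comm {i k j : ι} (hik : i ≠ k) (hkj : k ≠ j) (hij : i ≠ j) (a : L) : 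
    transvection i j a = transvection i k a * transvection k j 1 * transvection i k (-a) * transvection k j (-1) := by
  have hs : ∀ (x y : ι) (b : L), single x y (-b) = - single x y b := by
    intro x y b; ext u v; simp only [Matrix.neg_apply, Matrix.single_apply]; split_ifs <;> simp
  simp [transvection, hs, mul_add, add_mul, hik, hkj, hij, hik.symm, hkj.symm, hij.symm]
  abel

/-- invariance under diagonal matrices and transvections within the colours -/
def CI {γ : Type} (c : ι → γ) (f : MvPolynomial (ι × ι) K) : Prop :=
  (∀ d : ι → K, (∀ i, d i ≠ 0) → Gd f (diagonal d)) ∧ ∀ i j, i ≠ j → c i = c j → ∀ t, Gd f (transvection i j t)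

lemma ph_CI (p : ℕ) [Fact p.Prime] [CharP K p] [PerfectRing K p] [Infinite K] {n : ℕ} {γ : Type} (c : Fin n → γ) 
    (hc : ∀ i j k : Fin n, i ≤ k → k ≤ j → c i = c j → c k = c i)
    (f : MvPolynomial (Fin n × Fin n) K) (hf : CI c f) : CI c (ph p f) := by
  have hd : ∀ d : Fin n → K, (∀ i, d i ≠ 0) → Gd (ph p f) (diagonal d) := fun d hd => ph_diag p d hd f (hf.1 d hd)
  refine ⟨hd, ?_⟩
  have hup : ∀ i i' : Fin n, i'.val = i.val + 1 → c i = c i' → ∀ t, Gd (ph p f) (transvection i i' t) := by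
    intro i i' hii hcc t
    have hne : i ≠ i' := by intro h; rw [h] at hii; omega
    exact ph_up p i i' hii f (hf.2 i i' hne hcc) t
  have hlow : ∀ i i' : Fin n, i'.val = i.val + 1 → c i = c i' → ∀ t, Gd (ph p f) (transvection i' i t) := by
    intro i i' hii hcc t
    have hne : i ≠ i' := by intro h; rw [h] at hii; omega
    exact Gd_low hne _ hd (hup i i' hii hcc) t
  have main : ∀ m : ℕ, ∀ i j : Fin n, (j.val = i.val + m + 1 ∨ i.val = j.val + m + 1) → c i = c j → ∀ t, Gd (ph p f) (transvection i j t) := by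
    intro m
    induction m with
    | zero =>
      intro i j hij hcc t
      rcases hij with h | h
      · exact hup i j h hcc t
      · exact hlow j i h hcc.symm t
    | succ m ih =>
      intro i j hij hcc t
      rcases hij with h | h
      · set k : Fin n := ⟨i.val + 1, by omega⟩ with hk
        have hkv : k.val = i.val + 1 := rfl
        have hck : c k = c i := hc i j k (by rw [Fin.le_def]; omega) (by rw [Fin.le_def]; omega) hcc
        rw [trans_comm (i := i) (k := k) (j := j) (by intro e; rw [← e] at hkv; omega) (by intro e; rw [e] at hkv; omega) (by intro e; rw [e] at h; omega)]
        have h1 := hup i k hkv hck.symm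
        have h2 := ih k j (Or.inl (by omega)) (hck.trans hcc)
        exact (((h1 _).mul (h2 _)).mul (h1 _)).mul (h2 _)
      · set k : Fin n := ⟨i.val - 1, by omega⟩ with hk
        have hkv : k.val = i.val - 1 := rfl
        have hck : c k = c j := hc j i k (by rw [Fin.le_def]; omega) (by rw [Fin.le_def]; omega) hcc.symm
        rw [trans_comm (i := i) (k := k) (j := j) (by intro e; rw [← e] at hkv; omega) (by intro e; rw [e] at hkv; omega) (by intro e; rw [e] at h; omega)]
        have h1 := hlow k i (by omega) (hck.trans hcc.symm)
        have h2 := ih k j (Or.inr (by omega)) hck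
        exact (((h1 _).mul (h2 _)).mul (h1 _)).mul (h2 _)
  intro i j hij hcc t
  rcases lt_trichotomy i.val j.val with h | h | h
  · exact main (j.val - i.val - 1) i j (Or.inl (by omega)) hcc t
  · exact absurd (Fin.ext h) hij
  · exact main (i.val - j.val - 1) i j (Or.inr (by omega)) hcc t

end P1e
end QInv


namespace QInv

section P1f
set_option linter.unusedSectionVars false

lemma ev_rename {K ι κ L : Type} [Field K] [Fintype ι] [DecidableEq ι] [Fintype κ] [DecidableEq κ] [CommRing L] [Algebra K L]
    (e : ι ≃ κ) (Y : Matrix κ κ L) (f : MvPolynomial (ι × ι) K) : ev Y (rename (Prod.map e e) f) = ev (Y.submatrix e e) f := by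
  unfold ev
  rw [aeval_rename]
  rfl

lemma CI_rename {K ι κ γ : Type} [Field K] [Fintype ι] [DecidableEq ι] [Fintype κ] [DecidableEq κ] (e : ι ≃ κ) (c : ι → γ)
    (f : MvPolynomial (ι × ι) K) (hf : CI c f) : CI (c ∘ e.symm) (rename (Prod.map e e) f) := by
  have key : ∀ D : Matrix κ κ K, Gd f (D.submatrix e e) → Gd (rename (Prod.map e e) f) D := by
    intro D h Y
    rw [ev_rename, ev_rename, ← submatrix_mul_equiv D Y e e e, ← submatrix_mul_equiv Y D e e e, h]
  constructor
  · intro d hd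
    apply key
    rw [submatrix_diagonal_equiv]
    exact hf.1 _ fun i => hd _
  · intro i j hij hc t
    apply key
    have : (transvection i j t).submatrix e e = transvection (e.symm i) (e.symm j) t := by
      ext k l
      simp only [transvection, submatrix_apply, Matrix.add_apply, Matrix.one_apply, Matrix.single_apply, Equiv.symm_apply_eq, EmbeddingLike.apply_eq_iff_eq]
    rw [this]
    exact hf.2 _ _ (fun h => hij (e.symm.injective h)) hc t

/-- splitting for arbitrary colours -/
lemma exists_split {K ι γ : Type} [Field K] [Infinite K] (p : ℕ) [Fact p.Prime] [CharP K p] [PerfectRing K p] [Fintype ι] [DecidableEq ι] [Fintype γ]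
    (c : ι → γ) : ∃ φ : MvPolynomial (ι × ι) K → MvPolynomial (ι × ι) K, (∀ f g, φ (f + g) = φ f + φ g) ∧ 
      (∀ f g, φ (f ^ p * g) = f * φ g) ∧ φ 1 = 1 ∧ ∀ f, CI c f → CI c (φ f) := by
  let u : ι → ℕ := fun k => (Fintype.equivFin γ (c k)).val
  have hu : ∀ k l, u k = u l → c k = c l := fun k l h => (Fintype.equivFin γ).injective (Fin.ext h)
  let e0 := Fintype.equivFin ι
  let e : ι ≃ Fin (Fintype.card ι) := e0.trans (Tuple.sort (u ∘ e0.symm)).symm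
  have hmono : Monotone (u ∘ e.symm) := Tuple.monotone_sort (u ∘ e0.symm)
  have hinv : ∀ f : MvPolynomial (ι × ι) K, rename (Prod.map e.symm e.symm) (rename (Prod.map e e) f) = f := by
    intro f
    rw [rename_rename, Prod.map_comp_map, Equiv.symm_comp_self, Prod.map_id, rename_id_apply]
  refine ⟨fun f => rename (Prod.map e.symm e.symm) (ph p (rename (Prod.map e e) f)), ?_, ?_, ?_, ?_⟩
  · intro f g; simp only [map_add, ph_add]
  · intro f g; simp only [map_mul, map_pow, ph_mul, hinv]
  · simp only [map_one, ph_one]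
  · intro f hf
    have h := CI_rename e.symm _ _ (ph_CI p (c ∘ e.symm) ?_ _ (CI_rename e c f hf))
    · have e1 : (c ∘ e.symm) ∘ e.symm.symm = c := by funext k; simp
      rwa [e1] at h
    · intro i j k h1 h2 h3
      apply hu
      have a1 := hmono h1
      have a2 := hmono h2
      have a3 : u (e.symm i) = u (e.symm j) := congrArg (fun x => (Fintype.equivFin γ x).val) h3
      simp only [Function.comp_apply] at a1 a2
      omega

variable {L : Type} [CommRing L] {ι : Type} [Fintype ι] [DecidableEq ι]

/-- coordinate inclusion matrix -/
def Jg (L : Type) [CommRing L] {β : Type} (g : β → ι) : Matrix ι β L := Matrix.of fun k u => if k = g u then 1 else 0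

lemma Jg_T_mul {β κ : Type} (g : β → ι) (M : Matrix ι κ L) (u : β) (l : κ) : ((Jg L g)ᵀ * M) u l = M (g u) l := by
  simp [Jg, mul_apply]

lemma mul_Jg {β κ : Type} (g : β → ι) (M : Matrix κ ι L) (u : β) (l : κ) : (M * Jg L g) l u = M l (g u) := by
  simp [Jg, mul_apply]

lemma Jg_inv {β : Type} [DecidableEq β] {g : β → ι} (hg : Function.Injective g) : (Jg L g)ᵀ * Jg L g = 1 := by
  ext u v
  rw [Jg_T_mul, Matrix.one_apply]
  simp [Jg, hg.eq_iff]

lemma Jg_dis {β β' : Type} {g : β → ι} {g' : β' → ι} (h : ∀ u v, g u ≠ g' v) : (Jg L g)ᵀ * Jg L g' = 0 := by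
  ext u v
  rw [Jg_T_mul]
  simp [Jg, h]

lemma Jg_block {β : Type} [Fintype β] [DecidableEq β] {g : β → ι} (D : Matrix ι ι L) 
    (h : ∀ u k, (∀ v, k ≠ g v) → D (g u) k = 0) (hg : Function.Injective g) : (Jg L g)ᵀ * D = (Jg L g)ᵀ * D * Jg L g * (Jg L g)ᵀ := by
  ext u k
  rw [Jg_T_mul, mul_apply]
  simp only [mul_Jg, Jg_T_mul, transpose_apply]
  simp only [Jg, of_apply]
  by_cases hk : ∃ v, k = g v
  · obtain ⟨v, rfl⟩ := hk
    simp [hg.eq_iff]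
  · push Not at hk
    rw [h u k hk]
    simp [hk]

lemma Jg_block' {β : Type} [Fintype β] [DecidableEq β] {g : β → ι} (D : Matrix ι ι L) 
    (h : ∀ u k, (∀ v, k ≠ g v) → D k (g u) = 0) (hg : Function.Injective g) : D * Jg L g = Jg L g * ((Jg L g)ᵀ * D * Jg L g) := by
  have := Jg_block Dᵀ (by intro u k hk; exact h u k hk) hg
  have := congrArg transpose this
  simpa [Matrix.mul_assoc] using this

/-- embedding of a block -/
def emb {β : Type} [Fintype β] [DecidableEq β] (g : β → ι) (A : Matrix β β L) : Matrix ι ι L := 1 + Jg L g * (A - 1) * (Jg L g)ᵀ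

lemma emb_mul {β : Type} [Fintype β] [DecidableEq β] {g : β → ι} (hg : Function.Injective g) (A B : Matrix β β L) :
    emb g (A * B) = emb g A * emb g B := by
  unfold emb
  set J := Jg L g
  have e : A * B - 1 = (A - 1) + (B - 1) + (A - 1) * (B - 1) := by noncomm_ring
  have e2 : J * (A - 1) * Jᵀ * (J * (B - 1) * Jᵀ) = J * ((A - 1) * (B - 1)) * Jᵀ := by
    calc _ = J * (A - 1) * (Jᵀ * J) * (B - 1) * Jᵀ := by simp only [Matrix.mul_assoc]
      _ = _ := by rw [Jg_inv hg]; simp only [Matrix.mul_assoc, Matrix.one_mul]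
  rw [add_mul, mul_add, mul_add, e2, e]
  simp only [mul_one, one_mul, Matrix.mul_add, Matrix.add_mul]
  abel

lemma emb_trans {β : Type} [Fintype β] [DecidableEq β] (g : β → ι) (i j : β) (t : L) :
    emb g (transvection i j t) = transvection (g i) (g j) t := by
  unfold emb transvection
  rw [add_sub_cancel_left]
  congr 1
  ext k l
  rw [mul_apply, Finset.sum_eq_single j]
  · rw [mul_apply, Finset.sum_eq_single i]
    · simp only [Jg, single_apply, transpose_apply, of_apply, eq_comm (a := g i) (b := k), eq_comm (a := g j) (b := l)]
      by_cases h1 : k = g i <;> by_cases h2 : l = g j <;> simp [h1, h2]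
    · intro b _ hb; simp [single_apply, hb.symm]
    · simp
  · intro b _ hb
    rw [mul_apply, Finset.sum_eq_zero, zero_mul]
    intro x _
    simp [single_apply, hb.symm]
  · simp

lemma emb_diag {β : Type} [Fintype β] [DecidableEq β] (g : β → ι) (d : β → L) :
    emb g (diagonal d) = diagonal (fun k => 1 + ∑ u, if k = g u then d u - 1 else 0) := by
  unfold emb
  have : diagonal d - 1 = diagonal (fun u => d u - 1) := by rw [← diagonal_one, diagonal_sub]
  rw [this]
  ext k l
  rw [Matrix.add_apply, mul_apply, diagonal_apply, Matrix.one_apply]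
  simp only [mul_diagonal, transpose_apply, Jg, of_apply]
  split_ifs with h
  · subst h
    congr 1
    refine Finset.sum_congr rfl fun u _ => ?_
    split_ifs <;> simp
  · rw [zero_add]
    refine Finset.sum_eq_zero fun u _ => ?_
    split_ifs with h1 h2
    · exact absurd (h1.trans h2.symm) h
    all_goals simp

variable {K : Type} [Field K]

lemma CI_emb {γ β : Type} [Fintype β] [DecidableEq β] {c : ι → γ} {F : MvPolynomial (ι × ι) K} (hF : CI c F) {g : β → ι} (hg : Function.Injective g)
    (hc : ∀ u v, c (g u) = c (g v)) (A : Matrix β β K) (hA : A.det ≠ 0) : Gd F (emb g A) := by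
  refine diagonal_transvection_induction_of_det_ne_zero (fun A => Gd F (emb g A)) A hA ?_ ?_ ?_
  · intro D hD
    rw [emb_diag]
    apply hF.1
    intro k
    by_cases hk : ∃ u, k = g u
    · obtain ⟨u, rfl⟩ := hk
      rw [Finset.sum_eq_single u]
      · rw [if_pos rfl, add_sub_cancel]
        rw [det_diagonal] at hD
        exact fun h => hD (Finset.prod_eq_zero (Finset.mem_univ u) h)
      · intro v _ hv; rw [if_neg]; exact fun h => hv (hg h).symm
      · simp
    · push Not at hk
      simp [hk]
  · intro t
    simp only [TransvectionStruct.toMatrix]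
    rw [emb_trans]
    exact hF.2 _ _ (fun h => t.hij (hg h)) (hc _ _) _
  · intro A B _ _ h1 h2
    rw [emb_mul hg]
    exact Gd.mul h1 h2

/-- block-diagonal matrix -/
def emS {δ : Type} {β : δ → Type} [∀ x, Fintype (β x)] [∀ x, DecidableEq (β x)] (g : ∀ x, β x → ι) (A : ∀ x, Matrix (β x) (β x) L) 
    (s : Finset δ) : Matrix ι ι L := 1 + ∑ x ∈ s, Jg L (g x) * (A x - 1) * (Jg L (g x))ᵀ

lemma CI_emS {γ δ : Type} {β : δ → Type} [∀ x, Fintype (β x)] [∀ x, DecidableEq (β x)] (g : ∀ x, β x → ι) (A : ∀ x, Matrix (β x) (β x) K)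
    {c : ι → γ} {F : MvPolynomial (ι × ι) K} (hF : CI c F) (hg : ∀ x, Function.Injective (g x)) (hc : ∀ x u v, c (g x u) = c (g x v))
    (hgd : ∀ x y, x ≠ y → ∀ u v, g x u ≠ g y v) (hA : ∀ x, (A x).det ≠ 0) (s : Finset δ) : Gd F (emS g A s) := by
  classical
  induction s using Finset.induction_on with
  | empty => simp only [emS, Finset.sum_empty, add_zero]; exact Gd.one
  | insert x s hx ih =>
    have e : emS g A (insert x s) = emb (g x) (A x) * emS g A s := by
      unfold emS emb
      rw [Finset.sum_insert hx, add_mul, one_mul, mul_add, mul_one, Finset.mul_sum, Finset.sum_eq_zero (s := s) (f := fun i => Jg K (g x) * (A x - 1) * (Jg K (g x))ᵀ * _)]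
      · abel
      · intro y hy
        have : x ≠ y := by rintro rfl; exact hx hy
        calc _ = Jg K (g x) * (A x - 1) * ((Jg K (g x))ᵀ * Jg K (g y)) * (A y - 1) * (Jg K (g y))ᵀ := by simp only [Matrix.mul_assoc]
          _ = 0 := by rw [Jg_dis (hgd x y this)]; simp
    rw [e]
    exact (CI_emb hF (hg x) (hc x) _ (hA x)).mul ih

lemma emS_J {δ : Type} [Fintype δ] {β : δ → Type} [∀ x, Fintype (β x)] [∀ x, DecidableEq (β x)] (g : ∀ x, β x → ι) (A : ∀ x, Matrix (β x) (β x) L)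
    (hg : ∀ x, Function.Injective (g x)) (hgd : ∀ x y, x ≠ y → ∀ u v, g x u ≠ g y v) (x : δ) :
    emS g A Finset.univ * Jg L (g x) = Jg L (g x) * A x := by
  classical
  unfold emS
  rw [Matrix.add_mul, Matrix.one_mul, Matrix.sum_mul, Finset.sum_eq_single x]
  · rw [Matrix.mul_assoc, Jg_inv (hg x), Matrix.mul_sub, Matrix.mul_one, Matrix.mul_one]; abel
  · intro y _ hy
    rw [Matrix.mul_assoc, Jg_dis (hgd y x hy), Matrix.mul_zero]
  · simp

lemma emS_J0 {δ : Type} [Fintype δ] {β : δ → Type} [∀ x, Fintype (β x)] [∀ x, DecidableEq (β x)] (g : ∀ x, β x → ι) (A : ∀ x, Matrix (β x) (β x) L)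
    {β' : Type} {g' : β' → ι} (h : ∀ x u v, g x u ≠ g' v) :
    emS g A Finset.univ * Jg L g' = Jg L g' := by
  unfold emS
  rw [Matrix.add_mul, Matrix.one_mul, Matrix.sum_mul, Finset.sum_eq_zero, add_zero]
  intro y _
  rw [Matrix.mul_assoc, Jg_dis (h y), Matrix.mul_zero]

lemma emS_T {δ : Type} [Fintype δ] {β : δ → Type} [∀ x, Fintype (β x)] [∀ x, DecidableEq (β x)] (g : ∀ x, β x → ι) (A : ∀ x, Matrix (β x) (β x) L) :
    (emS g A Finset.univ)ᵀ = emS g (fun x => (A x)ᵀ) Finset.univ := by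
  unfold emS
  simp [Matrix.transpose_sum, Matrix.mul_assoc]

end P1f
end QInv


namespace QInv

section P1g
set_option linter.unusedSectionVars false
variable {Q0 Q1 : Type} [Fintype Q0] [Fintype Q1] [DecidableEq Q0] [DecidableEq Q1] {ta ha : Q1 → Q0} {α : Q0 → ℕ}
variable {L : Type} [CommRing L] 

/-- big index set -/
abbrev Bi {Q0 Q1 : Type} (ta : Q1 → Q0) (α : Q0 → ℕ) : Type := ((i : Q0) × Fin (α i)) ⊕ ((a : Q1) × Fin (α (ta a)))

/-- colours -/
def cl (k : Bi ta α) : Q0 ⊕ Q1 := Sum.map Sigma.fst Sigma.fst k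

/-- left inclusion -/
def gl (ta : Q1 → Q0) (α : Q0 → ℕ) (i : Q0) (u : Fin (α i)) : Bi ta α := Sum.inl ⟨i, u⟩
/-- right inclusion -/
def gr (ta : Q1 → Q0) (α : Q0 → ℕ) (a : Q1) (u : Fin (α (ta a))) : Bi ta α := Sum.inr ⟨a, u⟩

lemma gl_inj (i : Q0) : Function.Injective (gl ta α i) := by
  intro u v h; simpa [gl] using h
lemma gr_inj (a : Q1) : Function.Injective (gr ta α a) := by
  intro u v h; simpa [gr] using h
lemma gl_dis (i j : Q0) (h : i ≠ j) (u v) : gl ta α i u ≠ gl ta α j v := by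
  intro e; simp only [gl, Sum.inl.injEq, Sigma.mk.injEq] at e; exact h e.1
lemma gr_dis (i j : Q1) (h : i ≠ j) (u v) : gr ta α i u ≠ gr ta α j v := by
  intro e; simp only [gr, Sum.inr.injEq, Sigma.mk.injEq] at e; exact h e.1
lemma glr_dis (i : Q0) (a : Q1) (u v) : gl ta α i u ≠ gr ta α a v := by
  intro e; simp [gl, gr] at e
lemma grl_dis (i : Q0) (a : Q1) (u v) : gr ta α a v ≠ gl ta α i u := (glr_dis i a u v).symm

/-- left inclusion matrix -/
def Jl (L : Type) [CommRing L] (ta : Q1 → Q0) (α : Q0 → ℕ) (i : Q0) : Matrix (Bi ta α) (Fin (α i)) L := Jg L (gl ta α i)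
/-- right inclusion matrix -/
def Jr (L : Type) [CommRing L] (ta : Q1 → Q0) (α : Q0 → ℕ) (a : Q1) : Matrix (Bi ta α) (Fin (α (ta a))) L := Jg L (gr ta α a)

lemma Jll (i : Q0) : (Jl L ta α i)ᵀ * Jl L ta α i = 1 := Jg_inv (gl_inj i)
lemma Jrr (i : Q1) : (Jr L ta α i)ᵀ * Jr L ta α i = 1 := Jg_inv (gr_inj i)
lemma Jrr0 (a b : Q1) (h : a ≠ b) : (Jr L ta α a)ᵀ * Jr L ta α b = 0 := Jg_dis (gr_dis a b h)
lemma Jlr (i : Q0) (a : Q1) : (Jl L ta α i)ᵀ * Jr L ta α a = 0 := Jg_dis (glr_dis i a)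
lemma Jrl (i : Q0) (a : Q1) : (Jr L ta α a)ᵀ * Jl L ta α i = 0 := Jg_dis (fun u v => grl_dis i a v u)

/-- representation from a matrix -/
def qv (Y : Matrix (Bi ta α) (Bi ta α) L) (a : Q1) : Matrix (Fin (α (ha a))) (Fin (α (ta a))) L :=
  ((Jl L ta α (ha a))ᵀ * Y * Jr L ta α a) * ((Jr L ta α a)ᵀ * Y * Jl L ta α (ta a))

/-- matrix from a representation -/
def sec (v : (a : Q1) → Matrix (Fin (α (ha a))) (Fin (α (ta a))) L) : Matrix (Bi ta α) (Bi ta α) L :=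
  ∑ a, (Jl L ta α (ha a) * v a * (Jr L ta α a)ᵀ + Jr L ta α a * (Jl L ta α (ta a))ᵀ)

lemma qv_sec (v : (a : Q1) → Matrix (Fin (α (ha a))) (Fin (α (ta a))) L) (a : Q1) : qv (ha := ha) (sec v) a = v a := by
  unfold qv
  have h1 : (Jl L ta α (ha a))ᵀ * sec v * Jr L ta α a = v a := by
    unfold sec
    rw [Matrix.mul_sum, Matrix.sum_mul, Finset.sum_eq_single a]
    · rw [Matrix.mul_add, Matrix.add_mul, ← Matrix.mul_assoc _ (Jr L ta α a), Jlr, Matrix.zero_mul, Matrix.zero_mul, add_zero,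
        Matrix.mul_assoc, Matrix.mul_assoc, Jrr, Matrix.mul_one, ← Matrix.mul_assoc, Jll, Matrix.one_mul]
    · intro b _ hb
      rw [Matrix.mul_add, Matrix.add_mul, ← Matrix.mul_assoc _ (Jr L ta α b), Jlr, Matrix.zero_mul, Matrix.zero_mul, add_zero,
        Matrix.mul_assoc, Matrix.mul_assoc, Jrr0 _ _ hb, Matrix.mul_zero, Matrix.mul_zero]
    · simp
  have h2 : (Jr L ta α a)ᵀ * sec v * Jl L ta α (ta a) = 1 := by
    unfold sec
    rw [Matrix.mul_sum, Matrix.sum_mul, Finset.sum_eq_single a]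
    · rw [Matrix.mul_add, Matrix.add_mul, ← Matrix.mul_assoc _ (Jr L ta α a), Jrr, Matrix.one_mul, Jll,
        Matrix.mul_assoc, Matrix.mul_assoc _ (Jr L ta α a)ᵀ, Jrl, Matrix.mul_zero, Matrix.mul_zero, zero_add]
    · intro b _ hb
      rw [Matrix.mul_add, Matrix.add_mul, ← Matrix.mul_assoc _ (Jr L ta α b), Jrr0 _ _ hb.symm, Matrix.zero_mul, Matrix.zero_mul, add_zero,
        Matrix.mul_assoc, Matrix.mul_assoc _ (Jr L ta α b)ᵀ, Jrl, Matrix.mul_zero, Matrix.mul_zero]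
    · simp
  rw [h1, h2, Matrix.mul_one]

/-- block matrix of a group element -/
def Dm (ta : Q1 → Q0) (A : (i : Q0) → Matrix (Fin (α i)) (Fin (α i)) L) : Matrix (Bi ta α) (Bi ta α) L :=
  emS (gl ta α) A Finset.univ * emS (gr ta α) (fun a => A (ta a)) Finset.univ

lemma Dm_l (A : (i : Q0) → Matrix (Fin (α i)) (Fin (α i)) L) (i : Q0) : Dm ta A * Jl L ta α i = Jl L ta α i * A i := by
  unfold Dm Jl
  rw [Matrix.mul_assoc, emS_J0 _ _ (fun a u v => grl_dis i a v u), emS_J _ _ gl_inj gl_dis]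

lemma Dm_r (A : (i : Q0) → Matrix (Fin (α i)) (Fin (α i)) L) (a : Q1) : Dm ta A * Jr L ta α a = Jr L ta α a * A (ta a) := by
  unfold Dm Jr
  rw [Matrix.mul_assoc, emS_J _ _ gr_inj gr_dis, ← Matrix.mul_assoc, emS_J0 _ _ (fun i u v => glr_dis i a u v)]

lemma Dm_lT (A : (i : Q0) → Matrix (Fin (α i)) (Fin (α i)) L) (i : Q0) : (Jl L ta α i)ᵀ * Dm ta A = A i * (Jl L ta α i)ᵀ := by
  apply Matrix.transpose_injective
  unfold Dm Jl
  simp only [Matrix.transpose_mul, Matrix.transpose_transpose, emS_T]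
  rw [Matrix.mul_assoc, emS_J _ _ gl_inj gl_dis, ← Matrix.mul_assoc, emS_J0 _ _ (fun a u v => grl_dis i a v u)]

lemma Dm_rT (A : (i : Q0) → Matrix (Fin (α i)) (Fin (α i)) L) (a : Q1) : (Jr L ta α a)ᵀ * Dm ta A = A (ta a) * (Jr L ta α a)ᵀ := by
  apply Matrix.transpose_injective
  unfold Dm Jr
  simp only [Matrix.transpose_mul, Matrix.transpose_transpose, emS_T]
  rw [Matrix.mul_assoc, emS_J0 _ _ (fun i u v => glr_dis i a u v), emS_J _ _ gr_inj gr_dis]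

lemma sec_conj (A B : (i : Q0) → Matrix (Fin (α i)) (Fin (α i)) L) (hAB : ∀ i, A i * B i = 1) (v : (a : Q1) → Matrix (Fin (α (ha a))) (Fin (α (ta a))) L) :
    Dm ta A * (sec v * Dm ta B) = sec (ha := ha) (fun a => A (ha a) * v a * B (ta a)) := by
  unfold sec
  rw [Matrix.sum_mul, Matrix.mul_sum]
  refine Finset.sum_congr rfl fun a _ => ?_
  rw [Matrix.add_mul, Matrix.mul_add]
  congr 1
  · rw [Matrix.mul_assoc _ _ (Dm ta B), Dm_rT, Matrix.mul_assoc _ (v a), ← Matrix.mul_assoc (Dm ta A), Dm_l]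
    simp only [Matrix.mul_assoc]
  · rw [Matrix.mul_assoc _ _ (Dm ta B), Dm_lT, ← Matrix.mul_assoc (Dm ta A), Dm_r, Matrix.mul_assoc, ← Matrix.mul_assoc (A (ta a)), hAB, Matrix.one_mul]

lemma sec_inv (A B : (i : Q0) → Matrix (Fin (α i)) (Fin (α i)) L) (hBA : ∀ i, B i * A i = 1) (v : (a : Q1) → Matrix (Fin (α (ha a))) (Fin (α (ta a))) L) :
    (sec v * Dm ta B) * Dm ta A = sec (ha := ha) v := by
  unfold sec
  rw [Matrix.sum_mul, Matrix.sum_mul]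
  refine Finset.sum_congr rfl fun a _ => ?_
  rw [Matrix.add_mul, Matrix.add_mul]
  congr 1
  · rw [Matrix.mul_assoc _ _ (Dm ta B), Dm_rT, Matrix.mul_assoc, Matrix.mul_assoc, Matrix.mul_assoc (B (ta a)), Dm_rT, ← Matrix.mul_assoc (B (ta a)), hBA, Matrix.one_mul, Matrix.mul_assoc]
  · rw [Matrix.mul_assoc _ _ (Dm ta B), Dm_lT, Matrix.mul_assoc, Matrix.mul_assoc, Dm_lT, ← Matrix.mul_assoc (B (ta a)), hBA, Matrix.one_mul]

variable {K : Type} [Field K]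

/-- encoding -/
noncomputable def enc : MvPolynomial (Rho ta ha α) K →ₐ[K] MvPolynomial (Bi ta α × Bi ta α) K :=
  aeval (rc (qv (ha := ha) (mvPolynomialX (Bi ta α) (Bi ta α) K)))

/-- retraction -/
noncomputable def ret : MvPolynomial (Bi ta α × Bi ta α) K →ₐ[K] MvPolynomial (Rho ta ha α) K :=
  ev (sec (ta := ta) (ha := ha) fun a => Matrix.of fun r s => X ⟨a, (r, s)⟩)

lemma Jg_map {L' ι β : Type} [CommRing L'] [Fintype ι] [DecidableEq ι] (θ : L →+* L') (g : β → ι) : (Jg L g).map θ = Jg L' g := by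
  ext k u; simp [Jg, apply_ite θ]

lemma qv_map {L' : Type} [CommRing L'] (θ : L →+* L') (Y : Matrix (Bi ta α) (Bi ta α) L) (a : Q1) :
    (qv (ha := ha) Y a).map θ = qv (Y.map θ) a := by
  unfold qv Jl Jr
  simp only [Matrix.map_mul, Matrix.transpose_map, Jg_map]

lemma sec_map {L' : Type} [CommRing L'] (θ : L →+* L') (v : (a : Q1) → Matrix (Fin (α (ha a))) (Fin (α (ta a))) L) :
    (sec v).map θ = sec (ha := ha) (fun a => (v a).map θ) := by
  unfold sec Jl Jr
  rw [← RingHom.mapMatrix_apply, map_sum]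
  refine Finset.sum_congr rfl fun a _ => ?_
  rw [map_add]
  simp only [RingHom.mapMatrix_apply, Matrix.map_mul, Matrix.transpose_map, Jg_map]

lemma ev_enc [Algebra K L] (Y : Matrix (Bi ta α) (Bi ta α) L) (f : MvPolynomial (Rho ta ha α) K) : ev Y (enc f) = aeval (rc (qv Y)) f := by
  unfold enc
  have : (ev Y : MvPolynomial (Bi ta α × Bi ta α) K →ₐ[K] L).comp (aeval (rc (qv (ha := ha) (mvPolynomialX (Bi ta α) (Bi ta α) K)))) = aeval (rc (qv (ha := ha) Y)) := by
    apply MvPolynomial.algHom_ext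
    intro x
    rw [AlgHom.comp_apply, aeval_X, aeval_X]
    unfold rc
    have h := qv_map (ha := ha) (ev Y : MvPolynomial (Bi ta α × Bi ta α) K →ₐ[K] L).toRingHom (mvPolynomialX (Bi ta α) (Bi ta α) K) x.1
    have h2 : (mvPolynomialX (Bi ta α) (Bi ta α) K).map (ev Y : MvPolynomial (Bi ta α × Bi ta α) K →ₐ[K] L).toRingHom = Y := ev_X Y
    rw [h2] at h
    exact congrFun (congrFun h x.2.1) x.2.2
  rw [← this]; rfl

lemma aeval_ret (v : (a : Q1) → Matrix (Fin (α (ha a))) (Fin (α (ta a))) K) (F : MvPolynomial (Bi ta α × Bi ta α) K) :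
    aeval (rc v) (ret (ha := ha) F) = ev (sec v) F := by
  unfold ret
  rw [ev_map]
  have h := sec_map (aeval (rc v) : MvPolynomial (Rho ta ha α) K →ₐ[K] K).toRingHom (fun a => Matrix.of fun r s => X ⟨a, (r, s)⟩)
  have h2 : (fun a => (Matrix.of fun r s => (X ⟨a, (r, s)⟩ : MvPolynomial (Rho ta ha α) K)).map (aeval (rc v) : MvPolynomial (Rho ta ha α) K →ₐ[K] K).toRingHom) = v := by
    funext a; ext r s; simp [rc]
  rw [h2] at h
  rw [← h]; rfl

lemma ret_enc (f : MvPolynomial (Rho ta ha α) K) : ret (enc f) = f := by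
  unfold ret
  rw [ev_enc]
  have : rc (qv (ha := ha) (sec (ta := ta) (ha := ha) fun a => Matrix.of fun r s => (X ⟨a, (r, s)⟩ : MvPolynomial (Rho ta ha α) K))) = X := by
    funext x
    unfold rc
    rw [qv_sec]; rfl
  rw [this, aeval_X_left_apply]

lemma ret_qi (F : MvPolynomial (Bi ta α × Bi ta α) K) (hF : CI cl F) : ret F ∈ quiverInvariants K ta ha α := by
  rw [mem_qi]
  intro A B hAB v
  have hBA : ∀ i, B i * A i = 1 := fun i => mul_eq_one_comm.mp (hAB i)
  have hdet : ∀ i, (A i).det ≠ 0 := fun i h => by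
    have := congrArg det (hAB i)
    rw [det_mul, h, zero_mul, det_one] at this
    exact zero_ne_one this
  have hG : Gd F (Dm ta A) := by
    unfold Dm
    refine Gd.mul (CI_emS (gl ta α) A hF gl_inj ?_ gl_dis hdet _) (CI_emS (gr ta α) _ hF gr_inj ?_ gr_dis (fun a => hdet (ta a)) _)
    · intro x u v; rfl
    · intro x u v; rfl
  rw [aeval_ret, aeval_ret, ← sec_conj A B hAB, hG, sec_inv A B hBA]

lemma enc_Gd (f : MvPolynomial (Rho ta ha α) K) (hf : f ∈ quiverInvariants K ta ha α) (D D' : Matrix (Bi ta α) (Bi ta α) K)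
    (h1 : D * D' = 1) (hD : ∀ k l, cl k ≠ cl l → D k l = 0) (hD' : ∀ k l, cl k ≠ cl l → D' k l = 0) : Gd (enc f) D := by
  have h2 : D' * D = 1 := mul_eq_one_comm.mp h1
  rw [mem_qi] at hf
  refine Gd_of h1 fun Y => ?_
  rw [ev_enc, ev_enc]
  have cgl : ∀ i u k, (∀ w, k ≠ gl ta α i w) → cl (gl ta α i u) ≠ cl k := by
    rintro i u (⟨j, w⟩ | ⟨b, w⟩) hk e
    · simp only [cl, gl, Sum.map_inl, Sum.inl.injEq] at e
      subst e; exact hk w rfl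
    · simp [cl, gl] at e
  have cgr : ∀ i u k, (∀ w, k ≠ gr ta α i w) → cl (gr ta α i u) ≠ cl k := by
    rintro i u (⟨j, w⟩ | ⟨b, w⟩) hk e
    · simp [cl, gr] at e
    · simp only [cl, gr, Sum.map_inr, Sum.inr.injEq] at e
      subst e; exact hk w rfl
  have b1 : ∀ i, (Jl K ta α i)ᵀ * D = (Jl K ta α i)ᵀ * D * Jl K ta α i * (Jl K ta α i)ᵀ := fun i =>
    Jg_block D (fun u k hk => hD _ _ (cgl i u k hk)) (gl_inj i)
  have b2 : ∀ i, (Jr K ta α i)ᵀ * D = (Jr K ta α i)ᵀ * D * Jr K ta α i * (Jr K ta α i)ᵀ := fun i =>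
    Jg_block D (fun u k hk => hD _ _ (cgr i u k hk)) (gr_inj i)
  have b3 : ∀ i, D' * Jl K ta α i = Jl K ta α i * ((Jl K ta α i)ᵀ * D' * Jl K ta α i) := fun i =>
    Jg_block' D' (fun u k hk => hD' _ _ (cgl i u k hk).symm) (gl_inj i)
  have b4 : ∀ i, D' * Jr K ta α i = Jr K ta α i * ((Jr K ta α i)ᵀ * D' * Jr K ta α i) := fun i =>
    Jg_block' D' (fun u k hk => hD' _ _ (cgr i u k hk).symm) (gr_inj i)
  have hA : ∀ i, ((Jl K ta α i)ᵀ * D * Jl K ta α i) * ((Jl K ta α i)ᵀ * D' * Jl K ta α i) = 1 := by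
    intro i
    rw [Matrix.mul_assoc _ (Jl K ta α i), ← b3, Matrix.mul_assoc, ← Matrix.mul_assoc D, h1, Matrix.one_mul, Jll]
  have hC : ∀ a, (D' * Jr K ta α a) * ((Jr K ta α a)ᵀ * D) = Jr K ta α a * (Jr K ta α a)ᵀ := by
    intro a
    have e1 : ((Jr K ta α a)ᵀ * D' * Jr K ta α a) * ((Jr K ta α a)ᵀ * D * Jr K ta α a) = 1 := by
      apply mul_eq_one_comm.mp
      rw [Matrix.mul_assoc _ (Jr K ta α a), ← b4, Matrix.mul_assoc, ← Matrix.mul_assoc D, h1, Matrix.one_mul, Jrr]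
    rw [b4, b2, Matrix.mul_assoc (Jr K ta α a), ← Matrix.mul_assoc _ _ (Jr K ta α a)ᵀ, e1, Matrix.one_mul]
  rw [← hf _ _ hA (qv (ha := ha) Y)]
  congr 3
  funext a
  unfold qv
  have e1 : (Jl K ta α (ha a))ᵀ * (D * Y * D') * Jr K ta α a = ((Jl K ta α (ha a))ᵀ * D) * Y * (D' * Jr K ta α a) := by
    simp only [Matrix.mul_assoc]
  have e2 : (Jr K ta α a)ᵀ * (D * Y * D') * Jl K ta α (ta a) = ((Jr K ta α a)ᵀ * D) * (Y * (D' * Jl K ta α (ta a))) := by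
    simp only [Matrix.mul_assoc]
  rw [e1, e2, Matrix.mul_assoc _ (D' * Jr K ta α a), ← Matrix.mul_assoc (D' * Jr K ta α a), hC, b1, b3]
  simp only [Matrix.mul_assoc]
  rw [← Matrix.mul_assoc (Jl K ta α (ha a))ᵀ (Jl K ta α (ha a)), Jll, Matrix.one_mul]

lemma enc_CI (f : MvPolynomial (Rho ta ha α) K) (hf : f ∈ quiverInvariants K ta ha α) : CI cl (enc f) := by
  constructor
  · intro d hd
    refine enc_Gd f hf _ (diagonal fun i => (d i)⁻¹) ?_ ?_ ?_
    · rw [diagonal_mul_diagonal, ← diagonal_one]; congr 1; funext i; simp [hd i]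
    · intro k l h; rw [diagonal_apply_ne]; rintro rfl; exact h rfl
    · intro k l h; rw [diagonal_apply_ne]; rintro rfl; exact h rfl
  · intro i j hij hc t
    have : ∀ s : K, ∀ k l : Bi ta α, cl k ≠ cl l → transvection i j s k l = 0 := by
      intro s k l h
      rw [transvection, Matrix.add_apply, Matrix.one_apply_ne (by rintro rfl; exact h rfl), zero_add, Matrix.single_apply, if_neg]
      rintro ⟨rfl, rfl⟩; exact h hc
    exact enc_Gd f hf _ (transvection i j (-t)) (trans_inv hij t) (this _) (this _)

theorem P1main [Infinite K] (p : ℕ) [Fact p.Prime] [CharP K p] [PerfectRing K p] (ta ha : Q1 → Q0) (α : Q0 → ℕ) :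
    ∃ φ : MvPolynomial (Rho ta ha α) K → MvPolynomial (Rho ta ha α) K, (∀ f g, φ (f + g) = φ f + φ g) ∧ 
      (∀ f g, φ (f ^ p * g) = f * φ g) ∧ φ 1 = 1 ∧ ∀ f ∈ quiverInvariants K ta ha α, φ f ∈ quiverInvariants K ta ha α := by
  obtain ⟨φ, h1, h2, h3, h4⟩ := exists_split (K := K) p (cl (ta := ta) (α := α))
  refine ⟨fun f => ret (φ (enc f)), ?_, ?_, ?_, ?_⟩
  · intro f g; simp only [map_add, h1]
  · intro f g; simp only [map_mul, map_pow, h2, ret_enc]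
  · simp only [map_one, h3]
  · intro f hf; exact ret_qi _ (h4 _ (enc_CI f hf))

end P1g
end QInv


namespace QInv

section Glue
set_option linter.unusedSectionVars false
variable {Q0 Q1 : Type} [Fintype Q0] [Fintype Q1]

lemma card_Rho_le (ta ha : Q1 → Q0) (α : Q0 → ℕ) :
    Fintype.card (Rho ta ha α) ≤ Fintype.card Q1 * (∑ i, α i) ^ 2 := by
  have h : ∀ i, α i ≤ ∑ i, α i := fun i => Finset.single_le_sum (f := α) (fun _ _ => Nat.zero_le _) (Finset.mem_univ i)
  simp only [Rho, Fintype.card_sigma, Fintype.card_prod, Fintype.card_fin]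
  calc ∑ a : Q1, α (ha a) * α (ta a) ≤ ∑ a : Q1, (∑ i, α i) ^ 2 := by
        refine Finset.sum_le_sum fun a _ => ?_
        rw [pow_two]; exact Nat.mul_le_mul (h _) (h _)
    _ = _ := by simp

theorem charP_main (K : Type) [Field K] [IsAlgClosed K] (p : ℕ) [Fact p.Prime] [CharP K p]
    (ta ha : Q1 → Q0) (α : Q0 → ℕ) :
    quiverInvariants K ta ha α ≤ Algebra.adjoin K {f | f ∈ quiverInvariants K ta ha α ∧
      ∃ d ≤ (Fintype.card Q1 + 1) * (∑ i, α i) ^ 4, f.IsHomogeneous d} := by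
  classical
  haveI : Infinite K := IsAlgClosed.instInfinite
  haveI : ExpChar K p := ExpChar.prime Fact.out
  haveI : PerfectRing K p := inferInstance
  have hc := card_Rho_le ta ha α
  rcases Nat.eq_zero_or_pos (∑ i, α i) with h0 | h0
  · intro f hf
    have : IsEmpty (Rho ta ha α) := by
      rw [← Fintype.card_eq_zero_iff]; rw [h0] at hc; simpa using hc
    refine Algebra.subset_adjoin ⟨hf, 0, Nat.zero_le _, ?_⟩
    obtain ⟨c, rfl⟩ := MvPolynomial.C_surjective (R := K) (Rho ta ha α) f
    exact isHomogeneous_C _ _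
  · have hN : Fintype.card (Nn α) = ∑ i, α i := by simp [Nn]
    obtain ⟨φ, h1, h2, h3, h4⟩ := P1main (K := K) p ta ha α
    have := P3main p (Fact.out : p.Prime).one_lt (quiverInvariants K ta ha α) (fun f hf d => qi_graded f hf d) φ h1 h2 h3 h4
      ((∑ i, α i) ^ 2) (by positivity) (GT K ta ha α) (fun g hg => GT_mem g hg)
      (fun g hg => by have := GT_deg g hg; rwa [hN] at this) (fun f hf => GT_int f hf)
    refine this.trans (Algebra.adjoin_mono ?_)
    rintro f ⟨hf, d, hd, hh⟩
    refine ⟨hf, d, hd.trans ?_, hh⟩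
    calc _ ≤ (Fintype.card Q1 * (∑ i, α i) ^ 2 + (∑ i, α i) ^ 2) * (∑ i, α i) ^ 2 := by
          refine Nat.mul_le_mul_right _ (Nat.add_le_add hc ?_)
          exact Nat.one_le_pow _ _ h0
      _ = _ := by ring

end Glue
end QInv

/-- The ring of quiver invariants `I(Q,α)` is generated by its homogeneous
elements of degree `≤ (M+1) * N^4`, where `M` is the number of arrows and `N = ∑ i, α i`. -/
theorem stmt_4 (K : Type) [Field K] [IsAlgClosed K] {Q0 Q1 : Type} [Fintype Q0] [Fintype Q1]
    (ta ha : Q1 → Q0) (α : Q0 → ℕ) (M N : ℕ)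
    (hM : M = Fintype.card Q1) (hN : N = ∑ i, α i) :
    Algebra.adjoin K
        {f | f ∈ quiverInvariants K ta ha α ∧ ∃ d ≤ (M + 1) * N ^ 4, f.IsHomogeneous d}
      = quiverInvariants K ta ha α := by
  subst hM hN
  refine le_antisymm (Algebra.adjoin_le fun f hf => hf.1) ?_
  obtain ⟨p, hp⟩ := CharP.exists K
  rcases CharP.char_is_prime_or_zero K p with h | h
  · haveI : Fact p.Prime := ⟨h⟩
    exact QInv.charP_main K p ta ha α
  · subst h
    haveI : CharZero K := CharP.charP_to_charZero K
    refine QInv.P4main _ (fun p _ => ?_) K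
    haveI : CharP (AlgebraicClosure (ZMod p)) p := charP_of_injective_algebraMap (algebraMap (ZMod p) _).injective p
    exact QInv.charP_main _ p ta ha α
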